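/- arXiv:2006.11369 — 3 statements merged into one kernel-verified Lean document; each statement's English description precedes it below -/
import Mathlib

section
/- Let H be the disjoint union of two edges (H = K₂ + K₂) and fix p ∈ (0,1). Sample G ~ G(n,p), let X_H be the subgraph count of H in G, and let σ_H be the standard deviation of X_H. Then there exists a constant c = c(p) > 0 such that for all sufficiently large n, sup_{x ∈ ℤ} ℙ[X_H = x] ≥ c·n^{1/2}·σ_H^{−1}. In particular, anticoncentration of X_H at the optimal scale σ_H^{−1} fails by a polynomial factor. -/
open MeasureTheory ProbabilityTheory
open scoped ENNReal NNReal

noncomputable section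

/-- The standard normal density. -/
def stdNormal (z : ℝ) : ℝ := (Real.sqrt (2 * Real.pi))⁻¹ * Real.exp (-(z ^ 2) / 2)

/-- The uniform probability measure on a subset of a finite type. -/
def finUniform {γ : Type*} [Fintype γ] [MeasurableSpace γ] (s : Set γ) : Measure γ :=
  (Nat.card s : ℝ≥0∞)⁻¹ • ∑ a : γ, s.indicator (fun _ => (1 : ℝ≥0∞)) a • Measure.dirac a

/-- The product Bernoulli(p) measure on `ι → Bool`. -/
def bernoulliPi (ι : Type*) [Fintype ι] [DecidableEq ι] (p : ℝ) : Measure (ι → Bool) :=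
  ∑ x : ι → Bool, (∏ i : ι, ENNReal.ofReal (if x i then p else 1 - p)) • Measure.dirac x

/-- The Erdős–Rényi G(n,p) measure, as a measure on edge-indicator functions. -/
def gnp (n : ℕ) (p : ℝ) : Measure (Sym2 (Fin n) → Bool) := bernoulliPi _ p

/-- The G(n,m) measure: uniform over edge-indicator functions with exactly `m` edges
(diagonal coordinates forced to `false`). -/
def gnm (n m : ℕ) : Measure (Sym2 (Fin n) → Bool) :=
  finUniform {x | (∀ e : Sym2 (Fin n), e.IsDiag → x e = false) ∧
    (Finset.univ.filter fun e : Sym2 (Fin n) => x e = true).card = m}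

/-- The simple graph associated to an edge-indicator function. -/
def graphOfFn {n : ℕ} (x : Sym2 (Fin n) → Bool) : SimpleGraph (Fin n) :=
  SimpleGraph.fromRel fun i j => x s(i, j)

/-- The number of subgraphs of `G` isomorphic to `H`: the number of edge subsets of `G`
which are the image of the edge set of `H` under an injection of the vertices. -/
def subgraphCount {β : Type*} [Fintype β] (H : SimpleGraph β) {n : ℕ}
    (G : SimpleGraph (Fin n)) : ℕ :=
  Nat.card {E : Finset (Sym2 (Fin n)) // ↑E ⊆ G.edgeSet ∧
    ∃ f : β ↪ Fin n, (↑E : Set (Sym2 (Fin n))) = Sym2.map f '' H.edgeSet}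

/-- The number of induced copies of `H` in `G`: the number of vertex subsets `U` of the
correct size such that `G[U]` is isomorphic to `H`. -/
def inducedCount {β : Type*} [Fintype β] (H : SimpleGraph β) {n : ℕ}
    (G : SimpleGraph (Fin n)) : ℕ :=
  Nat.card {U : Finset (Fin n) // U.card = Fintype.card β ∧
    Nonempty (H ≃g (G.induce (↑U : Set (Fin n))))}

end

/-- The disjoint union of two edges, `K₂ + K₂`, as a graph on 4 vertices. -/
def twoEdges : SimpleGraph (Fin 4) :=
  SimpleGraph.fromRel fun i j => (i = 0 ∧ j = 1) ∨ (i = 2 ∧ j = 3)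

noncomputable section absprob

variable {ι : Type*} [Fintype ι] [DecidableEq ι]

def wt (p : ℝ) (x : ι → Bool) : ℝ := ∏ i, (if x i then p else 1 - p)

def EE (p : ℝ) (F : (ι → Bool) → ℝ) : ℝ := ∑ x, wt p x * F x

def bx (i : ι) (x : ι → Bool) : ℝ := if x i then 1 else 0

def xi (p : ℝ) (i : ι) (x : ι → Bool) : ℝ := bx i x - p

theorem wt_nonneg {p : ℝ} (h0 : 0 ≤ p) (h1 : p ≤ 1) (x : ι → Bool) : 0 ≤ wt p x := by
  unfold wt
  refine Finset.prod_nonneg fun i _ => ?_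
  split_ifs <;> linarith

theorem EE_one (p : ℝ) : EE (ι := ι) p (fun _ => 1) = 1 := by
  unfold EE wt
  have := (Finset.prod_univ_sum (fun _ : ι => (Finset.univ : Finset Bool))
    (fun _ b => if b then p else 1 - p)).symm
  rw [Fintype.piFinset_univ] at this
  simpa using this

theorem EE_add (p : ℝ) (F G : (ι → Bool) → ℝ) :
    EE p (fun x => F x + G x) = EE p F + EE p G := by
  simp [EE, mul_add, Finset.sum_add_distrib]

theorem EE_sub (p : ℝ) (F G : (ι → Bool) → ℝ) :
    EE p (fun x => F x - G x) = EE p F - EE p G := by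
  simp [EE, mul_sub, Finset.sum_sub_distrib]

theorem EE_cmul (p c : ℝ) (F : (ι → Bool) → ℝ) :
    EE p (fun x => c * F x) = c * EE p F := by
  simp only [EE, Finset.mul_sum]
  exact Finset.sum_congr rfl fun _ _ => by ring

theorem EE_const (p c : ℝ) : EE (ι := ι) p (fun _ => c) = c := by
  have := EE_cmul (ι := ι) p c (fun _ => 1)
  simpa [EE_one] using this

theorem EE_sum {κ : Type*} (p : ℝ) (s : Finset κ) (F : κ → (ι → Bool) → ℝ) :
    EE p (fun x => ∑ k ∈ s, F k x) = ∑ k ∈ s, EE p (F k) := by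
  simp only [EE, Finset.mul_sum]
  exact Finset.sum_comm

theorem EE_mono {p : ℝ} (h0 : 0 ≤ p) (h1 : p ≤ 1) {F G : (ι → Bool) → ℝ}
    (h : ∀ x, F x ≤ G x) : EE p F ≤ EE p G :=
  Finset.sum_le_sum fun x _ => mul_le_mul_of_nonneg_left (h x) (wt_nonneg h0 h1 x)

theorem wt_split (p : ℝ) (i : ι) (x : ι → Bool) :
    wt p x = (if x i then p else 1 - p) * ∏ j ∈ Finset.univ.erase i, (if x j then p else 1 - p) := by
  unfold wt
  rw [Finset.mul_prod_erase _ (fun j => if x j then p else 1 - p) (Finset.mem_univ i)]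

theorem EE_xi_zero (p : ℝ) (i : ι) (F : (ι → Bool) → ℝ)
    (hF : ∀ x b, F (Function.update x i b) = F x) :
    EE p (fun x => xi p i x * F x) = 0 := by
  unfold EE
  refine Finset.sum_involution (fun x _ => Function.update x i (!x i)) ?_ ?_ ?_ ?_
  · intro x _
    beta_reduce
    rw [hF, wt_split p i x, wt_split p i (Function.update x i _)]
    have : ∏ j ∈ Finset.univ.erase i, (if Function.update x i (!x i) j then p else 1 - p)
        = ∏ j ∈ Finset.univ.erase i, (if x j then p else 1 - p) := by
      refine Finset.prod_congr rfl fun j hj => ?_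
      rw [Function.update_of_ne (Finset.ne_of_mem_erase hj)]
    rw [this]
    unfold xi bx
    cases h : x i <;> simp <;> ring
  · intro x _ _ h
    have := congrFun h i
    simp at this
  · intro x _; exact Finset.mem_univ _
  · intro x _; simp

theorem xi_update (p : ℝ) {i j : ι} (h : j ≠ i) (x : ι → Bool) (b : Bool) :
    xi p j (Function.update x i b) = xi p j x := by
  simp [xi, bx, Function.update_of_ne h]

theorem EE_xi (p : ℝ) (i : ι) : EE p (xi p i) = 0 := by
  have := EE_xi_zero p i (fun _ => 1) (fun _ _ => rfl)
  simpa using this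

theorem xi_sq (p : ℝ) (i : ι) (x : ι → Bool) :
    xi p i x * xi p i x = (1 - 2 * p) * xi p i x + p * (1 - p) := by
  unfold xi bx
  split_ifs <;> ring

theorem xi_abs {p : ℝ} (h0 : 0 ≤ p) (h1 : p ≤ 1) (i : ι) (x : ι → Bool) :
    |xi p i x| ≤ 1 := by
  unfold xi bx
  rw [abs_le]
  split_ifs <;> constructor <;> linarith

theorem EE_xi2 (p : ℝ) (i j : ι) :
    EE p (fun x => xi p i x * xi p j x) = if i = j then p * (1 - p) else 0 := by
  split_ifs with h
  · subst h
    simp only [xi_sq]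
    rw [EE_add, EE_cmul, EE_xi, EE_const]; ring
  · exact EE_xi_zero p i _ (fun x b => xi_update p (Ne.symm h) x b)

theorem EE_xi3 (p : ℝ) (i j k : ι) (hij : i ≠ j) :
    EE p (fun x => xi p i x * xi p j x * xi p k x) = 0 := by
  by_cases h : i = k
  · have := EE_xi_zero p j (fun x => xi p i x * xi p k x)
      (fun x b => by rw [xi_update p hij, xi_update p (h ▸ hij)])
    rw [← this]; congr 1; funext x; ring
  · have := EE_xi_zero p i (fun x => xi p j x * xi p k x)
      (fun x b => by rw [xi_update p hij.symm, xi_update p (Ne.symm h)])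
    rw [← this]; congr 1; funext x; ring

theorem EE_xi4 (p : ℝ) (i j k l : ι) (hij : i ≠ j) (hkl : k ≠ l)
    (h1 : ¬ (k = i ∧ l = j)) (h2 : ¬ (k = j ∧ l = i)) :
    EE p (fun x => (xi p i x * xi p j x) * (xi p k x * xi p l x)) = 0 := by
  by_cases h : i ≠ k ∧ i ≠ l
  · have := EE_xi_zero p i (fun x => xi p j x * (xi p k x * xi p l x))
      (fun x b => by rw [xi_update p hij.symm, xi_update p h.1.symm, xi_update p h.2.symm])
    rw [← this]; congr 1; funext x; ring
  · have hj : j ≠ k ∧ j ≠ l := by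
      grind
    have := EE_xi_zero p j (fun x => xi p i x * (xi p k x * xi p l x))
      (fun x b => by rw [xi_update p hij, xi_update p hj.1.symm, xi_update p hj.2.symm])
    rw [← this]; congr 1; funext x; ring

def LL (p : ℝ) (s : Finset ι) (x : ι → Bool) : ℝ := ∑ i ∈ s, xi p i x

def YY (p : ℝ) (T : Finset (ι × ι)) (x : ι → Bool) : ℝ := ∑ t ∈ T, xi p t.1 x * xi p t.2 x

theorem EE_LL (p : ℝ) (s : Finset ι) : EE p (LL p s) = 0 := by
  have := EE_sum p s (fun i => xi p i)
  simp only [EE_xi, Finset.sum_const_zero] at this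
  exact this

theorem EE_LL_sq {p : ℝ} (h0 : 0 ≤ p) (h1 : p ≤ 1) (s : Finset ι) :
    EE p (fun x => LL p s x ^ 2) ≤ s.card := by
  have e : (fun x => LL p s x ^ 2) = fun x => ∑ i ∈ s, ∑ j ∈ s, xi p i x * xi p j x := by
    funext x; rw [sq, LL, Finset.sum_mul_sum]
  rw [e, EE_sum]
  have : ∀ i ∈ s, EE p (fun x => ∑ j ∈ s, xi p i x * xi p j x) ≤ 1 := by
    intro i hi
    rw [EE_sum]
    simp only [EE_xi2]
    rw [Finset.sum_ite_eq]
    simp only [hi, if_true]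
    nlinarith
  simpa using Finset.sum_le_sum this

theorem EE_YY_sq {p : ℝ} (h0 : 0 ≤ p) (h1 : p ≤ 1) (T : Finset (ι × ι))
    (hT : ∀ t ∈ T, t.1 ≠ t.2) :
    EE p (fun x => YY p T x ^ 2) ≤ 2 * T.card := by
  have e : (fun x => YY p T x ^ 2) = fun x => ∑ s ∈ T, ∑ t ∈ T,
      (xi p s.1 x * xi p s.2 x) * (xi p t.1 x * xi p t.2 x) := by
    funext x; rw [sq, YY, Finset.sum_mul_sum]
  rw [e, EE_sum]
  have : ∀ s ∈ T, EE p (fun x => ∑ t ∈ T,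
      (xi p s.1 x * xi p s.2 x) * (xi p t.1 x * xi p t.2 x)) ≤ 2 := by
    intro s hs
    rw [EE_sum]
    have hle : ∀ t ∈ T, EE p (fun x => (xi p s.1 x * xi p s.2 x) * (xi p t.1 x * xi p t.2 x))
        ≤ (if t = s then 1 else 0) + (if t = (s.2, s.1) then 1 else 0) := by
      intro t ht
      have hone : EE p (fun x => (xi p s.1 x * xi p s.2 x) * (xi p t.1 x * xi p t.2 x)) ≤ 1 := by
        rw [← EE_one (ι := ι) p]
        refine EE_mono h0 h1 fun x => ?_
        refine (le_abs_self _).trans ?_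
        rw [abs_mul, abs_mul, abs_mul]
        have a := xi_abs h0 h1 s.1 x
        have b := xi_abs h0 h1 s.2 x
        have c := xi_abs h0 h1 t.1 x
        have d := xi_abs h0 h1 t.2 x
        exact mul_le_one₀ (mul_le_one₀ a (abs_nonneg _) b) (by positivity)
          (mul_le_one₀ c (abs_nonneg _) d)
      by_cases ha : t = s
      · rw [if_pos ha]; split_ifs <;> linarith
      by_cases hb : t = (s.2, s.1)
      · rw [if_pos hb]; split_ifs <;> linarith
      rw [if_neg ha, if_neg hb, EE_xi4 p _ _ _ _ (hT s hs) (hT t ht)]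
      · simp
      · rintro ⟨h, h'⟩; exact ha (Prod.ext h h')
      · rintro ⟨h, h'⟩; exact hb (Prod.ext h h')
    refine (Finset.sum_le_sum hle).trans ?_
    rw [Finset.sum_add_distrib, Finset.sum_ite_eq', Finset.sum_ite_eq']
    split_ifs <;> norm_num
  have := Finset.sum_le_sum this
  simpa [mul_comm] using this

theorem EE_pair_LL (p : ℝ) (s : Finset ι) (i j : ι) (hi : i ∈ s) (hj : j ∈ s) (hij : i ≠ j) :
    EE p (fun x => bx i x * bx j x * LL p s x) = 2 * p ^ 2 * (1 - p) := by
  have e : (fun x => bx i x * bx j x * LL p s x) = fun x => ∑ k ∈ s,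
      (xi p i x * xi p j x * xi p k x + (p * (xi p i x * xi p k x)
        + (p * (xi p j x * xi p k x) + p ^ 2 * xi p k x))) := by
    funext x; rw [LL, Finset.mul_sum]
    refine Finset.sum_congr rfl fun k _ => ?_
    unfold xi; ring
  rw [e, EE_sum]
  simp only [EE_add, EE_cmul, EE_xi, EE_xi2, EE_xi3 p i j _ hij]
  simp [Finset.sum_add_distrib, ← Finset.mul_sum, hi, hj]
  ring

/-- Covariance lower bound. -/
theorem var_lower {p : ℝ} (h0 : 0 ≤ p) (h1 : p ≤ 1) (s : Finset ι) (D : Finset (ι × ι))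
    (hD : ∀ t ∈ D, t.1 ∈ s ∧ t.2 ∈ s ∧ t.1 ≠ t.2) (X : (ι → Bool) → ℝ)
    (hX : ∀ x, 2 * X x = ∑ t ∈ D, bx t.1 x * bx t.2 x) (m : ℝ) :
    (D.card * (p ^ 2 * (1 - p))) ^ 2 ≤ EE p (fun x => (X x - m) ^ 2) * s.card := by
  have hcov : EE p (fun x => (X x - m) * LL p s x) = D.card * (p ^ 2 * (1 - p)) := by
    have e : (fun x => (X x - m) * LL p s x) = fun x =>
        (1/2) * (∑ t ∈ D, bx t.1 x * bx t.2 x * LL p s x) - m * LL p s x := by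
      funext x; rw [← Finset.sum_mul, ← hX]; ring
    rw [e, EE_sub, EE_cmul, EE_cmul, EE_LL, EE_sum]
    rw [Finset.sum_congr rfl (fun t ht => EE_pair_LL p s t.1 t.2 (hD t ht).1 (hD t ht).2.1
      (hD t ht).2.2)]
    simp; ring
  rw [← hcov]
  have cs := Finset.sum_mul_sq_le_sq_mul_sq (Finset.univ : Finset (ι → Bool))
    (fun x => Real.sqrt (wt p x) * (X x - m)) (fun x => Real.sqrt (wt p x) * LL p s x)
  have hs : ∀ x : ι → Bool, Real.sqrt (wt p x) * Real.sqrt (wt p x) = wt p x :=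
    fun x => Real.mul_self_sqrt (wt_nonneg h0 h1 x)
  have e1 : ∀ x : ι → Bool, Real.sqrt (wt p x) * (X x - m) * (Real.sqrt (wt p x) * LL p s x)
      = wt p x * ((X x - m) * LL p s x) := fun x => by linear_combination ((X x - m) * LL p s x) * hs x
  have e2 : ∀ (x : ι → Bool) (F : ℝ), (Real.sqrt (wt p x) * F) ^ 2 = wt p x * F ^ 2 :=
    fun x F => by rw [mul_pow, sq (Real.sqrt _), hs]
  simp only [e1, e2] at cs
  refine le_trans cs ?_
  refine mul_le_mul_of_nonneg_left (EE_LL_sq h0 h1 s) ?_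
  exact Finset.sum_nonneg fun x _ => mul_nonneg (wt_nonneg h0 h1 x) (sq_nonneg _)

theorem markov_sq {p : ℝ} (h0 : 0 ≤ p) (h1 : p ≤ 1) (F : (ι → Bool) → ℝ) (a : ℝ) (ha : 0 < a)
    (h : 4 * EE p (fun x => F x ^ 2) ≤ a ^ 2) :
    EE p (fun x => if a < |F x| then 1 else 0) ≤ 1 / 4 := by
  have : EE p (fun x => a ^ 2 * (if a < |F x| then 1 else 0)) ≤ EE p (fun x => F x ^ 2) := by
    refine EE_mono h0 h1 fun x => ?_
    split_ifs with hx
    · rw [mul_one, ← sq_abs (F x)]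
      exact pow_le_pow_left₀ ha.le hx.le 2
    · simpa using sq_nonneg _
  rw [EE_cmul] at this
  have : 0 < a ^ 2 := by positivity
  nlinarith

theorem card_int_window (c R : ℝ) (hR : 0 ≤ R) :
    ((Finset.Icc ⌈c - R⌉ ⌊c + R⌋).card : ℝ) ≤ 2 * R + 1 := by
  rw [Int.card_Icc]
  have h1 := Int.floor_le (c + R)
  have h2 := Int.le_ceil (c - R)
  have : (((⌊c + R⌋ + 1 - ⌈c - R⌉).toNat : ℤ) : ℝ) ≤ 2 * R + 1 := by
    rw [Int.toNat_eq_max]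
    push_cast
    refine max_le ?_ (by linarith)
    linarith
  exact_mod_cast this

/-- Pigeonhole. -/
theorem pigeon {p : ℝ} (h0 : 0 ≤ p) (h1 : p ≤ 1) (X M : (ι → Bool) → ℤ)
    (L Y : (ι → Bool) → ℝ) (g : ℤ → ℝ) (q A B : ℝ) (hA : 0 < A) (hB : 0 < B)
    (hM : ∀ x, (M x : ℝ) = L x + q) (hXg : ∀ x, 2 * (X x : ℝ) = g (M x) - Y x)
    (hL : 4 * EE p (fun x => L x ^ 2) ≤ A ^ 2) (hY : 4 * EE p (fun x => Y x ^ 2) ≤ B ^ 2) :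
    ∃ k : ℤ, 1 / (2 * ((2 * A + 1) * (B + 1))) ≤ EE p (fun x => if X x = k then 1 else 0) := by
  classical
  by_contra hcon
  push Not at hcon
  set V : Finset ℤ := (Finset.Icc ⌈q - A⌉ ⌊q + A⌋).biUnion fun m =>
    Finset.Icc ⌈g m / 2 - B / 2⌉ ⌊g m / 2 + B / 2⌋ with hV
  have hVc : (V.card : ℝ) ≤ (2 * A + 1) * (B + 1) := by
    have : (V.card : ℝ) ≤ ∑ m ∈ Finset.Icc ⌈q - A⌉ ⌊q + A⌋,
        ((Finset.Icc ⌈g m / 2 - B / 2⌉ ⌊g m / 2 + B / 2⌋).card : ℝ) := by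
      exact_mod_cast Finset.card_biUnion_le
    refine this.trans ?_
    refine (Finset.sum_le_sum fun m _ => card_int_window (g m / 2) (B / 2) (by positivity)).trans ?_
    rw [Finset.sum_const, nsmul_eq_mul]
    have := card_int_window q A hA.le
    have e : 2 * (B / 2) + 1 = B + 1 := by ring
    rw [e]
    exact mul_le_mul_of_nonneg_right this (by positivity)
  have key : EE p (fun _ : ι → Bool => (1:ℝ)) ≤ EE p (fun x =>
      (∑ k ∈ V, if X x = k then (1:ℝ) else 0) + ((if A < |L x| then 1 else 0)
        + (if B < |Y x| then 1 else 0))) := by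
    refine EE_mono h0 h1 fun x => ?_
    have hs : (0:ℝ) ≤ ∑ k ∈ V, if X x = k then (1:ℝ) else 0 :=
      Finset.sum_nonneg fun k _ => by split_ifs <;> norm_num
    by_cases ha : A < |L x|
    · rw [if_pos ha]; split_ifs <;> linarith
    by_cases hb : B < |Y x|
    · rw [if_pos hb]; split_ifs <;> linarith
    rw [not_lt, abs_le] at ha hb
    have hin : X x ∈ V := by
      rw [hV, Finset.mem_biUnion]
      refine ⟨M x, ?_, ?_⟩
      · rw [Finset.mem_Icc, Int.ceil_le, Int.le_floor, hM]
        constructor <;> linarith [ha.1, ha.2]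
      · rw [Finset.mem_Icc, Int.ceil_le, Int.le_floor]
        have := hXg x
        constructor <;> linarith [hb.1, hb.2]
    have : (∑ k ∈ V, if X x = k then (1:ℝ) else 0) = 1 := by
      rw [Finset.sum_ite_eq]; simp [hin]
    rw [this]
    split_ifs <;> norm_num
  rw [EE_one, EE_add, EE_add, EE_sum] at key
  have m1 := markov_sq h0 h1 L A hA hL
  have m2 := markov_sq h0 h1 Y B hB hY
  have hpos : 0 < (2 * A + 1) * (B + 1) := by positivity
  have hhalf : (1:ℝ)/2 ≤ ∑ k ∈ V, EE p (fun x => if X x = k then 1 else 0) := by linarith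
  have hne : V.Nonempty := by
    by_contra h
    rw [Finset.not_nonempty_iff_eq_empty] at h
    rw [h] at hhalf; norm_num at hhalf
  have hlt := Finset.sum_lt_sum_of_nonempty hne (fun k _ => hcon k)
  rw [Finset.sum_const, nsmul_eq_mul] at hlt
  have : (V.card : ℝ) * (1 / (2 * ((2 * A + 1) * (B + 1)))) ≤ 1 / 2 := by
    rw [mul_one_div, div_le_div_iff₀ (by positivity) (by norm_num)]
    linarith
  linarith

end absprob

section graphpart

def dj {n : ℕ} (e f : Sym2 (Fin n)) : Prop := ∀ v, v ∈ e → v ∉ f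

open Classical in
noncomputable def EdgeF (n : ℕ) : Finset (Sym2 (Fin n)) := Finset.univ.filter fun e => ¬ e.IsDiag

open Classical in
noncomputable def DD (n : ℕ) : Finset (Sym2 (Fin n) × Sym2 (Fin n)) :=
  (EdgeF n).offDiag.filter fun t => dj t.1 t.2

open Classical in
noncomputable def TT (n : ℕ) : Finset (Sym2 (Fin n) × Sym2 (Fin n)) :=
  (EdgeF n).offDiag.filter fun t => ¬ dj t.1 t.2

theorem mem_EdgeF {n : ℕ} (e : Sym2 (Fin n)) : e ∈ EdgeF n ↔ ¬ e.IsDiag := by simp [EdgeF]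

theorem mem_graph {n : ℕ} (x : Sym2 (Fin n) → Bool) (e : Sym2 (Fin n)) :
    e ∈ (graphOfFn x).edgeSet ↔ e ∈ EdgeF n ∧ x e = true := by
  induction e using Sym2.ind with
  | _ a b =>
    rw [mem_EdgeF, SimpleGraph.mem_edgeSet, graphOfFn, SimpleGraph.fromRel_adj, Sym2.eq_swap (a := b)]
    simp

theorem twoEdges_edgeSet : twoEdges.edgeSet = {s(0, 1), s(2, 3)} := by
  ext e
  induction e using Sym2.ind with
  | _ a b =>
    rw [SimpleGraph.mem_edgeSet, twoEdges, SimpleGraph.fromRel_adj]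
    revert a b
    simp only [Set.mem_insert_iff, Set.mem_singleton_iff]
    decide

theorem dj_symm {n : ℕ} {e f : Sym2 (Fin n)} (h : dj e f) : dj f e := fun v hv hv' => h v hv' hv

theorem dj_ne {n : ℕ} {e f : Sym2 (Fin n)} (h : dj e f) : e ≠ f := by
  rintro rfl
  induction e using Sym2.ind with
  | _ a b => exact h a (by simp) (by simp)

theorem copy_iff {n : ℕ} (A : Finset (Sym2 (Fin n))) :
    (∃ f : Fin 4 ↪ Fin n, (↑A : Set (Sym2 (Fin n))) = Sym2.map f '' twoEdges.edgeSet) ↔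
    ∃ e g, e ∈ EdgeF n ∧ g ∈ EdgeF n ∧ dj e g ∧ A = {e, g} := by
  classical
  rw [twoEdges_edgeSet]
  constructor
  · rintro ⟨f, hf⟩
    refine ⟨s(f 0, f 1), s(f 2, f 3), ?_, ?_, ?_, ?_⟩
    · simp [mem_EdgeF]
    · simp [mem_EdgeF]
    · intro v hv hv'
      simp only [Sym2.mem_iff] at hv hv'
      rcases hv with rfl | rfl <;> simp at hv'
    · rw [← Finset.coe_inj, hf]
      simp [Set.image_pair]
  · rintro ⟨e, g, he, hg, hd, rfl⟩
    induction e using Sym2.ind with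
    | _ a b =>
    induction g using Sym2.ind with
    | _ c d =>
    rw [mem_EdgeF] at he hg
    have h1 := hd a (by simp)
    have h2 := hd b (by simp)
    simp only [Sym2.mem_iff, Sym2.mk_isDiag_iff, not_or] at h1 h2 he hg
    refine ⟨⟨![a, b, c, d], ?_⟩, ?_⟩
    · intro i j hij
      fin_cases i <;> fin_cases j <;> simp_all
    · rw [Set.image_pair, Finset.coe_pair]; rfl

theorem mem_DD {n : ℕ} (t : Sym2 (Fin n) × Sym2 (Fin n)) :
    t ∈ DD n ↔ t.1 ∈ EdgeF n ∧ t.2 ∈ EdgeF n ∧ dj t.1 t.2 := by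
  simp only [DD, Finset.mem_filter, Finset.mem_offDiag]
  constructor
  · tauto
  · rintro ⟨a, b, c⟩; exact ⟨⟨a, b, dj_ne c⟩, c⟩

theorem count_eq {n : ℕ} (x : Sym2 (Fin n) → Bool) :
    2 * (subgraphCount twoEdges (graphOfFn x) : ℝ) = ∑ t ∈ DD n, bx t.1 x * bx t.2 x := by
  classical
  have e1 : ∑ t ∈ DD n, bx t.1 x * bx t.2 x
      = (((DD n).filter fun t => x t.1 = true ∧ x t.2 = true).card : ℝ) := by
    rw [Finset.card_filter]
    push_cast
    refine Finset.sum_congr rfl fun t _ => ?_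
    unfold bx
    by_cases h1 : x t.1 = true <;> by_cases h2 : x t.2 = true <;> simp [h1, h2]
  rw [e1]
  set S : Finset (Finset (Sym2 (Fin n))) := Finset.univ.filter fun A =>
    (↑A ⊆ (graphOfFn x).edgeSet ∧ ∃ f : Fin 4 ↪ Fin n,
      (↑A : Set (Sym2 (Fin n))) = Sym2.map f '' twoEdges.edgeSet) with hS
  have e2 : subgraphCount twoEdges (graphOfFn x) = S.card := by
    rw [subgraphCount, Nat.card_eq_fintype_card, Fintype.card_subtype]
  have hmaps : (((DD n).filter fun t => x t.1 = true ∧ x t.2 = true :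
      Finset (Sym2 (Fin n) × Sym2 (Fin n))) : Set (Sym2 (Fin n) × Sym2 (Fin n))).MapsTo
      (fun t => ({t.1, t.2} : Finset (Sym2 (Fin n)))) S := by
    intro t ht
    simp only [Finset.coe_filter, Set.mem_ofPred_eq, mem_DD] at ht
    simp only [hS, Finset.coe_filter, Finset.mem_univ, true_and, Set.mem_ofPred_eq]
    rw [copy_iff]
    refine ⟨?_, t.1, t.2, ht.1.1, ht.1.2.1, ht.1.2.2, rfl⟩
    intro e he
    rw [mem_graph]
    simp only [Finset.coe_insert, Finset.coe_singleton, Set.mem_insert_iff,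
      Set.mem_singleton_iff] at he
    rcases he with rfl | rfl
    · exact ⟨ht.1.1, ht.2.1⟩
    · exact ⟨ht.1.2.1, ht.2.2⟩
  have e3 := Finset.card_eq_sum_card_fiberwise hmaps
  have e4 : ∀ A ∈ S, (((DD n).filter fun t => x t.1 = true ∧ x t.2 = true).filter
      fun t => ({t.1, t.2} : Finset (Sym2 (Fin n))) = A).card = 2 := by
    intro A hA
    simp only [hS, Finset.mem_filter, Finset.mem_univ, true_and] at hA
    rw [copy_iff] at hA
    obtain ⟨hsub, e, g, he, hg, hd, rfl⟩ := hA
    have hxe : x e = true := ((mem_graph x e).1 (hsub (by simp))).2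
    have hxg : x g = true := ((mem_graph x g).1 (hsub (by simp))).2
    have hne := dj_ne hd
    have : (((DD n).filter fun t => x t.1 = true ∧ x t.2 = true).filter
      fun t => ({t.1, t.2} : Finset (Sym2 (Fin n))) = {e, g}) = {(e, g), (g, e)} := by
      ext ⟨a, b⟩
      simp only [Finset.mem_filter, mem_DD, Finset.mem_insert, Finset.mem_singleton, Prod.mk.injEq]
      constructor
      · rintro ⟨⟨⟨_, _, hab⟩, _⟩, h⟩
        have ha : a ∈ ({e, g} : Finset (Sym2 (Fin n))) := h ▸ (by simp)
        have hb : b ∈ ({e, g} : Finset (Sym2 (Fin n))) := h ▸ (by simp)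
        have := dj_ne hab
        simp only [Finset.mem_insert, Finset.mem_singleton] at ha hb
        grind
      · rintro (⟨rfl, rfl⟩ | ⟨rfl, rfl⟩)
        · exact ⟨⟨⟨he, hg, hd⟩, hxe, hxg⟩, rfl⟩
        · exact ⟨⟨⟨hg, he, dj_symm hd⟩, hxg, hxe⟩, Finset.pair_comm _ _⟩
    rw [this, Finset.card_pair]
    intro h
    exact hne (Prod.ext_iff.1 h).1
  rw [Finset.sum_congr rfl e4, Finset.sum_const, smul_eq_mul] at e3
  rw [e3, e2]
  push_cast; ring

theorem EdgeF_eq (n : ℕ) : EdgeF n = (⊤ : SimpleGraph (Fin n)).edgeFinset := by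
  ext e; simp [mem_EdgeF]

theorem EdgeF_card (n : ℕ) : (EdgeF n).card = n.choose 2 := by
  rw [EdgeF_eq, SimpleGraph.card_edgeFinset_top_eq_card_choose_two, Fintype.card_fin]

theorem EdgeF_card_real (n : ℕ) : ((EdgeF n).card : ℝ) = n * (n - 1) / 2 := by
  rw [EdgeF_card, Nat.cast_choose_two]

open Classical in
theorem inc_card {n : ℕ} (a : Fin n) : ((EdgeF n).filter fun f => a ∈ f).card = n - 1 := by
  have h := SimpleGraph.card_incidenceFinset_eq_degree (⊤ : SimpleGraph (Fin n)) a
  rw [SimpleGraph.incidenceFinset_eq_filter] at h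
  rw [EdgeF_eq]
  simpa using h

open Classical in
theorem nbr_card {n : ℕ} (e : Sym2 (Fin n)) (he : e ∈ EdgeF n) :
    (((EdgeF n).filter fun f => e ≠ f ∧ ¬ dj e f).card : ℝ) = 2 * n - 4 := by
  induction e using Sym2.ind with
  | _ a b =>
  have hab : a ≠ b := by simpa [mem_EdgeF] using he
  have hun : insert s(a, b) ((EdgeF n).filter fun f => s(a, b) ≠ f ∧ ¬ dj s(a, b) f)
      = ((EdgeF n).filter fun f => a ∈ f) ∪ ((EdgeF n).filter fun f => b ∈ f) := by
    ext f
    simp only [Finset.mem_insert, Finset.mem_filter, Finset.mem_union, dj, Sym2.mem_iff]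
    by_cases hf : f = s(a, b)
    · subst hf; simp [he]
    · have : s(a, b) ≠ f := Ne.symm hf
      simp only [hf, false_or, this, ne_eq, not_false_iff, true_and, not_forall, not_not]
      constructor
      · rintro ⟨h, v, rfl | rfl, hv⟩ <;> tauto
      · rintro (⟨h, hv⟩ | ⟨h, hv⟩)
        · exact ⟨h, a, Or.inl rfl, hv⟩
        · exact ⟨h, b, Or.inr rfl, hv⟩
  have hint : ((EdgeF n).filter fun f => a ∈ f) ∩ ((EdgeF n).filter fun f => b ∈ f)
      = {s(a, b)} := by
    ext f
    simp only [Finset.mem_filter, Finset.mem_inter, Finset.mem_singleton]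
    constructor
    · rintro ⟨⟨_, h1⟩, _, h2⟩
      exact (Sym2.mem_and_mem_iff hab).1 ⟨h1, h2⟩
    · rintro rfl; simp [he]
  have hc := Finset.card_union_add_card_inter ((EdgeF n).filter fun f => a ∈ f)
    ((EdgeF n).filter fun f => b ∈ f)
  rw [← hun, hint, inc_card, inc_card, Finset.card_insert_of_notMem (by simp),
    Finset.card_singleton] at hc
  have hn : 1 ≤ n := by have := a.2; omega
  have hc' : ((EdgeF n).filter fun f => s(a, b) ≠ f ∧ ¬ dj s(a, b) f).card + 4 = 2 * n := by omega
  have : (((EdgeF n).filter fun f => s(a, b) ≠ f ∧ ¬ dj s(a, b) f).card : ℝ) + 4 = 2 * n := by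
    exact_mod_cast hc'
  linarith

theorem sum_TT {n : ℕ} (F : Sym2 (Fin n) → ℝ) :
    ∑ t ∈ TT n, F t.1 = (2 * n - 4) * ∑ e ∈ EdgeF n, F e := by
  classical
  have : TT n = ((EdgeF n) ×ˢ (EdgeF n)).filter fun t => t.1 ≠ t.2 ∧ ¬ dj t.1 t.2 := by
    ext t; simp only [TT, Finset.mem_filter, Finset.mem_offDiag, Finset.mem_product]; tauto
  rw [this, Finset.sum_filter, Finset.sum_product, Finset.mul_sum]
  refine Finset.sum_congr rfl fun e he => ?_
  rw [← Finset.sum_filter]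
  change ∑ a ∈ (EdgeF n).filter (fun f => e ≠ f ∧ ¬ dj e f), F e = _
  rw [Finset.sum_const, nsmul_eq_mul, nbr_card e he]

theorem TT_swap {n : ℕ} (F : Sym2 (Fin n) → ℝ) :
    ∑ t ∈ TT n, F t.2 = ∑ t ∈ TT n, F t.1 := by
  classical
  have hm : ∀ t ∈ TT n, t.swap ∈ TT n := by
    intro t
    simp only [TT, Finset.mem_filter, Finset.mem_offDiag, Prod.fst_swap, Prod.snd_swap]
    rintro ⟨⟨a, b, c⟩, d⟩
    exact ⟨⟨b, a, c.symm⟩, fun h => d (dj_symm h)⟩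
  exact Finset.sum_nbij' Prod.swap Prod.swap hm hm (by simp) (by simp) (by simp)

theorem TT_card (n : ℕ) : ((TT n).card : ℝ) = (2 * n - 4) * (EdgeF n).card := by
  have := sum_TT (n := n) (fun _ => 1)
  simpa using this

theorem DD_add_TT {n : ℕ} (F : Sym2 (Fin n) × Sym2 (Fin n) → ℝ) :
    ∑ t ∈ DD n, F t + ∑ t ∈ TT n, F t = ∑ t ∈ (EdgeF n).offDiag, F t := by
  classical
  exact Finset.sum_filter_add_sum_filter_not _ _ _

theorem sum_offDiag' {n : ℕ} (F : Sym2 (Fin n) → ℝ) :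
    ∑ t ∈ (EdgeF n).offDiag, F t.1 * F t.2
      = (∑ e ∈ EdgeF n, F e) ^ 2 - ∑ e ∈ EdgeF n, F e ^ 2 := by
  have h := Finset.sum_product (EdgeF n) (EdgeF n) (fun t => F t.1 * F t.2)
  rw [← Finset.diag_union_offDiag, Finset.sum_union (Finset.disjoint_diag_offDiag _),
    Finset.sum_diag, ← Finset.sum_mul_sum] at h
  simp only [← sq] at h
  linarith

theorem DD_card (n : ℕ) : ((DD n).card : ℝ)
    = (EdgeF n).card ^ 2 - (EdgeF n).card - (2 * n - 4) * (EdgeF n).card := by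
  have h1 := DD_add_TT (n := n) (fun _ => 1)
  have h2 := sum_offDiag' (n := n) (fun _ => 1)
  have h3 := TT_card n
  simp at h1 h2
  linarith

noncomputable def MM {n : ℕ} (x : Sym2 (Fin n) → Bool) : ℤ := ∑ e ∈ EdgeF n, if x e then 1 else 0

theorem MM_real {n : ℕ} (x : Sym2 (Fin n) → Bool) : (MM x : ℝ) = ∑ e ∈ EdgeF n, bx e x := by
  unfold MM bx; push_cast; rfl

theorem MM_LL {n : ℕ} (p : ℝ) (x : Sym2 (Fin n) → Bool) :
    (MM x : ℝ) = LL p (EdgeF n) x + p * (EdgeF n).card := by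
  rw [MM_real, LL]; simp [xi, Finset.sum_sub_distrib]; ring

theorem X_formula {n : ℕ} (p : ℝ) (x : Sym2 (Fin n) → Bool) :
    2 * (subgraphCount twoEdges (graphOfFn x) : ℝ)
      = ((MM x : ℝ) ^ 2 - MM x - 2 * p * ((2 * n - 4) * (MM x - p * (EdgeF n).card))
        - p ^ 2 * ((2 * n - 4) * (EdgeF n).card)) - YY p (TT n) x := by
  have h1 := DD_add_TT (fun t => bx t.1 x * bx t.2 x)
  have h2 := sum_offDiag' (fun e => bx e x)
  have h3 : ∑ e ∈ EdgeF n, bx e x ^ 2 = ∑ e ∈ EdgeF n, bx e x :=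
    Finset.sum_congr rfl fun e _ => by unfold bx; split_ifs <;> norm_num
  rw [h3, ← MM_real] at h2
  have h4 : ∑ t ∈ TT n, bx t.1 x * bx t.2 x = YY p (TT n) x + p * (∑ t ∈ TT n, xi p t.1 x)
      + p * (∑ t ∈ TT n, xi p t.2 x) + p ^ 2 * (TT n).card := by
    rw [YY, Finset.mul_sum, Finset.mul_sum, ← Finset.sum_add_distrib, ← Finset.sum_add_distrib,
      mul_comm (p ^ 2), ← nsmul_eq_mul, ← Finset.sum_const, ← Finset.sum_add_distrib]
    refine Finset.sum_congr rfl fun t _ => ?_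
    unfold xi; ring
  have h5 := TT_swap (n := n) (fun e => xi p e x)
  have h6 := sum_TT (n := n) (fun e => xi p e x)
  have h7 : ∑ e ∈ EdgeF n, xi p e x = MM x - p * (EdgeF n).card := by
    have := MM_LL p x
    rw [LL] at this; linarith
  have h8 := TT_card n
  rw [count_eq]
  rw [h5, h6, h7, h8] at h4
  linarith

theorem int_gnp {n : ℕ} {p : ℝ} (h0 : 0 ≤ p) (h1 : p ≤ 1) (F : (Sym2 (Fin n) → Bool) → ℝ) :
    ∫ x, F x ∂(gnp n p) = EE p F := by
  have hw : ∀ x : Sym2 (Fin n) → Bool,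
      (∏ i, ENNReal.ofReal (if x i then p else 1 - p)) = ENNReal.ofReal (wt p x) := by
    intro x
    rw [wt, ENNReal.ofReal_prod_of_nonneg]
    intro i _; split_ifs <;> linarith
  unfold gnp bernoulliPi
  simp only [hw]
  rw [integral_finsetSum_measure]
  · unfold EE
    refine Finset.sum_congr rfl fun x _ => ?_
    rw [integral_smul_measure, integral_dirac, ENNReal.toReal_ofReal (wt_nonneg h0 h1 x), smul_eq_mul]
  · intro x _
    exact Integrable.smul_measure (integrable_dirac (by simp)) ENNReal.ofReal_ne_top

open Classical in
theorem prob_gnp {n : ℕ} {p : ℝ} (h0 : 0 ≤ p) (h1 : p ≤ 1) (s : Set (Sym2 (Fin n) → Bool)) :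
    (gnp n p s).toReal = EE p (fun x => if x ∈ s then 1 else 0) := by
  rw [← int_gnp h0 h1]
  have : (fun x : Sym2 (Fin n) → Bool => if x ∈ s then (1:ℝ) else 0) = s.indicator 1 := by
    funext x; simp [Set.indicator_apply]
  rw [this, integral_indicator_one (Set.toFinite s).measurableSet]
  rfl

end graphpart

theorem two_edges_anticoncentration_fails
    (p : ℝ) (hp : p ∈ Set.Ioo (0 : ℝ) 1) :
    ∃ c : ℝ, 0 < c ∧ ∃ N : ℕ, ∀ n : ℕ, N ≤ n →
      let μ := gnp n p
      let X : (Sym2 (Fin n) → Bool) → ℝ := fun ω => (subgraphCount twoEdges (graphOfFn ω) : ℝ)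
      let μH := ∫ ω, X ω ∂μ
      let σH := Real.sqrt (∫ ω, (X ω - μH) ^ 2 ∂μ)
      ∃ x : ℤ, c * (n : ℝ) ^ ((1 : ℝ) / 2) * σH⁻¹ ≤ (μ {ω | X ω = (x : ℝ)}).toReal := by
  obtain ⟨hp0, hp1⟩ := hp
  have h0 := hp0.le
  have h1 := hp1.le
  have hq : 0 < 1 - p := by linarith
  have hpq : 0 < p ^ 2 * (1 - p) := by positivity
  refine ⟨p ^ 2 * (1 - p) / 1600, by positivity, 16, ?_⟩
  intro n hn μ X μH σH
  have hn' : (16 : ℝ) ≤ n := by exact_mod_cast hn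
  set N : ℝ := ((EdgeF n).card : ℝ) with hN
  have hNe : N = n * (n - 1) / 2 := EdgeF_card_real n
  have hNlo : (n : ℝ) ^ 2 / 4 ≤ N := by rw [hNe]; nlinarith
  have hNhi : N ≤ (n : ℝ) ^ 2 / 2 := by rw [hNe]; nlinarith
  set r : ℝ := Real.sqrt n with hr
  have hr2 : r ^ 2 = n := Real.sq_sqrt (by linarith)
  have hr4 : 4 ≤ r := by
    rw [hr]; apply Real.le_sqrt_of_sq_le; linarith
  have hL : 4 * EE p (fun x => LL p (EdgeF n) x ^ 2) ≤ (2 * (n : ℝ)) ^ 2 := by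
    have := EE_LL_sq h0 h1 (EdgeF n)
    nlinarith
  have hY : 4 * EE p (fun x => YY p (TT n) x ^ 2) ≤ (4 * (n : ℝ) * r) ^ 2 := by
    have h := EE_YY_sq h0 h1 (TT n) (fun t ht => by
      simp only [TT, Finset.mem_filter, Finset.mem_offDiag] at ht
      exact ht.1.2.2)
    rw [TT_card] at h
    have e : (4 * (n : ℝ) * r) ^ 2 = 16 * n ^ 2 * n := by rw [← hr2]; ring
    rw [e]
    have : (2 * (n : ℝ) - 4) * N ≤ (2 * n) * (n ^ 2 / 2) := by
      refine mul_le_mul (by linarith) hNhi (by positivity) (by linarith)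
    nlinarith [sq_nonneg (n : ℝ)]
  obtain ⟨k, hk⟩ := pigeon h0 h1 (fun x => ((subgraphCount twoEdges (graphOfFn x) : ℕ) : ℤ)) MM
    (LL p (EdgeF n)) (YY p (TT n))
    (fun m => (m : ℝ) ^ 2 - m - 2 * p * ((2 * n - 4) * (m - p * (EdgeF n).card))
        - p ^ 2 * ((2 * n - 4) * (EdgeF n).card)) (p * (EdgeF n).card) (2 * n) (4 * n * r)
    (by linarith) (by nlinarith) (MM_LL p) (fun x => by
      have := X_formula p x
      push_cast
      exact this) hL hY
  refine ⟨k, ?_⟩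
  have hprob : (μ {ω | X ω = (k : ℝ)}).toReal
      = EE p (fun x : Sym2 (Fin n) → Bool => if ((subgraphCount twoEdges (graphOfFn x) : ℕ) : ℤ) = k then 1 else 0) := by
    rw [prob_gnp h0 h1]
    congr 1
    funext x
    have : x ∈ {ω | X ω = (k : ℝ)} ↔ ((subgraphCount twoEdges (graphOfFn x) : ℕ) : ℤ) = k := by
      change ((subgraphCount twoEdges (graphOfFn x) : ℕ) : ℝ) = (k : ℝ) ↔ _
      exact_mod_cast Iff.rfl
    simp only [this]
  rw [hprob]
  refine le_trans ?_ hk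
  have hvar := var_lower h0 h1 (EdgeF n) (DD n) (fun t ht => by
      rw [mem_DD] at ht; exact ⟨ht.1, ht.2.1, dj_ne ht.2.2⟩) X count_eq μH
  have hDlo : (n : ℝ) ^ 4 / 32 ≤ (DD n).card := by
    rw [DD_card]
    have h2 : (n : ℝ) ^ 2 / 8 ≤ N - 1 - (2 * n - 4) := by nlinarith
    have := mul_le_mul hNlo h2 (by positivity) (by positivity)
    nlinarith
  have hσ : (n : ℝ) ^ 3 * (p ^ 2 * (1 - p)) / 32 ≤ σH := by
    apply Real.le_sqrt_of_sq_le
    rw [int_gnp h0 h1]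
    set V := EE p (fun x => (X x - μH) ^ 2) with hV
    have hV0 : 0 ≤ V := Finset.sum_nonneg fun x _ => mul_nonneg (wt_nonneg h0 h1 x) (sq_nonneg _)
    have h3 : ((n : ℝ) ^ 4 / 32 * (p ^ 2 * (1 - p))) ^ 2 ≤ V * n ^ 2 := by
      calc _ ≤ ((DD n).card * (p ^ 2 * (1 - p))) ^ 2 := by gcongr
        _ ≤ V * N := hvar
        _ ≤ V * n ^ 2 := by gcongr; nlinarith [sq_nonneg (n : ℝ)]
    have hn2 : (0 : ℝ) < n ^ 2 := by positivity
    refine le_of_mul_le_mul_right ?_ hn2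
    refine le_trans (le_of_eq ?_) h3
    ring
  have hn0 : (0 : ℝ) < n := by linarith
  have hs : 0 < (n : ℝ) ^ 3 * (p ^ 2 * (1 - p)) / 32 := by positivity
  rw [← Real.sqrt_eq_rpow, ← hr]
  have hr0 : 0 < r := by linarith
  calc p ^ 2 * (1 - p) / 1600 * r * σH⁻¹
      ≤ p ^ 2 * (1 - p) / 1600 * r * ((n : ℝ) ^ 3 * (p ^ 2 * (1 - p)) / 32)⁻¹ := by
        gcongr
    _ = 1 / (50 * (n ^ 2 * r)) := by
        have : (n : ℝ) ^ 3 = n ^ 2 * r ^ 2 := by rw [hr2]; ring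
        rw [this]
        field_simp
        norm_num
    _ ≤ _ := by
        apply one_div_le_one_div_of_le (by positivity)
        have a1 : 2 * (2 * (n : ℝ)) + 1 ≤ 5 * n := by linarith
        have a2 : 4 * (n : ℝ) * r + 1 ≤ 5 * (n * r) := by nlinarith
        have := mul_le_mul a1 a2 (by positivity) (by positivity)
        nlinarith
end

section
/- There exists a graph H′ on 64 vertices and an absolute constant c > 0 such that the following holds for all sufficiently large n. Sample G ~ G(n,1/2), let X_{H′} be the induced subgraph count of H′ in G, and let σ_{H′} be the standard deviation of X_{H′}. Then sup_{x ∈ ℤ} ℙ[X_{H′} = x] ≥ c·n^{1/2}·σ_{H′}^{−1}. In particular, anticoncentration of induced subgraph counts at the optimal scale σ_{H′}^{−1} fails by a polynomial factor in G(n,1/2). -/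
open MeasureTheory ProbabilityTheory
open scoped ENNReal NNReal

namespace IC
open Finset
open scoped BigOperators

noncomputable def yv {n : ℕ} (ω : Sym2 (Fin n) → Bool) (e : Sym2 (Fin n)) : ℝ := if ω e then 1 else -1

noncomputable def chi {n : ℕ} (ω : Sym2 (Fin n) → Bool) (S : Finset (Sym2 (Fin n))) : ℝ := ∏ e ∈ S, yv ω e

lemma chi_orth {n : ℕ} (S T : Finset (Sym2 (Fin n))) :
    𝔼 ω, chi ω S * chi ω T = if S = T then (1 : ℝ) else 0 := by
  have h1 : ∀ ω : Sym2 (Fin n) → Bool, chi ω S * chi ω T =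
      ∏ e, ((fun (e : Sym2 (Fin n)) (b : Bool) => (if e ∈ S then (if b then (1:ℝ) else -1) else 1) *
        (if e ∈ T then (if b then (1:ℝ) else -1) else 1)) e (ω e)) := by
    intro ω
    unfold chi yv
    rw [Finset.prod_mul_distrib]
    simp [Finset.prod_ite_mem]
  simp_rw [h1]
  rw [Fintype.expect_eq_sum_div_card, ← Fintype.piFinset_univ]
  rw [← Finset.prod_univ_sum (fun _ => univ) (fun (e : Sym2 (Fin n)) (b : Bool) => (if e ∈ S then (if b then (1:ℝ) else -1) else 1) *
        (if e ∈ T then (if b then (1:ℝ) else -1) else 1))]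
  have hc : ((Fintype.card (Sym2 (Fin n) → Bool) : ℕ) : ℝ) = ∏ e : Sym2 (Fin n), (2:ℝ) := by
    simp
  rw [hc, ← Finset.prod_div_distrib]
  split_ifs with h
  · subst h
    apply Finset.prod_eq_one
    intro e _
    by_cases he : e ∈ S <;> simp [he]
  · have : ∃ e, ¬ (e ∈ S ↔ e ∈ T) := by
      by_contra hcon
      push Not at hcon
      exact h (Finset.ext hcon)
    obtain ⟨e, he⟩ := this
    apply Finset.prod_eq_zero (Finset.mem_univ e)
    by_cases h1 : e ∈ S <;> by_cases h2 : e ∈ T <;> simp_all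

lemma avg_comp {m k n : ℕ} (hk : k ≤ n) (α : Fin m ↪ Fin k) (g : (Fin m ↪ Fin n) → ℝ) :
    𝔼 φ : Fin k ↪ Fin n, g (α.trans φ) = 𝔼 ψ : Fin m ↪ Fin n, g ψ := by
  have ne1 : Nonempty (Fin k ↪ Fin n) := ⟨Fin.castLEEmb hk⟩
  have ne2 : Nonempty (Fin m ↪ Fin n) := ⟨α.trans (Fin.castLEEmb hk)⟩
  let c : (Fin m ↪ Fin n) → ℝ := fun ψ => 𝔼 σ : Equiv.Perm (Fin n), g (ψ.trans σ.toEmbedding)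
  have hc : ∀ ψ ψ', c ψ = c ψ' := by
    intro ψ ψ'
    obtain ⟨τ, hτ⟩ := Equiv.Perm.exists_extending_pair ψ ψ' ψ.injective ψ'.injective
    refine Fintype.expect_equiv (Equiv.mulRight τ⁻¹) _ _ ?_
    intro σ
    congr 1
    ext i
    simp [← hτ]
  have key : ∀ {j : ℕ} (β : Fin m ↪ Fin j) [Nonempty (Fin j ↪ Fin n)] (ψ0 : Fin m ↪ Fin n),
      𝔼 φ : Fin j ↪ Fin n, g (β.trans φ) = c ψ0 := by
    intro j β _ ψ0
    have h1 : ∀ σ : Equiv.Perm (Fin n), 𝔼 φ : Fin j ↪ Fin n, g (β.trans φ) =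
        𝔼 φ : Fin j ↪ Fin n, g ((β.trans φ).trans σ.toEmbedding) := by
      intro σ
      symm
      refine Fintype.expect_equiv (Equiv.embeddingCongr (Equiv.refl _) σ) _ _ ?_
      intro φ
      congr 1
    have h2 : 𝔼 φ : Fin j ↪ Fin n, g (β.trans φ) =
        𝔼 σ : Equiv.Perm (Fin n), 𝔼 φ : Fin j ↪ Fin n, g ((β.trans φ).trans σ.toEmbedding) := by
      rw [← Finset.expect_congr rfl (fun σ _ => h1 σ), Fintype.expect_const]
    rw [h2, Finset.expect_comm]
    rw [Finset.expect_congr rfl (fun φ _ => hc (β.trans φ) ψ0), Fintype.expect_const]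
  let ψ0 : Fin m ↪ Fin n := Classical.choice ne2
  rw [key α ψ0]
  have := key (Function.Embedding.refl (Fin m)) ψ0
  exact this.symm

/-- average of the character of F over embeddings -/
noncomputable def tt {m n : ℕ} (F : Finset (Sym2 (Fin m))) (ω : Sym2 (Fin n) → Bool) : ℝ :=
  𝔼 φ : Fin m ↪ Fin n, chi ω (F.map φ.sym2Map)

lemma map_trans {m k n : ℕ} (F : Finset (Sym2 (Fin m))) (α : Fin m ↪ Fin k) (φ : Fin k ↪ Fin n) :
    (F.map α.sym2Map).map φ.sym2Map = F.map (α.trans φ).sym2Map := by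
  rw [Finset.map_map]
  congr 1
  ext e
  simp [Sym2.map_map]

lemma tt_map {m k n : ℕ} (hk : k ≤ n) (α : Fin m ↪ Fin k) (F : Finset (Sym2 (Fin m)))
    (ω : Sym2 (Fin n) → Bool) : tt (F.map α.sym2Map) ω = tt F ω := by
  unfold tt
  simp_rw [map_trans]
  exact avg_comp hk α (fun ψ => chi ω (F.map ψ.sym2Map))

/-- vertex set of F -/
def VV {m : ℕ} (F : Finset (Sym2 (Fin m))) : Finset (Fin m) :=
  univ.filter (fun v => ∃ e ∈ F, v ∈ e)

lemma VV_map {m n : ℕ} (F : Finset (Sym2 (Fin m))) (φ φ' : Fin m ↪ Fin n)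
    (h : F.map φ.sym2Map = F.map φ'.sym2Map) : ∀ v ∈ VV F, φ' v ∈ (VV F).map φ := by
  intro v hv
  simp only [VV, mem_filter, mem_univ, true_and] at hv
  obtain ⟨e, he, hve⟩ := hv
  have : φ'.sym2Map e ∈ F.map φ.sym2Map := by
    rw [h]; exact Finset.mem_map_of_mem _ he
  rw [Finset.mem_map] at this
  obtain ⟨e', he', heq⟩ := this
  have h2 : φ' v ∈ φ.sym2Map e' := by
    rw [heq]
    exact Sym2.mem_map.2 ⟨v, hve, rfl⟩
  obtain ⟨u, hu, huv⟩ := Sym2.mem_map.1 h2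
  rw [Finset.mem_map]
  exact ⟨u, by simp only [VV, mem_filter, mem_univ, true_and]; exact ⟨e', he', hu⟩, huv⟩

lemma count_le {m n : ℕ} (F : Finset (Sym2 (Fin m))) (φ : Fin m ↪ Fin n) :
    (univ.filter (fun φ' : Fin m ↪ Fin n => F.map φ.sym2Map = F.map φ'.sym2Map)).card
      ≤ m ^ m * n ^ (m - (VV F).card) := by
  classical
  have h1 : (univ.filter (fun φ' : Fin m ↪ Fin n => F.map φ.sym2Map = F.map φ'.sym2Map)).card ≤
      (Fintype.piFinset (fun v : Fin m => if v ∈ VV F then (VV F).map φ else univ)).card := by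
    apply Finset.card_le_card_of_injOn (fun φ' v => φ' v)
    · intro φ' hφ'
      simp only [coe_filter, mem_univ, true_and, Set.mem_ofPred_eq] at hφ'
      simp only [mem_coe, Fintype.mem_piFinset]
      intro v
      split_ifs with hv
      · exact VV_map F φ φ' hφ' v hv
      · exact mem_univ _
    · intro a _ b _ hab
      exact DFunLike.coe_injective hab
  refine h1.trans ?_
  rw [Fintype.card_piFinset]
  have h2 : ∀ v : Fin m, (if v ∈ VV F then (VV F).map φ else univ).card =
      if v ∈ VV F then (VV F).card else n := by
    intro v; split_ifs <;> simp
  rw [Finset.prod_congr rfl (fun v _ => h2 v), Finset.prod_ite]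
  simp only [prod_const]
  have h3 : (univ.filter (fun v => v ∈ VV F)).card = (VV F).card := by congr 1; ext; simp
  have h4 : (univ.filter (fun v => v ∉ VV F)).card = m - (VV F).card := by
    have := Finset.card_filter_add_card_filter_not (s := (univ : Finset (Fin m))) (fun v => v ∈ VV F)
    simp only [card_univ, Fintype.card_fin] at this
    omega
  rw [h3, h4]
  have h5 : (VV F).card ≤ m := by simpa using Finset.card_le_univ (VV F)
  refine Nat.mul_le_mul_right _ ?_
  rcases Nat.eq_zero_or_pos m with h | h
  · subst h; rw [Nat.le_zero.1 h5]
  · calc (VV F).card ^ (VV F).card ≤ m ^ (VV F).card := Nat.pow_le_pow_left h5 _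
      _ ≤ m ^ m := Nat.pow_le_pow_right h h5

lemma tt_sq {m n : ℕ} (hm : 2 * m ≤ n) (hn : 0 < n) (F : Finset (Sym2 (Fin m))) :
    𝔼 ω : Sym2 (Fin n) → Bool, (tt F ω) ^ 2 ≤ (2 * m : ℝ) ^ m / (n : ℝ) ^ (VV F).card := by
  have ne1 : Nonempty (Fin m ↪ Fin n) := ⟨Fin.castLEEmb (by omega)⟩
  have h1 : 𝔼 ω : Sym2 (Fin n) → Bool, (tt F ω) ^ 2 = 𝔼 φ : Fin m ↪ Fin n, 𝔼 φ' : Fin m ↪ Fin n,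
      (if F.map φ.sym2Map = F.map φ'.sym2Map then (1:ℝ) else 0) := by
    have : ∀ ω : Sym2 (Fin n) → Bool, (tt F ω) ^ 2 = 𝔼 φ : Fin m ↪ Fin n, 𝔼 φ' : Fin m ↪ Fin n,
        chi ω (F.map φ.sym2Map) * chi ω (F.map φ'.sym2Map) := by
      intro ω
      rw [sq, tt, Finset.expect_mul_expect]
    simp_rw [this]
    rw [Finset.expect_comm]
    refine Finset.expect_congr rfl (fun φ _ => ?_)
    rw [Finset.expect_comm]
    refine Finset.expect_congr rfl (fun φ' _ => ?_)
    exact chi_orth _ _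
  rw [h1]
  have hN : (Fintype.card (Fin m ↪ Fin n) : ℝ) ≥ (n / 2 : ℝ) ^ m := by
    rw [Fintype.card_embedding_eq, Fintype.card_fin, Fintype.card_fin]
    have := Nat.pow_sub_le_descFactorial n m
    have h3 : ((n + 1 - m : ℕ) : ℝ) ^ m ≤ (n.descFactorial m : ℝ) := by exact_mod_cast this
    refine le_trans ?_ h3
    gcongr
    rw [Nat.cast_sub (by omega)]
    have : (2 * m : ℝ) ≤ n := by exact_mod_cast hm
    push_cast
    linarith
  have hnp : (0:ℝ) < n := by exact_mod_cast hn
  have hV : (VV F).card ≤ m := by simpa using Finset.card_le_univ (VV F)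
  have h2 : ∀ φ : Fin m ↪ Fin n, 𝔼 φ' : Fin m ↪ Fin n,
      (if F.map φ.sym2Map = F.map φ'.sym2Map then (1:ℝ) else 0) ≤
        (2 * m : ℝ) ^ m / (n : ℝ) ^ (VV F).card := by
    intro φ
    rw [Fintype.expect_eq_sum_div_card]
    have h3 : ∑ φ' : Fin m ↪ Fin n, (if F.map φ.sym2Map = F.map φ'.sym2Map then (1:ℝ) else 0) ≤
        (m:ℝ) ^ m * (n:ℝ) ^ (m - (VV F).card) := by
      rw [Finset.sum_boole]
      exact_mod_cast count_le F φ
    calc _ ≤ ((m:ℝ) ^ m * (n:ℝ) ^ (m - (VV F).card)) / (n / 2 : ℝ) ^ m := by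
          gcongr
      _ = _ := by
          have h6 : (n:ℝ) ^ m = (n:ℝ) ^ (m - (VV F).card) * (n:ℝ) ^ (VV F).card := by
            rw [← pow_add]; congr 1; omega
          rw [div_pow, mul_pow, h6]
          field_simp
  calc _ ≤ 𝔼 φ : Fin m ↪ Fin n, (2 * m : ℝ) ^ m / (n : ℝ) ^ (VV F).card :=
        Finset.expect_le_expect (fun φ _ => h2 φ)
    _ = _ := Fintype.expect_const _

end IC

namespace IC
open Finset
open scoped BigOperators

lemma card_emb {k n : ℕ} (H : SimpleGraph (Fin k)) (G : SimpleGraph (Fin n)) :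
    Nat.card (H ↪g G) = inducedCount H G * Nat.card (H ≃g H) := by
  classical
  let I := {U : Finset (Fin n) // U.card = Fintype.card (Fin k) ∧
    Nonempty (H ≃g (G.induce (↑U : Set (Fin n))))}
  let Ψ : (Σ U : I, (H ≃g (G.induce (↑U.1 : Set (Fin n))))) → (H ↪g G) :=
    fun p => (SimpleGraph.Embedding.induce (G := G) (↑p.1.1 : Set (Fin n))).comp p.2.toEmbedding
  have hΨ : ∀ p v, Ψ p v = (p.2 v : Fin n) := fun p v => rfl
  have hb : Function.Bijective Ψ := by
    constructor
    · rintro ⟨⟨U, hU, hU'⟩, i⟩ ⟨⟨U', hV, hV'⟩, i'⟩ h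
      have hv : ∀ v, (i v : Fin n) = (i' v : Fin n) := fun v => by
        have := congrArg (fun f : H ↪g G => f v) h
        exact this
      have hUU : U = U' := by
        ext u
        constructor
        · intro hu
          obtain ⟨v, hv'⟩ := i.surjective ⟨u, hu⟩
          have h1 := hv v
          rw [hv'] at h1
          have h2 := (i' v).2
          rw [← h1] at h2
          exact h2
        · intro hu
          obtain ⟨v, hv'⟩ := i'.surjective ⟨u, hu⟩
          have h1 := hv v
          rw [hv'] at h1
          have h2 := (i v).2
          rw [h1] at h2
          exact h2
      subst hUU
      have : i = i' := by
        apply RelIso.ext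
        intro v
        exact Subtype.ext (hv v)
      subst this
      rfl
    · intro f
      let U : Finset (Fin n) := univ.map f.toEmbedding
      let e : Fin k ≃ (↑U : Set (Fin n)) := Equiv.ofBijective
        (fun v => ⟨f v, by simp [U]⟩) (by
          constructor
          · intro a b hab
            exact f.injective (congrArg Subtype.val hab)
          · rintro ⟨u, hu⟩
            simp [U] at hu
            obtain ⟨v, hv⟩ := hu
            exact ⟨v, Subtype.ext hv⟩)
      let i : H ≃g (G.induce (↑U : Set (Fin n))) := ⟨e, by
        intro a b
        exact f.map_rel_iff⟩
      exact ⟨⟨⟨U, by simp [U], ⟨i⟩⟩, i⟩, by ext v; rfl⟩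
  have hfin : ∀ U : I, Finite (H ≃g (G.induce (↑U.1 : Set (Fin n)))) := fun U =>
    Finite.of_injective (fun i => (i : Fin k → (↑U.1 : Set (Fin n)))) DFunLike.coe_injective
  rw [← Nat.card_congr (Equiv.ofBijective Ψ hb), Nat.card_sigma]
  have h2 : ∀ U : I, Nat.card (H ≃g (G.induce (↑U.1 : Set (Fin n)))) = Nat.card (H ≃g H) := by
    intro U
    obtain ⟨j⟩ := U.2.2
    refine Nat.card_congr ⟨fun i => i.trans j.symm, fun i => i.trans j, ?_, ?_⟩
    · intro i; ext v; simp
    · intro i; ext v; simp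
  rw [Finset.sum_congr rfl (fun U _ => h2 U)]
  rw [Finset.sum_const, smul_eq_mul, Finset.card_univ, ← Nat.card_eq_fintype_card]
  rfl

def PP (k : ℕ) : Finset (Sym2 (Fin k)) := univ.filter (fun e => ¬ e.IsDiag)

open Classical in
noncomputable def sg {k : ℕ} (H : SimpleGraph (Fin k)) (e : Sym2 (Fin k)) : ℝ :=
  if e ∈ H.edgeSet then 1 else -1

noncomputable def sgn {k : ℕ} (H : SimpleGraph (Fin k)) (F : Finset (Sym2 (Fin k))) : ℝ :=
  ∏ e ∈ F, sg H e

lemma graphOfFn_adj {n : ℕ} (ω : Sym2 (Fin n) → Bool) (a b : Fin n) :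
    (graphOfFn ω).Adj a b ↔ a ≠ b ∧ ω s(a, b) = true := by
  unfold graphOfFn
  rw [SimpleGraph.fromRel_adj, Sym2.eq_swap (a := b)]
  simp

open Classical in
lemma indic {k n : ℕ} (H : SimpleGraph (Fin k)) (ω : Sym2 (Fin n) → Bool) (φ : Fin k ↪ Fin n) :
    (if (∀ a b, (graphOfFn ω).Adj (φ a) (φ b) ↔ H.Adj a b) then (1:ℝ) else 0) =
      ∏ e ∈ PP k, ((1 + sg H e * yv ω (φ.sym2Map e)) / 2) := by
  split_ifs with h
  · symm
    apply Finset.prod_eq_one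
    intro e he
    induction e with
    | _ a b =>
      have hab : a ≠ b := by simpa [PP] using he
      have := h a b
      rw [graphOfFn_adj] at this
      have h3 : φ a ≠ φ b := fun h => hab (φ.injective h)
      simp only [sg, yv, SimpleGraph.mem_edgeSet, Function.Embedding.sym2Map_apply, Sym2.map_mk]
      simp only [ne_eq, h3, not_false_eq_true, true_and] at this
      by_cases h4 : H.Adj a b
      · simp [h4, this.2 h4]
      · have h5 : ¬ ω s(φ a, φ b) = true := fun h => h4 (this.1 h)
        simp [h4, h5]
  · symm
    push Not at h
    obtain ⟨a, b, hab⟩ := h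
    rw [graphOfFn_adj] at hab
    have hne : a ≠ b := by
      rintro rfl
      simp at hab
    have h3 : φ a ≠ φ b := fun h => hne (φ.injective h)
    apply Finset.prod_eq_zero (i := s(a, b)) (by simpa [PP] using hne)
    simp only [sg, yv, SimpleGraph.mem_edgeSet, Function.Embedding.sym2Map_apply, Sym2.map_mk]
    simp only [ne_eq, h3, not_false_eq_true, true_and] at hab
    by_cases h4 : H.Adj a b
    · have h5 : ¬ ω s(φ a, φ b) = true := by tauto
      simp [h4, h5]
    · have h5 : ω s(φ a, φ b) = true := by tauto
      simp [h4, h5]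

lemma expand {k n : ℕ} (H : SimpleGraph (Fin k)) (ω : Sym2 (Fin n) → Bool) (φ : Fin k ↪ Fin n) :
    ∏ e ∈ PP k, ((1 + sg H e * yv ω (φ.sym2Map e)) / 2) =
      (1 / 2 ^ (PP k).card) * ∑ F ∈ (PP k).powerset, sgn H F * chi ω (F.map φ.sym2Map) := by
  rw [Finset.prod_div_distrib, Finset.prod_one_add, Finset.prod_const, div_eq_mul_one_div, mul_comm]
  congr 1
  refine Finset.sum_congr rfl (fun F _ => ?_)
  rw [Finset.prod_mul_distrib, sgn, chi, Finset.prod_map]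

noncomputable def ZZ {k n : ℕ} (H : SimpleGraph (Fin k)) (ω : Sym2 (Fin n) → Bool) : ℝ :=
  ∑ F ∈ (PP k).powerset, sgn H F * tt F ω

lemma X_eq {k n : ℕ} (hk : k ≤ n) (H : SimpleGraph (Fin k)) (ω : Sym2 (Fin n) → Bool) :
    (inducedCount H (graphOfFn ω) : ℝ) =
      ((n.descFactorial k : ℝ) / (2 ^ (PP k).card * (Nat.card (H ≃g H) : ℝ))) * ZZ H ω := by
  classical
  have ne1 : Nonempty (Fin k ↪ Fin n) := ⟨Fin.castLEEmb hk⟩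
  have h1 := card_emb H (graphOfFn ω)
  have haut : (0:ℝ) < Nat.card (H ≃g H) := by
    have : Nonempty (H ≃g H) := ⟨RelIso.refl _⟩
    have : Finite (H ≃g H) :=
      Finite.of_injective (fun i => (i : Fin k → Fin k)) DFunLike.coe_injective
    exact_mod_cast Nat.card_pos
  have h2 : (Nat.card (H ↪g graphOfFn ω) : ℝ) =
      ∑ φ : Fin k ↪ Fin n, (if (∀ a b, (graphOfFn ω).Adj (φ a) (φ b) ↔ H.Adj a b) then (1:ℝ) else 0) := by
    rw [Finset.sum_boole]
    have e : (H ↪g graphOfFn ω) ≃ {φ : Fin k ↪ Fin n // ∀ a b, (graphOfFn ω).Adj (φ a) (φ b) ↔ H.Adj a b} :=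
      ⟨fun f => ⟨f.toEmbedding, fun a b => f.map_rel_iff⟩, fun φ => ⟨φ.1, fun {a b} => φ.2 a b⟩,
        fun f => rfl, fun φ => rfl⟩
    rw [Nat.card_congr e, Nat.card_eq_fintype_card, Fintype.card_subtype]
  have h3 : (Nat.card (H ↪g graphOfFn ω) : ℝ) = (n.descFactorial k : ℝ) * ((1 / 2 ^ (PP k).card) * ZZ H ω) := by
    rw [h2]
    simp_rw [indic, expand]
    rw [← Finset.mul_sum, Finset.sum_comm]
    have : ZZ H ω * (n.descFactorial k : ℝ) = ∑ F ∈ (PP k).powerset, ∑ φ : Fin k ↪ Fin n, sgn H F * chi ω (F.map φ.sym2Map) := by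
      unfold ZZ
      rw [Finset.sum_mul]
      refine Finset.sum_congr rfl (fun F _ => ?_)
      rw [← Finset.mul_sum, tt, Fintype.expect_eq_sum_div_card, Fintype.card_embedding_eq, Fintype.card_fin, Fintype.card_fin, mul_assoc, div_mul_cancel₀]
      have := Nat.descFactorial_pos.2 hk
      exact_mod_cast this.ne'
    rw [← this]; ring
  rw [h1] at h3
  push_cast at h3
  field_simp
  field_simp at h3
  linarith

end IC

namespace IC
open Finset
open scoped BigOperators

lemma sum_emb2 {n : ℕ} (g : Fin n → Fin n → ℝ) :
    ∑ ψ : Fin 2 ↪ Fin n, g (ψ 0) (ψ 1) = ∑ a, ∑ b, if a ≠ b then g a b else 0 := by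
  classical
  have h1 : ∑ ψ : Fin 2 ↪ Fin n, g (ψ 0) (ψ 1) =
      ∑ f : {f : Fin 2 → Fin n // Function.Injective f}, g (f.1 0) (f.1 1) :=
    (Fintype.sum_equiv (Equiv.subtypeInjectiveEquivEmbedding (Fin 2) (Fin n)) _ _ (fun f => rfl)).symm
  rw [h1, ← Finset.sum_subtype (univ.filter (fun f : Fin 2 → Fin n => Function.Injective f)) (by simp)
    (fun f => g (f 0) (f 1)), Finset.sum_filter]
  rw [← Fintype.sum_prod_type']
  refine Fintype.sum_equiv ⟨fun f => (f 0, f 1), fun p => ![p.1, p.2], fun f => by ext i; fin_cases i <;> rfl, fun p => rfl⟩ _ _ ?_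
  intro f
  have : Function.Injective f ↔ f 0 ≠ f 1 := by
    simp [Function.Injective, Fin.forall_fin_succ]
    tauto
  show (if Function.Injective f then g (f 0) (f 1) else 0) = if f 0 ≠ f 1 then g (f 0) (f 1) else 0
  simp only [this]

lemma sum_emb3 {n : ℕ} (g : Fin n → Fin n → Fin n → ℝ) :
    ∑ ψ : Fin 3 ↪ Fin n, g (ψ 0) (ψ 1) (ψ 2) =
      ∑ a, ∑ b, ∑ c, if a ≠ b ∧ a ≠ c ∧ b ≠ c then g a b c else 0 := by
  classical
  have h1 : ∑ ψ : Fin 3 ↪ Fin n, g (ψ 0) (ψ 1) (ψ 2) =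
      ∑ f : {f : Fin 3 → Fin n // Function.Injective f}, g (f.1 0) (f.1 1) (f.1 2) :=
    (Fintype.sum_equiv (Equiv.subtypeInjectiveEquivEmbedding (Fin 3) (Fin n)) _ _ (fun f => rfl)).symm
  rw [h1, ← Finset.sum_subtype (univ.filter (fun f : Fin 3 → Fin n => Function.Injective f)) (by simp)
    (fun f => g (f 0) (f 1) (f 2)), Finset.sum_filter]
  simp_rw [← Fintype.sum_prod_type']
  refine Fintype.sum_equiv ⟨fun f => (f 0, f 1, f 2), fun p => ![p.1, p.2.1, p.2.2], fun f => by ext i; fin_cases i <;> rfl, fun p => rfl⟩ _ _ ?_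
  intro f
  have : Function.Injective f ↔ f 0 ≠ f 1 ∧ f 0 ≠ f 2 ∧ f 1 ≠ f 2 := by
    simp [Function.Injective, Fin.forall_fin_succ]
    tauto
  show (if Function.Injective f then g (f 0) (f 1) (f 2) else 0) = if f 0 ≠ f 1 ∧ f 0 ≠ f 2 ∧ f 1 ≠ f 2 then g (f 0) (f 1) (f 2) else 0
  simp only [this]

lemma sum_emb4 {n : ℕ} (g : Fin n → Fin n → Fin n → Fin n → ℝ) :
    ∑ ψ : Fin 4 ↪ Fin n, g (ψ 0) (ψ 1) (ψ 2) (ψ 3) =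
      ∑ a, ∑ b, ∑ c, ∑ d, if a ≠ b ∧ a ≠ c ∧ a ≠ d ∧ b ≠ c ∧ b ≠ d ∧ c ≠ d then g a b c d else 0 := by
  classical
  have h1 : ∑ ψ : Fin 4 ↪ Fin n, g (ψ 0) (ψ 1) (ψ 2) (ψ 3) =
      ∑ f : {f : Fin 4 → Fin n // Function.Injective f}, g (f.1 0) (f.1 1) (f.1 2) (f.1 3) :=
    (Fintype.sum_equiv (Equiv.subtypeInjectiveEquivEmbedding (Fin 4) (Fin n)) _ _ (fun f => rfl)).symm
  rw [h1, ← Finset.sum_subtype (univ.filter (fun f : Fin 4 → Fin n => Function.Injective f)) (by simp)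
    (fun f => g (f 0) (f 1) (f 2) (f 3)), Finset.sum_filter]
  simp_rw [← Fintype.sum_prod_type']
  refine Fintype.sum_equiv ⟨fun f => (f 0, f 1, f 2, f 3), fun p => ![p.1, p.2.1, p.2.2.1, p.2.2.2], fun f => by ext i; fin_cases i <;> rfl, fun p => rfl⟩ _ _ ?_
  intro f
  have : Function.Injective f ↔ f 0 ≠ f 1 ∧ f 0 ≠ f 2 ∧ f 0 ≠ f 3 ∧ f 1 ≠ f 2 ∧ f 1 ≠ f 3 ∧ f 2 ≠ f 3 := by
    simp [Function.Injective, Fin.forall_fin_succ]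
    tauto
  show (if Function.Injective f then g (f 0) (f 1) (f 2) (f 3) else 0) = if f 0 ≠ f 1 ∧ f 0 ≠ f 2 ∧ f 0 ≠ f 3 ∧ f 1 ≠ f 2 ∧ f 1 ≠ f 3 ∧ f 2 ≠ f 3 then g (f 0) (f 1) (f 2) (f 3) else 0
  simp only [this]

def M1 : Finset (Sym2 (Fin 2)) := {s(0,1)}
def MC : Finset (Sym2 (Fin 3)) := {s(0,1), s(0,2)}
def M2 : Finset (Sym2 (Fin 4)) := {s(0,1), s(2,3)}

lemma descF2 (n : ℕ) : (n.descFactorial 2 : ℝ) = n * (n - 1) := by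
  rcases n with _ | n
  · simp
  · simp [Nat.descFactorial_succ]; ring

lemma descF3 (n : ℕ) (h : 3 ≤ n) : (n.descFactorial 3 : ℝ) = n * (n - 1) * (n - 2) := by
  obtain ⟨m, rfl⟩ := Nat.exists_eq_add_of_le' h
  simp [Nat.descFactorial_succ]; ring

lemma descF4 (n : ℕ) (h : 4 ≤ n) : (n.descFactorial 4 : ℝ) = n * (n - 1) * (n - 2) * (n - 3) := by
  obtain ⟨m, rfl⟩ := Nat.exists_eq_add_of_le' h
  simp [Nat.descFactorial_succ]; ring

lemma tt_sum {m n : ℕ} (h : m ≤ n) (F : Finset (Sym2 (Fin m))) (ω : Sym2 (Fin n) → Bool) :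
    (n.descFactorial m : ℝ) * tt F ω = ∑ φ : Fin m ↪ Fin n, chi ω (F.map φ.sym2Map) := by
  rw [tt, Fintype.expect_eq_sum_div_card, Fintype.card_embedding_eq, Fintype.card_fin, Fintype.card_fin,
    mul_div_cancel₀]
  have := Nat.descFactorial_pos.2 h
  exact_mod_cast this.ne'

lemma pair_identity {n : ℕ} (Y : Fin n → Fin n → ℝ) (hs : ∀ a b, Y a b = Y b a) (h0 : ∀ a, Y a a = 0) :
    ∑ a, ∑ b, ∑ c, ∑ d, (if a ≠ c ∧ a ≠ d ∧ b ≠ c ∧ b ≠ d then Y a b * Y c d else 0) =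
      (∑ a, ∑ b, Y a b) ^ 2 - 4 * (∑ a, ∑ b, ∑ c, if b ≠ c then Y a b * Y a c else 0)
        - 2 * ∑ a, ∑ b, Y a b ^ 2 := by
  have pt : ∀ a b c d, (if a ≠ c ∧ a ≠ d ∧ b ≠ c ∧ b ≠ d then Y a b * Y c d else 0) =
      Y a b * Y c d - (if c = a then Y a b * Y a d else 0) - (if d = a then Y a b * Y a c else 0)
       - (if c = b then Y a b * Y b d else 0) - (if d = b then Y a b * Y b c else 0)
       + (if c = a then if d = b then Y a b ^ 2 else 0 else 0)
       + (if d = a then if c = b then Y a b ^ 2 else 0 else 0) := by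
    intro a b c d
    by_cases h1 : c = a
    · subst h1
      by_cases h2 : d = c
      · subst h2
        by_cases h3 : d = b
        · subst h3; simp [h0]
        · simp [h0, h3]
      · by_cases h3 : c = b
        · subst h3; simp [h0]
        · by_cases h4 : d = b
          · subst h4; simp [h2, h3, hs d c]; ring
          · simp [h2, h3, h4]
    · by_cases h2 : d = a
      · subst h2
        by_cases h3 : c = b
        · subst h3; simp [h1, hs c d]; split_ifs <;> simp_all <;> ring
        · by_cases h4 : d = b
          · subst h4; simp [h0]
          · simp [h1, h3, h4, hs c d]
      · by_cases h3 : c = b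
        · subst h3
          by_cases h4 : d = c
          · subst h4; simp [h0, h1, h2]
          · simp [h1, h2, h4]
        · by_cases h4 : d = b
          · subst h4; simp [h1, h2, h3, hs c d]
          · have h1' : a ≠ c := fun h => h1 h.symm
            have h2' : a ≠ d := fun h => h2 h.symm
            have h3' : b ≠ c := fun h => h3 h.symm
            have h4' : b ≠ d := fun h => h4 h.symm
            simp [h1, h2, h3, h4, h1', h2', h3', h4']
  have hK : ∀ (K : ℝ), K = (∑ a, ∑ b, ∑ c, Y a b * Y a c) →
      (∑ a, ∑ b, ∑ c, if b ≠ c then Y a b * Y a c else 0) = K - ∑ a, ∑ b, Y a b ^ 2 := by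
    intro K hK
    rw [hK, ← Finset.sum_sub_distrib]
    refine Finset.sum_congr rfl (fun a _ => ?_)
    rw [← Finset.sum_sub_distrib]
    refine Finset.sum_congr rfl (fun b _ => ?_)
    have : Y a b ^ 2 = ∑ c, if c = b then Y a b * Y a c else 0 := by
      simp [sq]
    rw [this, ← Finset.sum_sub_distrib]
    refine Finset.sum_congr rfl (fun c _ => ?_)
    by_cases h : c = b
    · subst h; simp
    · have : b ≠ c := fun h' => h h'.symm
      simp [h, this]
  rw [hK _ rfl]
  simp_rw [pt]
  simp only [Finset.sum_add_distrib, Finset.sum_sub_distrib]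
  have e1 : ∑ a, ∑ b, ∑ c, ∑ d, Y a b * Y c d = (∑ a, ∑ b, Y a b) ^ 2 := by
    rw [sq, Finset.sum_mul]
    refine Finset.sum_congr rfl (fun a _ => ?_)
    rw [Finset.sum_mul]
    refine Finset.sum_congr rfl (fun b _ => ?_)
    rw [Finset.mul_sum]
    refine Finset.sum_congr rfl (fun c _ => ?_)
    rw [Finset.mul_sum]
  have e2 : ∑ a, ∑ b, ∑ c, ∑ d, (if c = a then Y a b * Y a d else 0) = ∑ a, ∑ b, ∑ c, Y a b * Y a c := by
    refine Finset.sum_congr rfl (fun a _ => Finset.sum_congr rfl (fun b _ => ?_))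
    rw [Finset.sum_comm]
    simp
  have e3 : ∑ a, ∑ b, ∑ c, ∑ d, (if d = a then Y a b * Y a c else 0) = ∑ a, ∑ b, ∑ c, Y a b * Y a c := by
    simp
  have e4 : ∑ a, ∑ b, ∑ c, ∑ d, (if c = b then Y a b * Y b d else 0) = ∑ a, ∑ b, ∑ c, Y a b * Y a c := by
    rw [Finset.sum_comm]
    refine Finset.sum_congr rfl (fun a _ => Finset.sum_congr rfl (fun b _ => ?_))
    rw [Finset.sum_comm]
    simp [hs b a]
  have e5 : ∑ a, ∑ b, ∑ c, ∑ d, (if d = b then Y a b * Y b c else 0) = ∑ a, ∑ b, ∑ c, Y a b * Y a c := by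
    rw [Finset.sum_comm]
    refine Finset.sum_congr rfl (fun a _ => Finset.sum_congr rfl (fun b _ => ?_))
    simp [hs b a]
  have e6 : ∑ a, ∑ b, ∑ c, ∑ d, (if c = a then if d = b then Y a b ^ 2 else 0 else 0) = ∑ a, ∑ b, Y a b ^ 2 := by
    refine Finset.sum_congr rfl (fun a _ => Finset.sum_congr rfl (fun b _ => ?_))
    rw [Finset.sum_eq_single a] <;> simp +contextual
  have e7 : ∑ a, ∑ b, ∑ c, ∑ d, (if d = a then if c = b then Y a b ^ 2 else 0 else 0) = ∑ a, ∑ b, Y a b ^ 2 := by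
    refine Finset.sum_congr rfl (fun a _ => Finset.sum_congr rfl (fun b _ => ?_))
    simp
  rw [e1, e2, e3, e4, e5, e6, e7]
  ring

noncomputable def Wsum {n : ℕ} (ω : Sym2 (Fin n) → Bool) : ℤ :=
  ∑ a, ∑ b, if a ≠ b then (if ω s(a,b) then 1 else -1) else 0

lemma w_eq {n : ℕ} (h : 2 ≤ n) (ω : Sym2 (Fin n) → Bool) :
    (n * (n - 1) : ℝ) * tt M1 ω = Wsum ω := by
  rw [← descF2, tt_sum h]
  have : ∀ φ : Fin 2 ↪ Fin n, chi ω (M1.map φ.sym2Map) = yv ω s(φ 0, φ 1) := by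
    intro φ; simp [chi, M1]
  simp_rw [this]
  rw [sum_emb2 (fun a b => yv ω s(a, b)), Wsum]
  push_cast
  rfl

lemma t2_eq {n : ℕ} (h : 4 ≤ n) (ω : Sym2 (Fin n) → Bool) :
    (n * (n - 1) * (n - 2) * (n - 3) : ℝ) * tt M2 ω =
      (Wsum ω : ℝ) ^ 2 - 4 * ((n * (n - 1) * (n - 2) : ℝ) * tt MC ω) - 2 * (n * (n - 1)) := by
  have key := pair_identity (fun a b : Fin n => if a ≠ b then yv ω s(a, b) else 0)
    (by intro a b; simp only [Sym2.eq_swap (a := a), ne_comm (a := a)]) (by simp)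
  rw [← descF4 n h, ← descF3 n (by omega), tt_sum h, tt_sum (by omega)]
  have c2 : ∀ φ : Fin 4 ↪ Fin n, chi ω (M2.map φ.sym2Map) = yv ω s(φ 0, φ 1) * yv ω s(φ 2, φ 3) := by
    intro φ
    rw [chi, Finset.prod_map, M2, Finset.prod_pair (by decide)]
    simp
  have c3 : ∀ φ : Fin 3 ↪ Fin n, chi ω (MC.map φ.sym2Map) = yv ω s(φ 0, φ 1) * yv ω s(φ 0, φ 2) := by
    intro φ
    rw [chi, Finset.prod_map, MC, Finset.prod_pair (by decide)]
    simp
  simp_rw [c2, c3]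
  rw [sum_emb4 (fun a b c d => yv ω s(a, b) * yv ω s(c, d)),
    sum_emb3 (fun a b c => yv ω s(a, b) * yv ω s(a, c))]
  have d1 : ∑ a, ∑ b, ∑ c, ∑ d, (if a ≠ b ∧ a ≠ c ∧ a ≠ d ∧ b ≠ c ∧ b ≠ d ∧ c ≠ d then yv ω s(a, b) * yv ω s(c, d) else 0) =
     ∑ a, ∑ b, ∑ c, ∑ d, (if a ≠ c ∧ a ≠ d ∧ b ≠ c ∧ b ≠ d then
       (if a ≠ b then yv ω s(a, b) else 0) * (if c ≠ d then yv ω s(c, d) else 0) else 0) := by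
    refine Finset.sum_congr rfl (fun a _ => Finset.sum_congr rfl (fun b _ => Finset.sum_congr rfl (fun c _ => Finset.sum_congr rfl (fun d _ => ?_))))
    by_cases h1 : a = b <;> by_cases h2 : c = d <;> simp [h1, h2]
  have d2 : ∑ a, ∑ b, ∑ c, (if a ≠ b ∧ a ≠ c ∧ b ≠ c then yv ω s(a, b) * yv ω s(a, c) else 0) =
     ∑ a, ∑ b, ∑ c, (if b ≠ c then
       (if a ≠ b then yv ω s(a, b) else 0) * (if a ≠ c then yv ω s(a, c) else 0) else 0) := by
    refine Finset.sum_congr rfl (fun a _ => Finset.sum_congr rfl (fun b _ => Finset.sum_congr rfl (fun c _ => ?_)))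
    by_cases h1 : a = b <;> by_cases h2 : a = c <;> simp [h1, h2]
  have d3 : (Wsum ω : ℝ) = ∑ a, ∑ b, (if a ≠ b then yv ω s(a, b) else 0) := by
    rw [Wsum]; push_cast; rfl
  have d4 : ∑ a : Fin n, ∑ b : Fin n, (if a ≠ b then yv ω s(a, b) else 0) ^ 2 = n * (n - 1) := by
    have : ∀ a b : Fin n, (if a ≠ b then yv ω s(a, b) else 0) ^ 2 = 1 - if a = b then (1:ℝ) else 0 := by
      intro a b
      by_cases h1 : a = b
      · simp [h1]
      · simp only [yv]; split_ifs <;> simp_all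
    simp_rw [this, Finset.sum_sub_distrib]
    simp
    ring
  rw [d1, d2, d3, ← d4]
  exact key

end IC

namespace IC
open Finset
open scoped BigOperators

noncomputable def sh {k : ℕ} (H : SimpleGraph (Fin k)) (F : Finset (Sym2 (Fin k))) : ℝ :=
  𝔼 π : Fin k ↪ Fin k, sgn H (F.map π.sym2Map)

lemma sh_map {m k : ℕ} (H : SimpleGraph (Fin k)) (α : Fin m ↪ Fin k) (F : Finset (Sym2 (Fin m))) :
    sh H (F.map α.sym2Map) = 𝔼 ψ : Fin m ↪ Fin k, sgn H (F.map ψ.sym2Map) := by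
  unfold sh
  simp_rw [map_trans]
  exact avg_comp le_rfl α (fun ψ => sgn H (F.map ψ.sym2Map))

lemma PP_map {k n : ℕ} (π : Fin k ↪ Fin n) {F : Finset (Sym2 (Fin k))} (hF : F ⊆ PP k) :
    F.map π.sym2Map ⊆ PP n := by
  intro e he
  rw [Finset.mem_map] at he
  obtain ⟨e', he', rfl⟩ := he
  have := hF he'
  simp only [PP, mem_filter, mem_univ, true_and] at this ⊢
  induction e' with
  | _ a b => simpa using this

lemma powerset_map {k : ℕ} (π : Fin k ↪ Fin k) :
    (PP k).powerset.map (Finset.mapEmbedding π.sym2Map).toEmbedding = (PP k).powerset := by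
  apply Finset.eq_of_subset_of_card_le
  · intro F hF
    rw [Finset.mem_map] at hF
    obtain ⟨F', hF', rfl⟩ := hF
    rw [Finset.mem_powerset] at hF' ⊢
    exact PP_map π hF'
  · rw [Finset.card_map]

lemma ZZ_sym {k n : ℕ} (hk : k ≤ n) (H : SimpleGraph (Fin k)) (ω : Sym2 (Fin n) → Bool) :
    ZZ H ω = ∑ F ∈ (PP k).powerset, sh H F * tt F ω := by
  have ne1 : Nonempty (Fin k ↪ Fin k) := ⟨Function.Embedding.refl _⟩
  have h1 : ∀ π : Fin k ↪ Fin k, ZZ H ω =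
      ∑ F ∈ (PP k).powerset, sgn H (F.map π.sym2Map) * tt F ω := by
    intro π
    rw [ZZ]
    conv_lhs => rw [← powerset_map π]
    rw [Finset.sum_map]
    refine Finset.sum_congr rfl (fun F _ => ?_)
    have := tt_map hk π F ω
    simp only [RelEmbedding.coe_toEmbedding, Finset.mapEmbedding_apply]
    rw [this]
  have h2 : ZZ H ω = 𝔼 π : Fin k ↪ Fin k,
      ∑ F ∈ (PP k).powerset, sgn H (F.map π.sym2Map) * tt F ω := by
    rw [← Finset.expect_congr rfl (fun π _ => h1 π), Fintype.expect_const]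
  rw [h2, Finset.expect_sum_comm]
  refine Finset.sum_congr rfl (fun F _ => ?_)
  rw [sh, Finset.expect_mul]

def IsM2 {k : ℕ} (F : Finset (Sym2 (Fin k))) : Prop := ∃ α : Fin 4 ↪ Fin k, F = M2.map α.sym2Map

lemma tt_inner {m m' n : ℕ} (F : Finset (Sym2 (Fin m))) (F' : Finset (Sym2 (Fin m'))) :
    𝔼 ω : Sym2 (Fin n) → Bool, tt F ω * tt F' ω = 𝔼 φ : Fin m ↪ Fin n, 𝔼 φ' : Fin m' ↪ Fin n,
      (if F.map φ.sym2Map = F'.map φ'.sym2Map then (1:ℝ) else 0) := by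
  have : ∀ ω : Sym2 (Fin n) → Bool, tt F ω * tt F' ω = 𝔼 φ : Fin m ↪ Fin n, 𝔼 φ' : Fin m' ↪ Fin n,
      chi ω (F.map φ.sym2Map) * chi ω (F'.map φ'.sym2Map) := by
    intro ω
    rw [tt, tt, Finset.expect_mul_expect]
  simp_rw [this]
  rw [Finset.expect_comm]
  refine Finset.expect_congr rfl (fun φ _ => ?_)
  rw [Finset.expect_comm]
  refine Finset.expect_congr rfl (fun φ' _ => ?_)
  exact chi_orth _ _

lemma tt_inner_zero {m m' n : ℕ} (F : Finset (Sym2 (Fin m))) (F' : Finset (Sym2 (Fin m')))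
    (h : F.card ≠ F'.card) : 𝔼 ω : Sym2 (Fin n) → Bool, tt F ω * tt F' ω = 0 := by
  rw [tt_inner]
  apply Finset.expect_eq_zero
  intro φ _
  apply Finset.expect_eq_zero
  intro φ' _
  rw [if_neg]
  intro he
  apply h
  have := congrArg Finset.card he
  simpa using this

lemma w_sq_lower {n : ℕ} (hn : 2 ≤ n) :
    1 / (n:ℝ) ^ 2 ≤ 𝔼 ω : Sym2 (Fin n) → Bool, tt M1 ω * tt M1 ω := by
  have ne1 : Nonempty (Fin 2 ↪ Fin n) := ⟨Fin.castLEEmb hn⟩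
  rw [tt_inner]
  have hc : (Fintype.card (Fin 2 ↪ Fin n) : ℝ) = n * (n - 1) := by
    rw [Fintype.card_embedding_eq, Fintype.card_fin, Fintype.card_fin, descF2]
  have hn' : (2:ℝ) ≤ n := by exact_mod_cast hn
  have h1 : ∀ φ : Fin 2 ↪ Fin n, 1 / (n:ℝ) ^ 2 ≤ 𝔼 φ' : Fin 2 ↪ Fin n,
      (if M1.map φ.sym2Map = M1.map φ'.sym2Map then (1:ℝ) else 0) := by
    intro φ
    rw [Fintype.expect_eq_sum_div_card, hc]
    have h2 : (1:ℝ) ≤ ∑ φ' : Fin 2 ↪ Fin n,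
        (if M1.map φ.sym2Map = M1.map φ'.sym2Map then (1:ℝ) else 0) := by
      have := Finset.single_le_sum (s := univ)
        (f := fun φ' : Fin 2 ↪ Fin n => (if M1.map φ.sym2Map = M1.map φ'.sym2Map then (1:ℝ) else 0))
        (fun i _ => by positivity) (Finset.mem_univ φ)
      simpa using this
    have h3 : (0:ℝ) < n * (n - 1) := by nlinarith
    rw [div_le_div_iff₀ (by positivity) h3]
    nlinarith
  calc _ = 𝔼 φ : Fin 2 ↪ Fin n, 1 / (n:ℝ) ^ 2 := (Fintype.expect_const _).symm
    _ ≤ _ := Finset.expect_le_expect (fun φ _ => h1 φ)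

lemma one_eq {k : ℕ} {F : Finset (Sym2 (Fin k))} (hF : F ⊆ PP k) (h : F.card = 1) :
    ∃ α : Fin 2 ↪ Fin k, F = M1.map α.sym2Map := by
  rw [Finset.card_eq_one] at h
  obtain ⟨e, rfl⟩ := h
  have he := hF (Finset.mem_singleton_self e)
  simp only [PP, mem_filter, mem_univ, true_and] at he
  induction e with
  | _ a b =>
    have hab : a ≠ b := by simpa using he
    refine ⟨⟨![a, b], ?_⟩, ?_⟩
    · intro i j hij
      fin_cases i <;> fin_cases j <;> simp_all
    · simp [M1]
      left
      exact ⟨rfl, rfl⟩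

noncomputable def s1 {k : ℕ} (H : SimpleGraph (Fin k)) : ℝ := 𝔼 ψ : Fin 2 ↪ Fin k, sgn H (M1.map ψ.sym2Map)

lemma sum_one {k n : ℕ} (hk : k ≤ n) (H : SimpleGraph (Fin k)) (ω : Sym2 (Fin n) → Bool) :
    ∑ F ∈ (PP k).powerset with F.card = 1, sh H F * tt F ω = ((PP k).card * s1 H) * tt M1 ω := by
  have h1 : ∀ F ∈ (PP k).powerset.filter (fun F => F.card = 1), sh H F * tt F ω = s1 H * tt M1 ω := by
    intro F hF
    rw [Finset.mem_filter, Finset.mem_powerset] at hF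
    obtain ⟨α, rfl⟩ := one_eq hF.1 hF.2
    rw [sh_map, tt_map hk, s1]
  rw [Finset.sum_congr rfl h1, Finset.sum_const, nsmul_eq_mul, mul_assoc]
  congr 2
  rw [← Finset.powersetCard_eq_filter, Finset.card_powersetCard, Nat.choose_one_right]

lemma expect_ZZ_w {k n : ℕ} (hk : k ≤ n) (H : SimpleGraph (Fin k)) :
    𝔼 ω : Sym2 (Fin n) → Bool, ZZ H ω * tt M1 ω =
      ((PP k).card * s1 H) * 𝔼 ω : Sym2 (Fin n) → Bool, tt M1 ω * tt M1 ω := by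
  have h1 : ∀ ω : Sym2 (Fin n) → Bool, ZZ H ω * tt M1 ω =
      ((PP k).card * s1 H) * (tt M1 ω * tt M1 ω) +
        ∑ F ∈ (PP k).powerset with ¬ F.card = 1, sh H F * (tt F ω * tt M1 ω) := by
    intro ω
    rw [ZZ_sym hk, ← Finset.sum_filter_add_sum_filter_not _ (fun F => F.card = 1), sum_one hk, add_mul,
      Finset.sum_mul]
    congr 1
    · ring
    · exact Finset.sum_congr rfl (fun F _ => by ring)
  simp_rw [h1]
  rw [Finset.expect_add_distrib, ← Finset.mul_expect, Finset.expect_sum_comm]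
  rw [Finset.sum_eq_zero, add_zero]
  intro F hF
  rw [← Finset.mul_expect, tt_inner_zero, mul_zero]
  rw [Finset.mem_filter] at hF
  simpa [M1] using hF.2

lemma expect_w {n : ℕ} (hn : 2 ≤ n) : 𝔼 ω : Sym2 (Fin n) → Bool, tt M1 ω = 0 := by
  have h := tt_inner_zero (n := n) (∅ : Finset (Sym2 (Fin 2))) M1 (by decide)
  have ne1 : Nonempty (Fin 2 ↪ Fin n) := ⟨Fin.castLEEmb hn⟩
  rw [← h]
  refine Finset.expect_congr rfl (fun ω _ => ?_)
  have : tt (∅ : Finset (Sym2 (Fin 2))) ω = 1 := by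
    simp [tt, chi]
  rw [this, one_mul]

lemma var_lower {k n : ℕ} (hk : k ≤ n) (hn : 2 ≤ n) (H : SimpleGraph (Fin k)) (c : ℝ) :
    ((PP k).card * s1 H) ^ 2 / (n:ℝ) ^ 2 ≤ 𝔼 ω : Sym2 (Fin n) → Bool, (ZZ H ω - c) ^ 2 := by
  set A := ((PP k).card * s1 H) with hA
  set v := 𝔼 ω : Sym2 (Fin n) → Bool, tt M1 ω * tt M1 ω with hv
  have hv1 := w_sq_lower hn
  rw [← hv] at hv1
  have h1 : 𝔼 ω : Sym2 (Fin n) → Bool, (ZZ H ω - c - A * tt M1 ω) ^ 2 =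
      𝔼 ω : Sym2 (Fin n) → Bool, (ZZ H ω - c) ^ 2 - A ^ 2 * v := by
    have : ∀ ω : Sym2 (Fin n) → Bool, (ZZ H ω - c - A * tt M1 ω) ^ 2 =
        (ZZ H ω - c) ^ 2 - (2 * A) * (ZZ H ω * tt M1 ω) + (2 * A * c) * tt M1 ω
          + A ^ 2 * (tt M1 ω * tt M1 ω) := by intro ω; ring
    simp_rw [this]
    rw [Finset.expect_add_distrib, Finset.expect_add_distrib, Finset.expect_sub_distrib,
      ← Finset.mul_expect, ← Finset.mul_expect, ← Finset.mul_expect, expect_ZZ_w hk, expect_w hn, ← hv, ← hA]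
    ring
  have h2 : 0 ≤ 𝔼 ω : Sym2 (Fin n) → Bool, (ZZ H ω - c - A * tt M1 ω) ^ 2 :=
    Finset.expect_nonneg (fun ω _ => sq_nonneg _)
  have h3 : A ^ 2 / (n:ℝ) ^ 2 ≤ A ^ 2 * v := by
    rw [div_eq_mul_one_div]
    exact mul_le_mul_of_nonneg_left hv1 (sq_nonneg _)
  linarith

lemma VV_M1 : (VV M1).card = 2 := by decide
lemma VV_MC : (VV MC).card = 3 := by decide

lemma Wsum_sq {n : ℕ} (hn : 4 ≤ n) : 𝔼 ω : Sym2 (Fin n) → Bool, (Wsum ω : ℝ) ^ 2 ≤ 16 * (n:ℝ) ^ 2 := by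
  have h := tt_sq (m := 2) (n := n) (by omega) (by omega) M1
  rw [VV_M1] at h
  have hn' : (4:ℝ) ≤ n := by exact_mod_cast hn
  simp_rw [← w_eq (show 2 ≤ n by omega), mul_pow]
  rw [← Finset.mul_expect]
  calc _ ≤ ((n:ℝ) * n) ^ 2 * ((2 * (2:ℕ)) ^ 2 / (n:ℝ) ^ 2) := by
        rw [← mul_pow]
        have : (0:ℝ) ≤ n - 1 := by linarith
        gcongr
        linarith
    _ = _ := by field_simp; norm_num

lemma decomp {k : ℕ} (H : SimpleGraph (Fin k))
    (hH : ∀ F ∈ (PP k).powerset, 2 ≤ F.card → ¬ IsM2 F → (VV F).card ≤ 4 → sh H F = 0) :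
    ∃ C : ℝ, 0 < C ∧ ∀ n : ℕ, 2 * k + 8 ≤ n → ∃ (g : ℤ → ℝ) (R : (Sym2 (Fin n) → Bool) → ℝ),
      (∀ ω, ZZ H ω = g (Wsum ω) + R ω) ∧ 𝔼 ω, (R ω) ^ 2 ≤ C / (n:ℝ) ^ 5 := by
  classical
  let bad : Finset (Finset (Sym2 (Fin k))) := (PP k).powerset.filter (fun F => 2 ≤ F.card ∧ ¬ IsM2 F)
  let B : ℝ := ∑ F ∈ (PP k).powerset with (2 ≤ F.card ∧ IsM2 F), sh H F
  let A : ℝ := (PP k).card * s1 H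
  let C0 : ℝ := bad.card * ∑ F ∈ bad, (sh H F) ^ 2 * (2 * k : ℝ) ^ k
  have hC0 : 0 ≤ C0 := by positivity
  refine ⟨2 * C0 + 32 * B ^ 2 * 4 * 6 ^ 3 + 1, by positivity, fun n hn => ?_⟩
  have hn' : (8:ℝ) ≤ n := by
    have : 8 ≤ n := by omega
    exact_mod_cast this
  have hk : k ≤ n := by omega
  let R0 : (Sym2 (Fin n) → Bool) → ℝ := fun ω => ∑ F ∈ bad, sh H F * tt F ω
  have hZ : ∀ ω : Sym2 (Fin n) → Bool, ZZ H ω = sh H ∅ + A * tt M1 ω + B * tt M2 ω + R0 ω := by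
    intro ω
    have ne1 : Nonempty (Fin k ↪ Fin n) := ⟨Fin.castLEEmb hk⟩
    rw [ZZ_sym hk, ← Finset.sum_filter_add_sum_filter_not _ (fun F => F.card = 1), sum_one hk,
      ← Finset.sum_filter_add_sum_filter_not (Finset.filter _ _) (fun F => F.card = 0), Finset.filter_filter,
      Finset.filter_filter,
      ← Finset.sum_filter_add_sum_filter_not (Finset.filter (fun a => ¬ a.card = 1 ∧ ¬ a.card = 0) _) (fun F => IsM2 F), Finset.filter_filter,
      Finset.filter_filter]
    have e0 : ∑ F ∈ (PP k).powerset with (¬ F.card = 1 ∧ F.card = 0), sh H F * tt F ω = sh H ∅ := by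
      have : (PP k).powerset.filter (fun F => ¬ F.card = 1 ∧ F.card = 0) = {∅} := by
        ext F
        simp only [mem_filter, mem_powerset, card_eq_zero, mem_singleton]
        constructor
        · exact fun h => h.2.2
        · rintro rfl; simp
      rw [this, Finset.sum_singleton]
      have : tt (∅ : Finset (Sym2 (Fin k))) ω = 1 := by simp [tt, chi]
      rw [this, mul_one]
    have e1 : ∑ F ∈ (PP k).powerset with ((¬ F.card = 1 ∧ ¬ F.card = 0) ∧ IsM2 F), sh H F * tt F ω = B * tt M2 ω := by
      have : (PP k).powerset.filter (fun F => (¬ F.card = 1 ∧ ¬ F.card = 0) ∧ IsM2 F) =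
         (PP k).powerset.filter (fun F => 2 ≤ F.card ∧ IsM2 F) := by
        apply Finset.filter_congr
        intro F _
        have : (¬ F.card = 1 ∧ ¬ F.card = 0) ↔ 2 ≤ F.card := by omega
        rw [this]
      rw [this, Finset.sum_mul]
      refine Finset.sum_congr rfl (fun F hF => ?_)
      rw [Finset.mem_filter] at hF
      obtain ⟨α, hα⟩ := hF.2.2
      congr 1
      rw [hα, tt_map hk]
    have e2 : ∑ F ∈ (PP k).powerset with ((¬ F.card = 1 ∧ ¬ F.card = 0) ∧ ¬ IsM2 F), sh H F * tt F ω = R0 ω := by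
      have : (PP k).powerset.filter (fun F => (¬ F.card = 1 ∧ ¬ F.card = 0) ∧ ¬ IsM2 F) = bad := by
        apply Finset.filter_congr
        intro F _
        have : (¬ F.card = 1 ∧ ¬ F.card = 0) ↔ 2 ≤ F.card := by omega
        rw [this]
      rw [this]
    rw [e0, e1, e2]
    ring
  have hR0 : 𝔼 ω, (R0 ω) ^ 2 ≤ C0 / (n:ℝ) ^ 5 := by
    calc 𝔼 ω, (R0 ω) ^ 2 ≤ 𝔼 ω : Sym2 (Fin n) → Bool, (bad.card : ℝ) * ∑ F ∈ bad, (sh H F * tt F ω) ^ 2 :=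
          Finset.expect_le_expect (fun ω _ => sq_sum_le_card_mul_sum_sq)
      _ = (bad.card : ℝ) * ∑ F ∈ bad, (sh H F) ^ 2 * 𝔼 ω : Sym2 (Fin n) → Bool, (tt F ω) ^ 2 := by
          rw [← Finset.mul_expect, Finset.expect_sum_comm]
          simp_rw [mul_pow, Finset.mul_expect]
      _ ≤ (bad.card : ℝ) * ∑ F ∈ bad, (sh H F) ^ 2 * ((2 * k : ℝ) ^ k / (n:ℝ) ^ 5) := by
          apply mul_le_mul_of_nonneg_left _ (by positivity)
          apply Finset.sum_le_sum
          intro F hF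
          rw [Finset.mem_filter] at hF
          by_cases hV : (VV F).card ≤ 4
          · rw [hH F hF.1 hF.2.1 hF.2.2 hV]; simp
          · apply mul_le_mul_of_nonneg_left _ (sq_nonneg _)
            refine (tt_sq (by omega) (by omega) F).trans ?_
            apply div_le_div_of_nonneg_left (by positivity) (by positivity)
            apply pow_le_pow_right₀ (by linarith)
            omega
      _ = C0 / (n:ℝ) ^ 5 := by
          simp only [C0]
          rw [mul_div_assoc, Finset.sum_div]
          congr 1
          exact Finset.sum_congr rfl (fun F _ => by ring)
  have hn3 : (0:ℝ) < n - 3 := by linarith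
  have hn2 : (0:ℝ) < n - 2 := by linarith
  have hn1 : (0:ℝ) < n - 1 := by linarith
  refine ⟨fun W => sh H ∅ + A * (W / (n * (n - 1))) + B * ((W ^ 2 - 2 * (n * (n - 1))) / (n * (n - 1) * (n - 2) * (n - 3))),
    fun ω => R0 ω + (- (4 * B / (n - 3))) * tt MC ω, ?_, ?_⟩
  · intro ω
    rw [hZ]
    have h1 := w_eq (show 2 ≤ n by omega) ω
    have h2 := t2_eq (show 4 ≤ n by omega) ω
    have h1' : tt M1 ω = (Wsum ω : ℝ) / (n * (n - 1)) := by
      rw [eq_div_iff (by positivity)]; linarith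
    have h2' : tt M2 ω = ((Wsum ω : ℝ) ^ 2 - 4 * ((n * (n - 1) * (n - 2) : ℝ) * tt MC ω) - 2 * (n * (n - 1))) / (n * (n - 1) * (n - 2) * (n - 3)) := by
      rw [eq_div_iff (by positivity)]; linarith
    rw [h1', h2']
    field_simp
    ring
  · have hc := tt_sq (m := 3) (n := n) (by omega) (by omega) MC
    rw [VV_MC] at hc
    calc 𝔼 ω, (R0 ω + (- (4 * B / (n - 3))) * tt MC ω) ^ 2
        ≤ 𝔼 ω, (2 * (R0 ω) ^ 2 + (32 * B ^ 2 / (n - 3) ^ 2) * (tt MC ω) ^ 2) := by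
          apply Finset.expect_le_expect
          intro ω _
          have : (32 * B ^ 2 / ((n:ℝ) - 3) ^ 2) * (tt MC ω) ^ 2 = 2 * ((- (4 * B / (n - 3))) * tt MC ω) ^ 2 := by
            field_simp; ring
          rw [this]
          nlinarith [sq_nonneg (R0 ω - (- (4 * B / (n - 3))) * tt MC ω)]
      _ = 2 * 𝔼 ω, (R0 ω) ^ 2 + (32 * B ^ 2 / (n - 3) ^ 2) * 𝔼 ω : Sym2 (Fin n) → Bool, (tt MC ω) ^ 2 := by
          rw [Finset.expect_add_distrib, Finset.mul_expect, Finset.mul_expect]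
      _ ≤ 2 * (C0 / (n:ℝ) ^ 5) + (32 * B ^ 2 / (n / 2) ^ 2) * ((2 * (3:ℕ)) ^ 3 / (n:ℝ) ^ 3) := by
          have h5 : 0 ≤ 𝔼 ω : Sym2 (Fin n) → Bool, (tt MC ω) ^ 2 :=
            Finset.expect_nonneg (fun ω _ => sq_nonneg _)
          have : (n:ℝ) / 2 ≤ n - 3 := by linarith
          gcongr
      _ ≤ _ := by
          have h6 : 2 * (C0 / (n:ℝ) ^ 5) + (32 * B ^ 2 / (n / 2) ^ 2) * ((2 * (3:ℕ)) ^ 3 / (n:ℝ) ^ 3) =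
            (2 * C0 + 32 * B ^ 2 * 4 * 6 ^ 3) / (n:ℝ) ^ 5 := by
            field_simp; norm_num; ring
          rw [h6]
          apply div_le_div_of_nonneg_right _ (by positivity)
          linarith

end IC

namespace IC
open Finset
open scoped BigOperators

lemma gnp_integral (n : ℕ) (f : (Sym2 (Fin n) → Bool) → ℝ) :
    ∫ ω, f ω ∂(gnp n (1 / 2)) = 𝔼 ω, f ω := by
  unfold gnp bernoulliPi
  rw [integral_finsetSum_measure]
  · rw [Fintype.expect_eq_sum_div_card, Finset.sum_div]
    refine Finset.sum_congr rfl (fun x _ => ?_)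
    rw [integral_smul_measure, integral_dirac]
    have : ∀ i, (if x i = true then (1 / 2 : ℝ) else 1 - 1 / 2) = 1 / 2 := by
      intro i; split_ifs <;> norm_num
    simp_rw [this]
    rw [Finset.prod_const, ENNReal.toReal_pow, ENNReal.toReal_ofReal (by norm_num), Fintype.card_fun,
      Fintype.card_bool, Finset.card_univ, smul_eq_mul]
    push_cast
    rw [one_div, inv_pow]
    field_simp
  · intro x _
    apply Integrable.smul_measure
    · exact integrable_dirac (by simp)
    · exact ENNReal.prod_ne_top (fun i _ => ENNReal.ofReal_ne_top)

open Classical in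
lemma gnp_measure (n : ℕ) (S : Set (Sym2 (Fin n) → Bool)) :
    ((gnp n (1 / 2)) S).toReal = 𝔼 ω, (if ω ∈ S then (1:ℝ) else 0) := by
  have h := gnp_integral n (S.indicator 1)
  rw [integral_indicator_one (Set.toFinite S).measurableSet] at h
  rw [measureReal_def] at h
  rw [h]
  refine Finset.expect_congr rfl (fun ω _ => ?_)
  simp [Set.indicator_apply]

open Classical in
lemma pigeon {Ω : Type*} [Fintype Ω] [Nonempty Ω] (N : Ω → ℕ) (W : Ω → ℤ) (Z R : Ω → ℝ) (g : ℤ → ℝ)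
    (L C q : ℝ) (n : ℕ) (hn : 1 ≤ n) (hq : 0 < q) (hqn : q ^ 2 = n) (hC : 0 < C) (hL : (n:ℝ) ^ 3 ≤ L)
    (hX : ∀ ω, (N ω : ℝ) = L * Z ω) (hZ : ∀ ω, Z ω = g (W ω) + R ω)
    (hR : 𝔼 ω, (R ω) ^ 2 ≤ C / (n:ℝ) ^ 5) (hW : 𝔼 ω, (W ω : ℝ) ^ 2 ≤ 16 * (n:ℝ) ^ 2) :
    ∃ x : ℤ, q ^ 3 / (34 * (4 * Real.sqrt C + 1) * L) ≤ 𝔼 ω, (if (N ω : ℝ) = x then (1:ℝ) else 0) := by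
  have hn' : (1:ℝ) ≤ n := by exact_mod_cast hn
  have hLp : 0 < L := lt_of_lt_of_le (by positivity) hL
  have hq1 : 1 ≤ q := by nlinarith
  set r : ℝ := 2 * Real.sqrt C / q ^ 5 with hr
  have hsC : 0 < Real.sqrt C := Real.sqrt_pos.2 hC
  have hrp : 0 < r := by positivity
  have hr2 : r ^ 2 = 4 * C / (n:ℝ) ^ 5 := by
    rw [hr, div_pow, mul_pow, Real.sq_sqrt hC.le, ← hqn]; ring
  let T : Finset ℤ := (Finset.Icc (-(8 * n) : ℤ) (8 * n)).biUnion
    (fun w => Finset.Icc ⌈L * (g w - r)⌉ ⌊L * (g w + r)⌋)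
  set M : ℝ := 17 * (4 * Real.sqrt C + 1) * L / q ^ 3 with hM
  have hMp : 0 < M := by positivity
  have hT : (T.card : ℝ) ≤ M := by
    have h1 : T.card ≤ ∑ w ∈ Finset.Icc (-(8 * n) : ℤ) (8 * n), (Finset.Icc ⌈L * (g w - r)⌉ ⌊L * (g w + r)⌋).card :=
      Finset.card_biUnion_le
    have h2 : ∀ w ∈ Finset.Icc (-(8 * n) : ℤ) (8 * n), ((Finset.Icc ⌈L * (g w - r)⌉ ⌊L * (g w + r)⌋).card : ℝ) ≤ 2 * L * r + 1 := by
      intro w _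
      rw [Int.card_Icc]
      have h3 : (((⌊L * (g w + r)⌋ + 1 - ⌈L * (g w - r)⌉).toNat : ℤ) : ℝ) ≤ 2 * L * r + 1 := by
        rw [Int.toNat_eq_max, Int.cast_max]
        apply max_le
        · push_cast
          have := Int.floor_le (L * (g w + r))
          have := Int.le_ceil (L * (g w - r))
          linarith
        · push_cast; positivity
      exact_mod_cast h3
    have h4 : (T.card : ℝ) ≤ ∑ w ∈ Finset.Icc (-(8 * n) : ℤ) (8 * n), (2 * L * r + 1) := by
      refine le_trans (Nat.cast_le.2 h1) ?_
      push_cast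
      exact Finset.sum_le_sum h2
    rw [Finset.sum_const, Int.card_Icc, nsmul_eq_mul] at h4
    have h5 : (((8 * n + 1 - (-(8 * n)) : ℤ).toNat : ℕ) : ℝ) = 16 * n + 1 := by
      have : (8 * n + 1 - (-(8 * n)) : ℤ).toNat = 16 * n + 1 := by omega
      rw [this]; push_cast; ring
    rw [h5] at h4
    have h6 : 1 ≤ L / q ^ 5 := by
      rw [le_div_iff₀ (by positivity), one_mul]
      refine le_trans ?_ hL
      rw [← hqn, ← pow_mul]
      exact pow_le_pow_right₀ hq1 (by norm_num)
    calc (T.card : ℝ) ≤ _ := h4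
      _ ≤ (17 * q ^ 2) * (2 * L * r + L / q ^ 5) := by
          rw [hqn]
          gcongr
          linarith
      _ = M := by
          rw [hM, hr]; field_simp; ring
  have hgood : ∀ ω, 1 - (R ω) ^ 2 / r ^ 2 - (W ω : ℝ) ^ 2 / (64 * (n:ℝ) ^ 2) ≤
      ∑ x ∈ T, (if (N ω : ℝ) = x then (1:ℝ) else 0) := by
    intro ω
    have p0 : 0 ≤ ∑ x ∈ T, (if (N ω : ℝ) = x then (1:ℝ) else 0) :=
      Finset.sum_nonneg (fun x _ => by positivity)
    have p1 : 0 ≤ (R ω) ^ 2 / r ^ 2 := by positivity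
    have p2 : 0 ≤ (W ω : ℝ) ^ 2 / (64 * (n:ℝ) ^ 2) := by positivity
    by_cases h1 : r ^ 2 < (R ω) ^ 2
    · have : 1 ≤ (R ω) ^ 2 / r ^ 2 := by rw [le_div_iff₀ (by positivity)]; linarith
      linarith
    by_cases h2 : (64 * (n:ℝ) ^ 2) < (W ω : ℝ) ^ 2
    · have : 1 ≤ (W ω : ℝ) ^ 2 / (64 * (n:ℝ) ^ 2) := by rw [le_div_iff₀ (by positivity)]; linarith
      linarith
    push Not at h1 h2
    have h1' := abs_le_of_sq_le_sq' h1 hrp.le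
    have h2' : (W ω : ℝ) ^ 2 ≤ (8 * n) ^ 2 := by linarith
    have h2'' := abs_le_of_sq_le_sq' h2' (by positivity)
    have hmem : (N ω : ℤ) ∈ T := by
      simp only [T, Finset.mem_biUnion, Finset.mem_Icc]
      refine ⟨W ω, ⟨by exact_mod_cast h2''.1, by exact_mod_cast h2''.2⟩, ?_, ?_⟩
      · rw [Int.ceil_le]
        push_cast
        rw [hX, hZ]
        apply mul_le_mul_of_nonneg_left _ hLp.le
        linarith
      · rw [Int.le_floor]
        push_cast
        rw [hX, hZ]
        apply mul_le_mul_of_nonneg_left _ hLp.le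
        linarith
    have := Finset.single_le_sum (f := fun x : ℤ => (if (N ω : ℝ) = x then (1:ℝ) else 0))
      (fun x _ => by positivity) hmem
    simp only [Int.cast_natCast, if_true] at this
    linarith
  have hsum : 1 / 2 ≤ ∑ x ∈ T, 𝔼 ω, (if (N ω : ℝ) = x then (1:ℝ) else 0) := by
    rw [← Finset.expect_sum_comm]
    refine le_trans ?_ (Finset.expect_le_expect (fun ω _ => hgood ω))
    rw [Finset.expect_sub_distrib, Finset.expect_sub_distrib, Fintype.expect_const, ← Finset.expect_div,
      ← Finset.expect_div]
    have e1 : (𝔼 ω, (R ω) ^ 2) / r ^ 2 ≤ 1 / 4 := by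
      rw [div_le_iff₀ (by positivity), hr2]
      refine hR.trans (le_of_eq ?_)
      ring
    have e2 : (𝔼 ω, (W ω : ℝ) ^ 2) / (64 * (n:ℝ) ^ 2) ≤ 1 / 4 := by
      rw [div_le_iff₀ (by positivity)]
      linarith
    linarith
  have hTne : T.Nonempty := by
    by_contra h
    rw [Finset.not_nonempty_iff_eq_empty] at h
    rw [h] at hsum
    norm_num at hsum
  have hfin : ∑ x ∈ T, (1 / (2 * M)) ≤ ∑ x ∈ T, 𝔼 ω, (if (N ω : ℝ) = x then (1:ℝ) else 0) := by
    refine le_trans ?_ hsum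
    rw [Finset.sum_const, nsmul_eq_mul, mul_one_div, div_le_div_iff₀ (by positivity) (by norm_num)]
    linarith
  obtain ⟨x, _, hx⟩ := Finset.exists_le_of_sum_le hTne hfin
  refine ⟨x, le_trans (le_of_eq ?_) hx⟩
  rw [hM]
  field_simp
  norm_num

lemma L_lower {k n : ℕ} (hk : 4 ≤ k) (hn : 2 * k ≤ n) (D : ℝ) (hD : 0 < D) (hDn : 2 ^ k * D ≤ n) :
    (n:ℝ) ^ 3 ≤ (n.descFactorial k : ℝ) / D := by
  have hn0 : (1:ℝ) ≤ n := by
    have : 1 ≤ n := by omega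
    exact_mod_cast this
  have hN : (n / 2 : ℝ) ^ k ≤ (n.descFactorial k : ℝ) := by
    have := Nat.pow_sub_le_descFactorial n k
    have h3 : ((n + 1 - k : ℕ) : ℝ) ^ k ≤ (n.descFactorial k : ℝ) := by exact_mod_cast this
    refine le_trans ?_ h3
    gcongr
    rw [Nat.cast_sub (by omega)]
    have : (2 * k : ℝ) ≤ n := by exact_mod_cast hn
    push_cast
    linarith
  rw [le_div_iff₀ hD]
  refine le_trans ?_ hN
  rw [div_pow, le_div_iff₀ (by positivity)]
  calc (n:ℝ) ^ 3 * D * 2 ^ k = (n:ℝ) ^ 3 * (2 ^ k * D) := by ring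
    _ ≤ (n:ℝ) ^ 3 * n := by gcongr
    _ = (n:ℝ) ^ 4 := by ring
    _ ≤ (n:ℝ) ^ k := pow_le_pow_right₀ hn0 hk

theorem general {k : ℕ} (hk4 : 4 ≤ k) (H : SimpleGraph (Fin k)) (hs : s1 H ≠ 0)
    (hH : ∀ F ∈ (PP k).powerset, 2 ≤ F.card → ¬ IsM2 F → (VV F).card ≤ 4 → sh H F = 0) :
    ∃ c : ℝ, 0 < c ∧ ∃ N : ℕ, ∀ n : ℕ, N ≤ n →
      let μ := gnp n (1 / 2)
      let X : (Sym2 (Fin n) → Bool) → ℝ := fun ω => (inducedCount H (graphOfFn ω) : ℝ)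
      let μH := ∫ ω, X ω ∂μ
      let σH := Real.sqrt (∫ ω, (X ω - μH) ^ 2 ∂μ)
      ∃ x : ℤ, c * (n : ℝ) ^ ((1 : ℝ) / 2) * σH⁻¹ ≤ (μ {ω | X ω = (x : ℝ)}).toReal := by
  classical
  obtain ⟨C, hC, hdec⟩ := decomp H hH
  have hPP : (PP k).card ≠ 0 := by
    apply Finset.card_ne_zero_of_mem (a := s((⟨0, by omega⟩ : Fin k), (⟨1, by omega⟩ : Fin k)))
    simp [PP]
  set A : ℝ := (PP k).card * s1 H with hA
  have hA0 : A ≠ 0 := mul_ne_zero (by exact_mod_cast hPP) hs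
  have hAp : 0 < |A| := abs_pos.2 hA0
  set D : ℝ := 2 ^ (PP k).card * (Nat.card (H ≃g H) : ℝ) with hDdef
  have hD : 0 < D := by
    have : Nonempty (H ≃g H) := ⟨RelIso.refl _⟩
    have : Finite (H ≃g H) :=
      Finite.of_injective (fun i => (i : Fin k → Fin k)) DFunLike.coe_injective
    have : 0 < Nat.card (H ≃g H) := Nat.card_pos
    positivity
  have hsC : 0 < Real.sqrt C := Real.sqrt_pos.2 hC
  refine ⟨|A| / (34 * (4 * Real.sqrt C + 1)), by positivity, 2 * k + 8 + ⌈2 ^ k * D⌉₊, fun n hn => ?_⟩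
  intro μ X μH σH
  have hn8 : 2 * k + 8 ≤ n := by omega
  have hnD : 2 ^ k * D ≤ n := by
    refine (Nat.le_ceil _).trans ?_
    exact_mod_cast (show ⌈2 ^ k * D⌉₊ ≤ n by omega)
  have hnp : (0:ℝ) < n := by
    have : 0 < n := by omega
    exact_mod_cast this
  obtain ⟨g, R, hZ, hR⟩ := hdec n hn8
  set L : ℝ := (n.descFactorial k : ℝ) / D with hLdef
  have hL : (n:ℝ) ^ 3 ≤ L := L_lower hk4 (by omega) D hD hnD
  have hLp : 0 < L := lt_of_lt_of_le (by positivity) hL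
  have hX : ∀ ω, X ω = L * ZZ H ω := fun ω => X_eq (by omega) H ω
  obtain ⟨x, hx⟩ := pigeon (fun ω => inducedCount H (graphOfFn ω)) Wsum (ZZ H) R g L C (Real.sqrt n) n
    (by omega) (Real.sqrt_pos.2 hnp) (Real.sq_sqrt hnp.le) hC hL hX hZ hR (Wsum_sq (by omega))
  refine ⟨x, ?_⟩
  rw [gnp_measure]
  refine le_trans ?_ hx
  have hσ : L * |A| / n ≤ σH := by
    apply Real.le_sqrt_of_sq_le
    rw [gnp_integral]
    have h1 : ∀ ω, (X ω - μH) ^ 2 = L ^ 2 * (ZZ H ω - μH / L) ^ 2 := by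
      intro ω
      rw [hX, ← mul_pow]
      congr 1
      field_simp
    simp_rw [h1]
    rw [← Finset.mul_expect]
    have h2 := var_lower (show k ≤ n by omega) (show 2 ≤ n by omega) H (μH / L)
    calc (L * |A| / n) ^ 2 = L ^ 2 * (A ^ 2 / (n:ℝ) ^ 2) := by
          rw [div_pow, mul_pow, sq_abs]; ring
      _ ≤ _ := by gcongr
  rw [← Real.sqrt_eq_rpow]
  have hinv : σH⁻¹ ≤ (L * |A| / n)⁻¹ := inv_anti₀ (by positivity) hσ
  calc |A| / (34 * (4 * Real.sqrt C + 1)) * Real.sqrt n * σH⁻¹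
      ≤ |A| / (34 * (4 * Real.sqrt C + 1)) * Real.sqrt n * (L * |A| / n)⁻¹ := by gcongr
    _ = Real.sqrt n * n / (34 * (4 * Real.sqrt C + 1) * L) := by
        field_simp
    _ = _ := by
        congr 1
        rw [pow_succ, Real.sq_sqrt hnp.le]; ring

end IC

namespace IC
open Finset
open scoped BigOperators

def MM : ℕ :=
  0x72c5246aabfc5718a0864d628fd3ea21d66404a971af0ad8a43c49033ce0b021069a670de1c678ca3840cc2232aea0f7a99e56dd4e00ea050212e6ce27564dceca40893400ac85b0a49ca48810ec20c83012eb1394507a0d1b6f39ba722602f41a545e271013e88cf259beb3c25a32b04b3142bce9b791a180165cc4270e53fb05e430f1b2f4514a5f2b0b9d29849a1b89748b8337d23391021d8d87f4a0cf6354bd749e1788c417ef4d1afdadc5a3f40b2e6550aeae8d1558b072477726bf782357fc5e933fe9dbc30187b9295e17c2e49e844ecfbf545d02b6cec8b29c8ab3ab524cf6f9677c600b8b5da9554c0889d53c39a8de5605a63a2cf5441d92b481c82696ba35aea5c52a16112e237d6769bd13f758d4483bf43478b99fa985c06cd202466b1024cb8453213f27a171fa28c715abb240376eebe9036dedd41a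d43afcc2fe319031d047d964a44e643ffa39b4d293a8ceca5e63c12ea0f347ccd43fa4c50af4e17310bcadd3c7feda5179756d1f23eb83686f4e600a04a856ccd033568a5f919dd1217acb2998a85ff7113e5e6c2589e64692ba9827e16925fd666c6b28539c2e6605ad81801b6bc33218c3e23575506e6231c48183b7c2e806ca302ddf24d7aa082e582d5195e8f2a696ac5497151a777df946a4956fb0215de183a969c1a4575af8c607380e22b89e5a6a0d01d8d203b3e43c56237ab5c2f50c10


noncomputable def adjB (a b : ℕ) : Bool :=
  Nat.beq (Nat.mod (Nat.shiftRight MM (Nat.add (Nat.mul 64 a) b)) 2) 1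

noncomputable def sumN (f : ℕ → ℕ) (n : ℕ) : ℕ :=
  Nat.rec 0 (fun i s => Nat.add s (f i)) n

noncomputable def force (x : ℕ) (k : ℕ → ℕ) : ℕ :=
  Nat.rec (k 0) (fun n _ => k (Nat.succ n)) x

noncomputable def build (V K : ℕ → ℕ) (n : ℕ) : List (ℕ × ℕ × ℕ) → (List (ℕ × ℕ × ℕ) → ℕ) → ℕ :=
  Nat.rec (fun acc k => k acc)
    (fun i ih acc k => force (V i) (fun v => force (K i) (fun w => ih ((i, v, w) :: acc) k))) n

noncomputable def sumL (h : ℕ × ℕ × ℕ → ℕ) (l : List (ℕ × ℕ × ℕ)) : ℕ :=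
  List.rec 0 (fun x _ s => Nat.add (h x) s) l

noncomputable def pk (v : ℕ → Bool) : ℕ :=
  sumN (fun d => Nat.mul (v d).toNat (Nat.pow 2 (Nat.mul 13 d))) 64

noncomputable def pkW (v : ℕ → ℕ) : ℕ :=
  sumN (fun c => Nat.mul (v c) (Nat.pow 2 (Nat.mul 832 c))) 64

noncomputable def neB (a b : ℕ) : Bool := cond (Nat.beq a b) false true

noncomputable def EC (o1 : ℕ) (v : ℕ → Bool) : ℕ := Nat.mul (pkW (fun c => (v c).toNat)) o1
noncomputable def ED (oW : ℕ) (v : ℕ → Bool) : ℕ := Nat.mul (pk v) oW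

noncomputable def total (m0 m1 m2 m3 m4 m5 : Bool) : ℕ :=
  force (pk (fun _ => true)) fun o1 => force (pkW (fun _ => 1)) fun oW =>
  force (Nat.mul o1 oW) fun O => force (pkW (fun c => pk (neB c))) fun N0 =>
  force (cond m5 (pkW (fun c => pk (adjB c))) 0) fun Y =>
  build (fun b => Nat.xor (cond m3 (EC o1 (adjB b)) 0) (cond m4 (ED oW (adjB b)) 0))
    (fun b => Nat.land (Nat.land N0 (EC o1 (neB b))) (ED oW (neB b))) 64 [] fun L =>
  sumL (fun p => force (Nat.xor (Nat.xor (cond m1 (EC o1 (adjB p.1)) 0) (cond m2 (ED oW (adjB p.1)) 0)) Y)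
    fun u => force p.2.2 fun ka => force p.1 fun a =>
      sumL (fun q => cond (Nat.beq a q.1) 0
        (Nat.mod (Nat.land (Nat.land (Nat.xor (Nat.xor u q.2.1) (cond (and m0 (adjB a q.1)) O 0)) ka) q.2.2) 8191)) L) L
theorem chk_cherry : Nat.beq (total true true false false false false) 7624512 = true := by decide +kernel
theorem chk_tri : Nat.beq (total true true false true false false) 7624512 = true := by decide +kernel
theorem chk_star : Nat.beq (total true true true false false false) 7624512 = true := by decide +kernel
theorem chk_path : Nat.beq (total true false false true false true) 7624512 = true := by decide +kernel
theorem chk_cycle : Nat.beq (total true false true true false true) 7624512 = true := by decide +kernel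
theorem chk_paw : Nat.beq (total true true true true false false) 7624512 = true := by decide +kernel
theorem chk_diam : Nat.beq (total true true true true true false) 7624512 = true := by decide +kernel
theorem chk_full : Nat.beq (total true true true true true true) 7624512 = true := by decide +kernel
theorem chk_edge : Nat.beq (total true false false false false false) 7624512 = false := by decide +kernel
theorem adj_symm : ∀ a b : Fin 64, adjB a b = adjB b a := by decide +kernel
theorem adj_irr : ∀ a : Fin 64, adjB a a = false := by decide +kernel

theorem force_eq (x : ℕ) (k : ℕ → ℕ) : force x k = k x := by cases x <;> rfl

theorem sumN_eq (f : ℕ → ℕ) (n : ℕ) : sumN f n = ∑ i ∈ range n, f i := by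
  induction n with
  | zero => rfl
  | succ n ih => rw [sum_range_succ, ← ih]; rfl

theorem build_eq (V K : ℕ → ℕ) (n : ℕ) : ∀ (acc : List (ℕ × ℕ × ℕ)) (k : List (ℕ × ℕ × ℕ) → ℕ),
    build V K n acc k = k ((List.range n).map (fun i => (i, V i, K i)) ++ acc) := by
  induction n with
  | zero => intro acc k; rfl
  | succ n ih =>
    intro acc k
    have : build V K (n+1) acc k =
      force (V n) (fun v => force (K n) (fun w => build V K n ((n, v, w) :: acc) k)) := rfl
    rw [this, force_eq, force_eq, ih, List.range_succ]
    simp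

theorem sumL_eq (h : ℕ × ℕ × ℕ → ℕ) (f : ℕ → ℕ × ℕ × ℕ) (n : ℕ) :
    sumL h ((List.range n).map f) = ∑ i ∈ range n, h (f i) := by
  have h1 : ∀ l, sumL h l = (l.map h).sum := by
    intro l
    induction l with
    | nil => rfl
    | cons x l ih => rw [List.map_cons, List.sum_cons, ← ih]; rfl
  rw [h1]
  induction n with
  | zero => rfl
  | succ n ih => rw [sum_range_succ, ← ih, List.range_succ]; simp

theorem xor_block (k x y a b : ℕ) (hx : x < 2^k) (hy : y < 2^k) :
    (x + a * 2^k) ^^^ (y + b * 2^k) = (x ^^^ y) + (a ^^^ b) * 2^k := by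
  have h := Nat.xor_lt_two_pow hx hy
  apply Nat.eq_of_testBit_eq
  intro j
  rw [Nat.testBit_xor, add_comm x, add_comm y, add_comm (x ^^^ y), mul_comm a, mul_comm b, mul_comm (a ^^^ b),
    Nat.testBit_two_pow_mul_add _ hx, Nat.testBit_two_pow_mul_add _ hy, Nat.testBit_two_pow_mul_add _ h]
  split_ifs <;> simp [Nat.testBit_xor]

theorem and_block (k x y a b : ℕ) (hx : x < 2^k) (hy : y < 2^k) :
    (x + a * 2^k) &&& (y + b * 2^k) = (x &&& y) + (a &&& b) * 2^k := by
  have h : x &&& y < 2^k := lt_of_le_of_lt Nat.and_le_left hx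
  apply Nat.eq_of_testBit_eq
  intro j
  rw [Nat.testBit_and, add_comm x, add_comm y, add_comm (x &&& y), mul_comm a, mul_comm b, mul_comm (a &&& b),
    Nat.testBit_two_pow_mul_add _ hx, Nat.testBit_two_pow_mul_add _ hy, Nat.testBit_two_pow_mul_add _ h]
  split_ifs <;> simp [Nat.testBit_and]

def Pk (w n : ℕ) (g : ℕ → ℕ) : ℕ := ∑ i ∈ range n, g i * 2^(w*i)

theorem Pk_lt (w n : ℕ) (g : ℕ → ℕ) (hg : ∀ i, g i < 2^w) : Pk w n g < 2^(w*n) := by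
  induction n with
  | zero => simp [Pk]
  | succ n ih =>
    rw [Pk, sum_range_succ, mul_add, mul_one, pow_add]
    have h1 := hg n
    have : Pk w n g = ∑ i ∈ range n, g i * 2^(w*i) := rfl
    rw [← this]
    have h2 : (g n + 1) * 2^(w*n) ≤ 2^w * 2^(w*n) := Nat.mul_le_mul_right _ h1
    nlinarith

theorem Pk_xor (w n : ℕ) (g h : ℕ → ℕ) (hg : ∀ i, g i < 2^w) (hh : ∀ i, h i < 2^w) :
    Pk w n g ^^^ Pk w n h = Pk w n (fun i => g i ^^^ h i) := by
  induction n with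
  | zero => simp [Pk]
  | succ n ih =>
    have e : ∀ g, Pk w (n+1) g = Pk w n g + g n * 2^(w*n) := fun g => sum_range_succ _ _
    rw [e, e, e, xor_block _ _ _ _ _ (Pk_lt w n g hg) (Pk_lt w n h hh), ih]

theorem Pk_and (w n : ℕ) (g h : ℕ → ℕ) (hg : ∀ i, g i < 2^w) (hh : ∀ i, h i < 2^w) :
    Pk w n g &&& Pk w n h = Pk w n (fun i => g i &&& h i) := by
  induction n with
  | zero => simp [Pk]
  | succ n ih =>
    have e : ∀ g, Pk w (n+1) g = Pk w n g + g n * 2^(w*n) := fun g => sum_range_succ _ _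
    rw [e, e, e, and_block _ _ _ _ _ (Pk_lt w n g hg) (Pk_lt w n h hh), ih]

def e2 (f : ℕ → ℕ → Bool) : ℕ := Pk 832 64 fun c => Pk 13 64 fun d => (f c d).toNat

theorem e2_lt1 (b : Bool) : b.toNat < 2^13 := by cases b <;> decide

theorem e2_lt2 (f : ℕ → Bool) : (Pk 13 64 fun d => (f d).toNat) < 2^832 :=
  (Pk_lt 13 64 _ (fun _ => e2_lt1 _)).trans_eq (congrArg (fun x => 2^x) (by norm_num : 13*64 = 832))

theorem e2_xor (f g : ℕ → ℕ → Bool) : e2 f ^^^ e2 g = e2 (fun c d => xor (f c d) (g c d)) := by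
  unfold e2
  rw [Pk_xor _ _ _ _ (fun _ => e2_lt2 _) (fun _ => e2_lt2 _)]
  refine congrArg (Pk 832 64) (funext fun c => ?_)
  rw [Pk_xor _ _ _ _ (fun _ => e2_lt1 _) (fun _ => e2_lt1 _)]
  refine congrArg (Pk 13 64) (funext fun d => ?_)
  beta_reduce
  cases f c d <;> cases g c d <;> rfl

theorem e2_and (f g : ℕ → ℕ → Bool) : e2 f &&& e2 g = e2 (fun c d => and (f c d) (g c d)) := by
  unfold e2
  rw [Pk_and _ _ _ _ (fun _ => e2_lt2 _) (fun _ => e2_lt2 _)]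
  refine congrArg (Pk 832 64) (funext fun c => ?_)
  rw [Pk_and _ _ _ _ (fun _ => e2_lt1 _) (fun _ => e2_lt1 _)]
  refine congrArg (Pk 13 64) (funext fun d => ?_)
  beta_reduce
  cases f c d <;> cases g c d <;> rfl

theorem Pk_mod (w n : ℕ) (hw : 2^w % 8191 = 1) (g : ℕ → ℕ) : Pk w n g ≡ ∑ i ∈ range n, g i [MOD 8191] := by
  unfold Pk
  apply Nat.ModEq.sum
  intro i _
  have h : 2^(w*i) ≡ 1 [MOD 8191] := by
    rw [pow_mul]
    have : 2^w ≡ 1 [MOD 8191] := hw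
    simpa using this.pow i
  simpa using h.mul_left (g i)

theorem e2_mod (f : ℕ → ℕ → Bool) : e2 f % 8191 = ∑ c ∈ range 64, ∑ d ∈ range 64, (f c d).toNat := by
  have h1 : e2 f ≡ ∑ c ∈ range 64, ∑ d ∈ range 64, (f c d).toNat [MOD 8191] := by
    refine (Pk_mod 832 64 (by decide +kernel) _).trans ?_
    apply Nat.ModEq.sum
    intro i _
    exact Pk_mod 13 64 (by decide +kernel) _
  have h2 : ∑ c ∈ range 64, ∑ d ∈ range 64, (f c d).toNat ≤ ∑ c ∈ range 64, ∑ d ∈ range 64, 1 :=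
    sum_le_sum fun c _ => sum_le_sum fun d _ => Bool.toNat_le _
  have h3 : ∑ c ∈ range 64, ∑ d ∈ range 64, 1 = 4096 := by simp
  rw [h1, Nat.mod_eq_of_lt]
  omega

theorem nmul (x y : ℕ) : Nat.mul x y = x * y := rfl
theorem npow (x y : ℕ) : Nat.pow x y = x ^ y := rfl

theorem pk_eq (v : ℕ → Bool) : pk v = Pk 13 64 fun d => (v d).toNat := by
  unfold pk Pk; rw [sumN_eq]; simp only [nmul, npow]

theorem pkW_eq (v : ℕ → ℕ) : pkW v = Pk 832 64 v := by
  unfold pkW Pk; rw [sumN_eq]; simp only [nmul, npow]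

theorem Pk_mul_right (w n a : ℕ) (g : ℕ → ℕ) : Pk w n g * a = Pk w n fun i => g i * a := by
  unfold Pk; rw [sum_mul]; exact sum_congr rfl fun _ _ => by ring

theorem Pk_mul_left (w n a : ℕ) (g : ℕ → ℕ) : a * Pk w n g = Pk w n fun i => a * g i := by
  unfold Pk; rw [mul_sum]; exact sum_congr rfl fun _ _ => by ring

theorem EC_eq (v : ℕ → Bool) : EC (pk (fun _ => true)) v = e2 fun c _ => v c := by
  unfold EC e2
  rw [pk_eq, pkW_eq, nmul, Pk_mul_right]
  refine congrArg (Pk 832 64) (funext fun c => ?_)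
  rw [Pk_mul_left]
  refine congrArg (Pk 13 64) (funext fun d => ?_)
  rw [Bool.toNat_true, mul_one]

theorem ED_eq (v : ℕ → Bool) : ED (pkW (fun _ => 1)) v = e2 fun _ d => v d := by
  unfold ED e2
  rw [pk_eq, pkW_eq, nmul, Pk_mul_left]
  refine congrArg (Pk 832 64) (funext fun c => ?_)
  rw [mul_one]

theorem O_eq : Nat.mul (pk (fun _ => true)) (pkW (fun _ => 1)) = e2 fun _ _ => true := by
  rw [← ED_eq]; unfold ED; with_reducible rfl

theorem Pk_zero (w n : ℕ) : (Pk w n fun _ => 0) = 0 := by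
  unfold Pk; exact sum_eq_zero fun _ _ => zero_mul _

theorem e2_false : e2 (fun _ _ => false) = 0 := by
  unfold e2; beta_reduce; rw [Bool.toNat_false, Pk_zero, Pk_zero]

theorem W_eq (f : ℕ → ℕ → Bool) : pkW (fun c => pk (f c)) = e2 f := by
  rw [pkW_eq]; unfold e2
  refine congrArg (Pk 832 64) (funext fun c => ?_)
  rw [pk_eq]

theorem cond_e2 (m : Bool) (f : ℕ → ℕ → Bool) : cond m (e2 f) 0 = e2 fun c d => and m (f c d) := by
  cases m
  · have h1 : ∀ x : ℕ, cond false x 0 = 0 := fun _ => rfl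
    have h2 : (fun c d => and false (f c d)) = fun _ _ => false := rfl
    rw [h1, h2, e2_false]
  · have h1 : ∀ x : ℕ, cond true x 0 = x := fun _ => rfl
    have h2 : (fun c d => and true (f c d)) = f := rfl
    rw [h1, h2]

noncomputable def dist4 (a b c d : ℕ) : Bool :=
  neB a b && neB a c && neB a d && neB b c && neB b d && neB c d

noncomputable def bit6 (m0 m1 m2 m3 m4 m5 : Bool) (a b c d : ℕ) : Bool :=
  (m0 && adjB a b) ^^ (m1 && adjB a c) ^^ (m2 && adjB a d) ^^ (m3 && adjB b c) ^^ (m4 && adjB b d)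
    ^^ (m5 && adjB c d)

theorem total_eq (m0 m1 m2 m3 m4 m5 : Bool) : total m0 m1 m2 m3 m4 m5 =
    ∑ a ∈ range 64, ∑ b ∈ range 64, ∑ c ∈ range 64, ∑ d ∈ range 64,
      (dist4 a b c d && bit6 m0 m1 m2 m3 m4 m5 a b c d).toNat := by
  unfold total
  simp only [force_eq, build_eq, List.append_nil, sumL_eq, O_eq, EC_eq, ED_eq, W_eq]
  have hx : ∀ x y, Nat.xor x y = x ^^^ y := fun _ _ => rfl
  have ha : ∀ x y, Nat.land x y = x &&& y := fun _ _ => rfl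
  have hm : ∀ x y, Nat.mod x y = x % y := fun _ _ => rfl
  simp only [hx, ha, hm, cond_e2, e2_xor, e2_and, e2_mod]
  refine sum_congr rfl fun a _ => sum_congr rfl fun b _ => ?_
  by_cases hab : a = b
  · subst hab
    simp [dist4, neB]
  · have hb : Nat.beq a b = false := by
      rw [Bool.eq_false_iff]; intro h; exact hab (Nat.eq_of_beq_eq_true h)
    rw [hb]
    refine sum_congr rfl fun c _ => sum_congr rfl fun d _ => ?_
    unfold dist4 bit6
    have : neB a b = true := by simp [neB, hb]
    rw [this]
    congr 1
    generalize adjB a b = x1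
    generalize adjB a c = x2
    generalize adjB a d = x3
    generalize adjB b c = x4
    generalize adjB b d = x5
    generalize adjB c d = x6
    generalize neB a c = y1
    generalize neB a d = y2
    generalize neB b c = y3
    generalize neB b d = y4
    generalize neB c d = y5
    cases y1 <;> cases y2 <;> cases y3 <;> cases y4 <;> cases y5 <;> simp
    cases (m0 && x1) <;> cases (m1 && x2) <;> cases (m2 && x3) <;> cases (m3 && x4) <;> cases (m4 && x5) <;> cases (m5 && x6) <;> rfl

def HH : SimpleGraph (Fin 64) where
  Adj a b := adjB a b = true
  symm := ⟨fun a b h => by rw [← adj_symm a b]; exact h⟩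
  loopless := ⟨fun a h => by rw [adj_irr a] at h; exact Bool.noConfusion h⟩

theorem sg_HH (a b : Fin 64) : sg HH s(a, b) = if adjB a b then 1 else -1 := by
  unfold sg
  have : s(a, b) ∈ HH.edgeSet ↔ adjB a b = true := Iff.rfl
  by_cases h : adjB a b = true
  · rw [if_pos (this.2 h), if_pos h]
  · rw [if_neg (fun h' => h (this.1 h')), if_neg h]

theorem PP4 : PP 4 = {s(0,1), s(0,2), s(0,3), s(1,2), s(1,3), s(2,3)} := by decide

theorem prod4 (F : Finset (Sym2 (Fin 4))) (hF : F ⊆ PP 4) (g : Sym2 (Fin 4) → ℝ) :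
    ∏ e ∈ F, g e = (if s(0,1) ∈ F then g s(0,1) else 1) * (if s(0,2) ∈ F then g s(0,2) else 1) *
      (if s(0,3) ∈ F then g s(0,3) else 1) * (if s(1,2) ∈ F then g s(1,2) else 1) *
      (if s(1,3) ∈ F then g s(1,3) else 1) * (if s(2,3) ∈ F then g s(2,3) else 1) := by
  have h1 : ∏ e ∈ F, g e = ∏ e ∈ PP 4, if e ∈ F then g e else 1 := by
    rw [← prod_filter, filter_mem_eq_inter, inter_eq_right.2 hF]
  rw [h1, PP4, prod_insert (by decide), prod_insert (by decide), prod_insert (by decide),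
    prod_insert (by decide), prod_insert (by decide), prod_singleton]
  ring

noncomputable def qq (b : Bool) : ℝ := if b then -1 else 1

theorem qq_xor (a b : Bool) : qq (a ^^ b) = qq a * qq b := by
  cases a <;> cases b <;> norm_num [qq]

theorem qq_nat (a : Bool) : qq a = 1 - 2 * (a.toNat : ℝ) := by
  cases a <;> norm_num [qq]

theorem qq_ne (a : Bool) : qq a ≠ 0 := by
  cases a <;> norm_num [qq]

theorem qq_term (p : Prop) [Decidable p] (x : Bool) :
    (if p then (if x then (1:ℝ) else -1) else 1) = qq (decide p) * qq (decide p && x) := by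
  by_cases h : p <;> cases x <;> norm_num [qq, h]

theorem neB_iff (a b : ℕ) : neB a b = true ↔ a ≠ b := by
  unfold neB
  by_cases h : a = b
  · subst h; simp
  · have : Nat.beq a b = false := by
      rw [Bool.eq_false_iff]; intro h'; exact h (Nat.eq_of_beq_eq_true h')
    simp [this, h]

noncomputable def tot (F : Finset (Sym2 (Fin 4))) : ℕ :=
  total (decide (s(0,1) ∈ F)) (decide (s(0,2) ∈ F)) (decide (s(0,3) ∈ F))
    (decide (s(1,2) ∈ F)) (decide (s(1,3) ∈ F)) (decide (s(2,3) ∈ F))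

theorem tot_beq (F : Finset (Sym2 (Fin 4))) (m0 m1 m2 m3 m4 m5 r : Bool)
    (hc : Nat.beq (total m0 m1 m2 m3 m4 m5) 7624512 = r)
    (h0 : decide (s(0,1) ∈ F) = m0) (h1 : decide (s(0,2) ∈ F) = m1) (h2 : decide (s(0,3) ∈ F) = m2)
    (h3 : decide (s(1,2) ∈ F) = m3) (h4 : decide (s(1,3) ∈ F) = m4) (h5 : decide (s(2,3) ∈ F) = m5) :
    Nat.beq (tot F) 7624512 = r := by
  unfold tot; rw [h0, h1, h2, h3, h4, h5, hc]

theorem sum_sgn (F : Finset (Sym2 (Fin 4))) (hF : F ⊆ PP 4) : ∃ q : ℝ, q ≠ 0 ∧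
    ∑ ψ : Fin 4 ↪ Fin 64, sgn HH (F.map ψ.sym2Map) = q * (15249024 - 2 * (tot F : ℝ)) := by
  refine ⟨qq (decide (s(0,1) ∈ F)) * qq (decide (s(0,2) ∈ F)) * qq (decide (s(0,3) ∈ F)) *
    qq (decide (s(1,2) ∈ F)) * qq (decide (s(1,3) ∈ F)) * qq (decide (s(2,3) ∈ F)), ?_, ?_⟩
  · simp only [ne_eq, mul_eq_zero, qq_ne, or_self, not_false_eq_true]
  set q := qq (decide (s(0,1) ∈ F)) * qq (decide (s(0,2) ∈ F)) * qq (decide (s(0,3) ∈ F)) *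
    qq (decide (s(1,2) ∈ F)) * qq (decide (s(1,3) ∈ F)) * qq (decide (s(2,3) ∈ F)) with hq
  let B : ℕ → ℕ → ℕ → ℕ → Bool := bit6 (decide (s(0,1) ∈ F)) (decide (s(0,2) ∈ F)) (decide (s(0,3) ∈ F))
    (decide (s(1,2) ∈ F)) (decide (s(1,3) ∈ F)) (decide (s(2,3) ∈ F))
  have h1 : ∀ ψ : Fin 4 ↪ Fin 64, sgn HH (F.map ψ.sym2Map) =
      q * qq (B (ψ 0) (ψ 1) (ψ 2) (ψ 3)) := by
    intro ψ
    unfold sgn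
    rw [prod_map, prod4 F hF]
    have e : ∀ a b, ψ.sym2Map s(a, b) = s(ψ a, ψ b) := fun a b => rfl
    simp only [e, sg_HH, qq_term]
    simp only [B, bit6, qq_xor, hq]
    ring
  have h2 : ∑ ψ : Fin 4 ↪ Fin 64, (1:ℝ) = 15249024 := by
    rw [sum_const, card_univ, Fintype.card_embedding_eq, Fintype.card_fin, Fintype.card_fin]
    norm_num [Nat.descFactorial]
  have h3 : ∑ ψ : Fin 4 ↪ Fin 64, ((B (ψ 0) (ψ 1) (ψ 2) (ψ 3)).toNat : ℝ) = tot F := by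
    rw [sum_emb4 (fun a b c d => ((B a b c d).toNat : ℝ)), tot, total_eq]
    push_cast
    simp only [← Fin.sum_univ_eq_sum_range]
    refine sum_congr rfl fun a _ => sum_congr rfl fun b _ => sum_congr rfl fun c _ => sum_congr rfl fun d _ => ?_
    have hd : dist4 a b c d = true ↔ (a ≠ b ∧ a ≠ c ∧ a ≠ d ∧ b ≠ c ∧ b ≠ d ∧ c ≠ d) := by
      simp only [dist4, Bool.and_eq_true, neB_iff, ne_eq, Fin.val_inj, and_assoc]
    by_cases h : dist4 a b c d = true
    · rw [if_pos (hd.1 h), h, Bool.true_and]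
    · rw [if_neg (fun h' => h (hd.2 h'))]
      rw [Bool.not_eq_true] at h
      rw [h, Bool.false_and]; simp
  simp only [h1, qq_nat]
  rw [← mul_sum, sum_sub_distrib, h2, ← mul_sum, h3]

theorem sh_zero (F : Finset (Sym2 (Fin 4))) (hF : F ⊆ PP 4) (h : Nat.beq (tot F) 7624512 = true)
    (α : Fin 4 ↪ Fin 64) : sh HH (F.map α.sym2Map) = 0 := by
  obtain ⟨q, _, hq⟩ := sum_sgn F hF
  rw [sh_map, Fintype.expect_eq_sum_div_card, hq, Nat.eq_of_beq_eq_true h]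
  norm_num

theorem s1_ne : s1 HH ≠ 0 := by
  let β : Fin 2 ↪ Fin 4 := Fin.castLEEmb (by norm_num)
  let α : Fin 4 ↪ Fin 64 := Fin.castLEEmb (by norm_num)
  have hM : M1.map β.sym2Map = ({s(0,1)} : Finset (Sym2 (Fin 4))) := by decide
  have h1 : s1 HH = sh HH (({s(0,1)} : Finset (Sym2 (Fin 4))).map α.sym2Map) := by
    rw [← hM, map_trans, sh_map]; rfl
  obtain ⟨q, hq0, hq⟩ := sum_sgn {s(0,1)} (by decide)
  rw [h1, sh_map, Fintype.expect_eq_sum_div_card, hq]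
  have ht : tot {s(0,1)} ≠ 7624512 := by
    intro h
    have : Nat.beq (tot {s(0,1)}) 7624512 = false := tot_beq _ _ _ _ _ _ _ _ chk_edge (by decide) (by decide) (by decide) (by decide) (by decide) (by decide)
    rw [h] at this
    exact absurd this (by decide)
  have ht' : (tot {s(0,1)} : ℝ) ≠ 7624512 := by exact_mod_cast ht
  refine div_ne_zero (mul_ne_zero hq0 ?_) ?_
  · intro h; apply ht'; linarith
  · rw [Fintype.card_embedding_eq, Fintype.card_fin, Fintype.card_fin]
    norm_num [Nat.descFactorial]

def reps : List (Finset (Sym2 (Fin 4))) :=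
  [{s(0,1), s(0,2)}, {s(0,1), s(0,2), s(1,2)}, {s(0,1), s(0,2), s(0,3)}, {s(0,1), s(1,2), s(2,3)},
   {s(0,1), s(0,3), s(1,2), s(2,3)}, {s(0,1), s(0,2), s(0,3), s(1,2)},
   {s(0,1), s(0,2), s(0,3), s(1,2), s(1,3)}, {s(0,1), s(0,2), s(0,3), s(1,2), s(1,3), s(2,3)}]

theorem reps_ok : ∀ F ∈ reps, F ⊆ PP 4 ∧ Nat.beq (tot F) 7624512 = true := by
  intro F hF
  simp only [reps, List.mem_cons, List.not_mem_nil, or_false] at hF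
  rcases hF with rfl | rfl | rfl | rfl | rfl | rfl | rfl | rfl
  · exact ⟨by decide, tot_beq _ _ _ _ _ _ _ _ chk_cherry (by decide) (by decide) (by decide) (by decide) (by decide) (by decide)⟩
  · exact ⟨by decide, tot_beq _ _ _ _ _ _ _ _ chk_tri (by decide) (by decide) (by decide) (by decide) (by decide) (by decide)⟩
  · exact ⟨by decide, tot_beq _ _ _ _ _ _ _ _ chk_star (by decide) (by decide) (by decide) (by decide) (by decide) (by decide)⟩
  · exact ⟨by decide, tot_beq _ _ _ _ _ _ _ _ chk_path (by decide) (by decide) (by decide) (by decide) (by decide) (by decide)⟩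
  · exact ⟨by decide, tot_beq _ _ _ _ _ _ _ _ chk_cycle (by decide) (by decide) (by decide) (by decide) (by decide) (by decide)⟩
  · exact ⟨by decide, tot_beq _ _ _ _ _ _ _ _ chk_paw (by decide) (by decide) (by decide) (by decide) (by decide) (by decide)⟩
  · exact ⟨by decide, tot_beq _ _ _ _ _ _ _ _ chk_diam (by decide) (by decide) (by decide) (by decide) (by decide) (by decide)⟩
  · exact ⟨by decide, tot_beq _ _ _ _ _ _ _ _ chk_full (by decide) (by decide) (by decide) (by decide) (by decide) (by decide)⟩

def PM (b0 b1 b2 b3 b4 b5 : Bool) (e : Sym2 (Fin 4)) : Bool :=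
  (b0 && decide (e = s(0,1))) || (b1 && decide (e = s(0,2))) || (b2 && decide (e = s(0,3))) ||
  (b3 && decide (e = s(1,2))) || (b4 && decide (e = s(1,3))) || (b5 && decide (e = s(2,3)))

set_option synthInstance.maxHeartbeats 400000 in
set_option synthInstance.maxSize 1000 in
theorem classify0 : ∀ b0 b1 b2 b3 b4 b5 : Bool,
    2 ≤ b0.toNat + b1.toNat + b2.toNat + b3.toNat + b4.toNat + b5.toNat →
    ∃ R ∈ M2 :: reps, b0.toNat + b1.toNat + b2.toNat + b3.toNat + b4.toNat + b5.toNat = R.card ∧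
      ∃ a b : Fin 4, a ≠ b ∧ ∃ c, (a ≠ c ∧ b ≠ c) ∧ ∃ d : Fin 4, (a ≠ d ∧ b ≠ d ∧ c ≠ d) ∧
       ∀ e ∈ R, PM b0 b1 b2 b3 b4 b5 (Sym2.map ![a, b, c, d] e) = true := by
  decide +kernel

theorem card4 (F : Finset (Sym2 (Fin 4))) (hF : F ⊆ PP 4) :
    F.card = (decide (s(0,1) ∈ F)).toNat + (decide (s(0,2) ∈ F)).toNat + (decide (s(0,3) ∈ F)).toNat +
      (decide (s(1,2) ∈ F)).toNat + (decide (s(1,3) ∈ F)).toNat + (decide (s(2,3) ∈ F)).toNat := by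
  have h1 : F.card = ∑ e ∈ PP 4, (decide (e ∈ F)).toNat := by
    rw [card_eq_sum_ones]
    have : ∑ e ∈ F, 1 = ∑ e ∈ PP 4, if e ∈ F then 1 else 0 := by
      rw [← sum_filter, filter_mem_eq_inter, inter_eq_right.2 hF]
    rw [this]
    refine sum_congr rfl fun e _ => ?_
    by_cases h : e ∈ F <;> simp [h]
  rw [h1, PP4, sum_insert (by decide), sum_insert (by decide), sum_insert (by decide),
    sum_insert (by decide), sum_insert (by decide), sum_singleton]
  ring

theorem classify (F : Finset (Sym2 (Fin 4))) (hF : F ∈ (PP 4).powerset) (h2 : 2 ≤ F.card) :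
    ∃ R ∈ M2 :: reps, ∃ σ : Fin 4 ↪ Fin 4, F = R.map σ.sym2Map := by
  have hc := card4 F (mem_powerset.1 hF)
  rw [hc] at h2
  obtain ⟨R, hR, hc', a, b, hab, c, ⟨hac, hbc⟩, d, ⟨had, hbd, hcd⟩, h⟩ := classify0 _ _ _ _ _ _ h2
  have hi : Function.Injective ![a, b, c, d] := by
    clear h hc hc' h2 hF hR
    intro i j hij
    fin_cases i <;> fin_cases j <;> simp_all [eq_comm]
  refine ⟨R, hR, ⟨_, hi⟩, (eq_of_subset_of_card_le ?_ (by rw [card_map, hc, hc'])).symm⟩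
  intro e he
  obtain ⟨e', he', rfl⟩ := mem_map.1 he
  have := h e' he'
  change Sym2.map ![a, b, c, d] e' ∈ F
  simp only [PM, Bool.or_eq_true, Bool.and_eq_true, decide_eq_true_eq] at this
  rcases this with ((((⟨h, h'⟩ | ⟨h, h'⟩) | ⟨h, h'⟩) | ⟨h, h'⟩) | ⟨h, h'⟩) | ⟨h, h'⟩ <;>
    rw [h'] <;> exact h

theorem exists_four {k : ℕ} (hk : 4 ≤ k) (F : Finset (Sym2 (Fin k))) (hF : F ⊆ PP k)
    (hV : (VV F).card ≤ 4) : ∃ α : Fin 4 ↪ Fin k, ∃ F4 ∈ (PP 4).powerset, F = F4.map α.sym2Map := by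
  obtain ⟨W, hW, hc⟩ := Finset.exists_superset_card_eq hV (by simpa using hk)
  let α : Fin 4 ↪ Fin k := (W.orderEmbOfFin hc).toEmbedding
  have hα : ∀ v ∈ W, ∃ i, α i = v := by
    intro v hv
    have : v ∈ Set.range (W.orderEmbOfFin hc) := by rw [Finset.range_orderEmbOfFin]; exact hv
    exact this
  refine ⟨α, (PP 4).filter (fun e => α.sym2Map e ∈ F), mem_powerset.2 (filter_subset _ _), ?_⟩
  ext e
  simp only [mem_map, mem_filter]
  constructor
  · intro he
    induction e using Sym2.ind with
    | _ a b =>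
      have ha : a ∈ VV F := by
        simp only [VV, mem_filter, mem_univ, true_and]; exact ⟨_, he, Sym2.mem_mk_left a b⟩
      have hb : b ∈ VV F := by
        simp only [VV, mem_filter, mem_univ, true_and]; exact ⟨_, he, Sym2.mem_mk_right a b⟩
      obtain ⟨i, rfl⟩ := hα a (hW ha)
      obtain ⟨j, rfl⟩ := hα b (hW hb)
      refine ⟨s(i, j), ⟨?_, he⟩, rfl⟩
      have := hF he
      simp only [PP, mem_filter, mem_univ, true_and, Sym2.mk_isDiag_iff] at this ⊢
      exact fun h => this (congrArg α h)
  · rintro ⟨e', ⟨_, h⟩, rfl⟩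
    exact h

theorem HH_zero : ∀ F ∈ (PP 64).powerset, 2 ≤ F.card → ¬ IsM2 F → (VV F).card ≤ 4 → sh HH F = 0 := by
  intro F hF h2 hM hV
  obtain ⟨α, F4, hF4, rfl⟩ := exists_four (by norm_num) F (mem_powerset.1 hF) hV
  rw [card_map] at h2
  obtain ⟨R, hR, σ, rfl⟩ := classify F4 hF4 h2
  rw [map_trans] at hM ⊢
  rcases List.mem_cons.1 hR with rfl | hR
  · exact absurd ⟨_, rfl⟩ hM
  · exact sh_zero R (reps_ok R hR).1 (reps_ok R hR).2 _

end IC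

theorem induced_count_anticoncentration_fails :
    ∃ H' : SimpleGraph (Fin 64), ∃ c : ℝ, 0 < c ∧ ∃ N : ℕ, ∀ n : ℕ, N ≤ n →
      let μ := gnp n (1 / 2)
      let X : (Sym2 (Fin n) → Bool) → ℝ := fun ω => (inducedCount H' (graphOfFn ω) : ℝ)
      let μH := ∫ ω, X ω ∂μ
      let σH := Real.sqrt (∫ ω, (X ω - μH) ^ 2 ∂μ)
      ∃ x : ℤ, c * (n : ℝ) ^ ((1 : ℝ) / 2) * σH⁻¹ ≤ (μ {ω | X ω = (x : ℝ)}).toReal := by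
  exact ⟨IC.HH, IC.general (by norm_num) IC.HH IC.s1_ne IC.HH_zero⟩
end

section
/- Fix an integer ℓ ≥ 4, a real p ∈ (0,1), and real coefficients Φ_H, one for each isomorphism class of graphs H with no isolated vertices and v(H) ≤ ℓ, independent of n, such that: (i) Φ_H = 0 for every connected graph H on 3 or 4 vertices; (ii) Φ_{K₂} ≠ 0 and Φ_{K₂+K₂} ≠ 0 (where K₂+K₂ is the disjoint union of two edges). For each n, let (x_e)_{e ∈ C({1,…,n},2)} be i.i.d. Bernoulli(p) and set F(x) = Σ_H C(n−v(H), ℓ−v(H))·Φ_H·γ_H(x), the sum being over all such isomorphism classes H. Suppose F(x) is integer valued (almost surely, for every n). Then there exist a constant c > 0 (depending only on ℓ, the Φ_H, and p) and, for each sufficiently large n, an integer y_n, such that ℙ[F(x) = y_n] ≥ c·n^{3/2−ℓ}. -/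
open MeasureTheory
open scoped ENNReal NNReal

noncomputable section

open Classical in
/-- The graph factor `γ_H(x) = Σ_{E ≅ H} Π_{e ∈ E} χ_e`, where
`χ_e = (x_e − p)/√(p(1−p))`, and the sum is over edge sets `E` spanning a copy of `H`. -/
def graphFactor {β : Type*} [Fintype β] (H : SimpleGraph β) (p : ℝ) {n : ℕ}
    (x : Sym2 (Fin n) → Bool) : ℝ :=
  ∑ E : Finset (Sym2 (Fin n)),
    if ∃ f : β ↪ Fin n, (↑E : Set (Sym2 (Fin n))) = Sym2.map f '' H.edgeSet then
      ∏ e ∈ E, (((if x e then (1 : ℝ) else 0) - p) / Real.sqrt (p * (1 - p)))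
    else 0

/-- A single edge, padded with isolated vertices to a graph on `ℓ ≥ 4` vertices. -/
def singleEdgeGraph (ℓ : ℕ) (h : 4 ≤ ℓ) : SimpleGraph (Fin ℓ) :=
  SimpleGraph.fromRel fun i j =>
    i = (⟨0, by omega⟩ : Fin ℓ) ∧ j = (⟨1, by omega⟩ : Fin ℓ)

/-- The disjoint union of two edges, padded with isolated vertices to a graph on
`ℓ ≥ 4` vertices. -/
def twoEdgesGraph (ℓ : ℕ) (h : 4 ≤ ℓ) : SimpleGraph (Fin ℓ) :=
  SimpleGraph.fromRel fun i j =>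
    (i = (⟨0, by omega⟩ : Fin ℓ) ∧ j = (⟨1, by omega⟩ : Fin ℓ)) ∨
    (i = (⟨2, by omega⟩ : Fin ℓ) ∧ j = (⟨3, by omega⟩ : Fin ℓ))

end


def wtA {ι : Type*} [Fintype ι] (p : ℝ) (x : ι → Bool) : ℝ := ∏ i, if x i then p else 1 - p

noncomputable def chiA (p : ℝ) (b : Bool) : ℝ :=
  ((if b then (1 : ℝ) else 0) - p) / Real.sqrt (p * (1 - p))

lemma wtA_pos {ι : Type*} [Fintype ι] {p : ℝ} (hp : p ∈ Set.Ioo (0 : ℝ) 1) (x : ι → Bool) :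
    0 < wtA p x := by
  unfold wtA
  refine Finset.prod_pos fun i _ => ?_
  have h1 := hp.1
  have h2 := hp.2
  split_ifs <;> linarith

lemma wtA_sum_prod {ι : Type*} [Fintype ι] [DecidableEq ι] (p : ℝ) (u : ι → Bool → ℝ) :
    ∑ x : ι → Bool, wtA p x * ∏ i, u i (x i) = ∏ i, (p * u i true + (1 - p) * u i false) := by
  have : ∀ i, (p * u i true + (1 - p) * u i false) =
      ∑ b : Bool, (if b then p else 1 - p) * u i b := by
    intro i; simp
  simp only [this, wtA, ← Finset.prod_mul_distrib]
  rw [Finset.prod_univ_sum, Fintype.piFinset_univ]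

lemma wtA_sum {ι : Type*} [Fintype ι] [DecidableEq ι] (p : ℝ) :
    ∑ x : ι → Bool, wtA p x = 1 := by
  have := wtA_sum_prod (ι := ι) p (fun _ _ => 1)
  simpa using this

open Classical in
lemma gnp_toReal {p : ℝ} (hp : p ∈ Set.Ioo (0 : ℝ) 1) (n : ℕ) (A : Set (Sym2 (Fin n) → Bool)) :
    (gnp n p A).toReal = ∑ x, if x ∈ A then wtA p x else 0 := by
  have h1 := hp.1
  have h2 := hp.2
  unfold gnp bernoulliPi
  rw [Measure.coe_finsetSum, Finset.sum_apply, ENNReal.toReal_sum]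
  · refine Finset.sum_congr rfl fun x _ => ?_
    rw [Measure.smul_apply, Measure.dirac_apply' _ (MeasurableSet.of_discrete)]
    by_cases hx : x ∈ A
    · simp only [hx, Set.indicator_of_mem, smul_eq_mul, Pi.one_apply, mul_one, if_true, wtA]
      rw [ENNReal.toReal_prod]
      refine Finset.prod_congr rfl fun i _ => ENNReal.toReal_ofReal ?_
      split_ifs <;> linarith
    · simp [hx]
  · intro x _
    rw [Measure.smul_apply, Measure.dirac_apply' _ (MeasurableSet.of_discrete)]
    apply ENNReal.mul_ne_top
    · exact ENNReal.prod_ne_top fun _ _ => ENNReal.ofReal_ne_top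
    · by_cases hx : x ∈ A <;> simp [hx]

lemma all_of_ae {p : ℝ} (hp : p ∈ Set.Ioo (0 : ℝ) 1) (n : ℕ) (P : (Sym2 (Fin n) → Bool) → Prop)
    (h : ∀ᵐ x ∂(gnp n p), P x) (x) : P x := by
  classical
  rw [ae_iff] at h
  have h2 := gnp_toReal hp n {a | ¬ P a}
  rw [h] at h2
  by_contra hx
  have hx' : x ∈ {a | ¬ P a} := hx
  generalize {a | ¬ P a} = A at h2 hx'
  have h4 : ∀ y ∈ Finset.univ, 0 ≤ if y ∈ A then wtA p y else 0 := by
    intro y _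
    split_ifs
    · exact (wtA_pos hp y).le
    · exact le_rfl
  rw [ENNReal.toReal_zero] at h2
  have h3 := (Finset.sum_eq_zero_iff_of_nonneg h4).1 h2.symm x (Finset.mem_univ x)
  rw [if_pos hx'] at h3
  exact (wtA_pos hp x).ne' h3

lemma chi_mean {p : ℝ} : p * chiA p true + (1 - p) * chiA p false = 0 := by
  simp [chiA]; ring

lemma chi_sq {p : ℝ} (hp : p ∈ Set.Ioo (0 : ℝ) 1) :
    p * (chiA p true * chiA p true) + (1 - p) * (chiA p false * chiA p false) = 1 := by
  have h : 0 < p * (1 - p) := mul_pos hp.1 (by linarith [hp.2])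
  have hs := Real.mul_self_sqrt h.le
  have hs0 : Real.sqrt (p * (1 - p)) ≠ 0 := (Real.sqrt_pos.2 h).ne'
  simp only [chiA, if_true, Bool.false_eq_true, if_false]
  rw [div_mul_div_comm, div_mul_div_comm, hs]
  have : p ≠ 0 := hp.1.ne'
  have : 1 - p ≠ 0 := by linarith [hp.2]
  field_simp
  ring

lemma chi_orth {ι : Type*} [Fintype ι] [DecidableEq ι] {p : ℝ} (hp : p ∈ Set.Ioo (0 : ℝ) 1)
    (E E' : Finset ι) :
    ∑ x : ι → Bool, wtA p x * ((∏ e ∈ E, chiA p (x e)) * ∏ e ∈ E', chiA p (x e)) =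
      if E = E' then 1 else 0 := by
  have key : ∀ x : ι → Bool, (∏ e ∈ E, chiA p (x e)) * ∏ e ∈ E', chiA p (x e) =
      ∏ i, (fun i b => (if i ∈ E then chiA p b else 1) * (if i ∈ E' then chiA p b else 1)) i (x i) := by
    intro x
    simp only [Finset.prod_mul_distrib, Finset.prod_ite_mem, Finset.univ_inter]
  rw [Finset.sum_congr rfl fun x _ => by rw [key x]]
  refine (wtA_sum_prod p (fun i b => (if i ∈ E then chiA p b else 1) * (if i ∈ E' then chiA p b else 1))).trans ?_
  split_ifs with h
  · subst h
    refine Finset.prod_eq_one fun i _ => ?_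
    by_cases hi : i ∈ E
    · simpa [hi] using chi_sq hp
    · simp [hi]
  · have : ∃ i, ¬ (i ∈ E ↔ i ∈ E') := by
      by_contra hc; push Not at hc; exact h (Finset.ext hc)
    obtain ⟨i, hi⟩ := this
    refine Finset.prod_eq_zero (Finset.mem_univ i) ?_
    have := chi_mean (p := p)
    by_cases h1 : i ∈ E <;> by_cases h2 : i ∈ E' <;> simp [h1, h2] at hi ⊢ <;> exact this

lemma chi_var {ι : Type*} [Fintype ι] [DecidableEq ι] {p : ℝ} (hp : p ∈ Set.Ioo (0 : ℝ) 1)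
    (S : Finset (Finset ι)) :
    ∑ x : ι → Bool, wtA p x * (∑ E ∈ S, ∏ e ∈ E, chiA p (x e)) ^ 2 = S.card := by
  have : ∀ x : ι → Bool, wtA p x * (∑ E ∈ S, ∏ e ∈ E, chiA p (x e)) ^ 2 =
      ∑ E ∈ S, ∑ E' ∈ S, wtA p x * ((∏ e ∈ E, chiA p (x e)) * ∏ e ∈ E', chiA p (x e)) := by
    intro x
    rw [sq, Finset.sum_mul_sum, Finset.mul_sum]
    simp only [Finset.mul_sum]
  simp only [this]
  rw [Finset.sum_comm]
  have : ∀ E ∈ S, ∑ x : ι → Bool, ∑ E' ∈ S, wtA p x * ((∏ e ∈ E, chiA p (x e)) * ∏ e ∈ E', chiA p (x e)) = 1 := by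
    intro E hE
    rw [Finset.sum_comm]
    simp only [chi_orth hp]
    simp [hE]
  rw [Finset.sum_congr rfl this]
  simp

lemma e2_formula {ι : Type*} [DecidableEq ι] (f : ι → ℝ) (s : Finset ι) :
    ∑ E ∈ s.powersetCard 2, ∏ e ∈ E, f e = ((∑ e ∈ s, f e) ^ 2 - ∑ e ∈ s, f e ^ 2) / 2 := by
  have h1 : ∀ s : Finset ι, ∑ E ∈ s.powersetCard 1, ∏ e ∈ E, f e = ∑ e ∈ s, f e := by
    intro s
    rw [Finset.powersetCard_one]
    simp
  induction s using Finset.induction_on with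
  | empty => rw [Finset.powersetCard_eq_empty.2 (by simp)]; simp
  | insert a s ha ih =>
    rw [Finset.powersetCard_succ_insert ha, Finset.sum_union, ih, Finset.sum_image]
    · have : ∀ E ∈ s.powersetCard 1, ∏ e ∈ insert a E, f e = f a * ∏ e ∈ E, f e := by
        intro E hE
        rw [Finset.prod_insert]
        exact fun h => ha ((Finset.mem_powersetCard.1 hE).1 h)
      rw [Finset.sum_congr rfl this, ← Finset.mul_sum, h1, Finset.sum_insert ha, Finset.sum_insert ha]
      ring
    · intro E hE E' hE' h
      have h3 : a ∉ E := fun h => ha ((Finset.mem_powersetCard.1 hE).1 h)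
      have h4 : a ∉ E' := fun h => ha ((Finset.mem_powersetCard.1 hE').1 h)
      rw [← Finset.erase_insert h3, ← Finset.erase_insert h4]
      rw [h]
    · rw [Finset.disjoint_left]
      intro E hE hE'
      obtain ⟨E'', _, rfl⟩ := Finset.mem_image.1 hE'
      exact ha ((Finset.mem_powersetCard.1 hE).1 (Finset.mem_insert_self _ _))

/-- The non-diagonal pairs. -/
def ndA (n : ℕ) : Finset (Sym2 (Fin n)) := Finset.univ.filter fun e => ¬ e.IsDiag

/-- number of edges -/
def mA {n : ℕ} (x : Sym2 (Fin n) → Bool) : ℕ := ((ndA n).filter fun e => x e = true).card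

lemma sum_fun_m {n : ℕ} (x : Sym2 (Fin n) → Bool) (h : Bool → ℝ) :
    ∑ e ∈ ndA n, h (x e) = (ndA n).card * h false + mA x * (h true - h false) := by
  have : ∀ e ∈ ndA n, h (x e) = h false + if x e = true then (h true - h false) else 0 := by
    intro e _
    cases x e <;> simp
  rw [Finset.sum_congr rfl this, Finset.sum_add_distrib, ← Finset.sum_filter]
  simp [mA]
  ring

lemma gamma_m {n : ℕ} (p : ℝ) (x : Sym2 (Fin n) → Bool) :
    ∑ e ∈ ndA n, chiA p (x e) = (mA x - p * (ndA n).card) / Real.sqrt (p * (1 - p)) := by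
  rw [sum_fun_m]
  simp [chiA]
  ring

lemma ndA_card (n : ℕ) : (ndA n).card ≤ n ^ 2 := by
  have : ndA n ⊆ (Finset.univ : Finset (Fin n × Fin n)).image (fun q => s(q.1, q.2)) := by
    intro e _
    induction e with | _ a b =>
    simp only [Finset.mem_image, Finset.mem_univ, true_and]
    exact ⟨(a, b), rfl⟩
  refine (Finset.card_le_card this).trans (Finset.card_image_le.trans ?_)
  simp [sq]

lemma gamma_var {n : ℕ} {p : ℝ} (hp : p ∈ Set.Ioo (0 : ℝ) 1) :
    ∑ x : Sym2 (Fin n) → Bool, wtA p x * (∑ e ∈ ndA n, chiA p (x e)) ^ 2 ≤ (n : ℝ) ^ 2 := by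
  have := chi_var hp ((ndA n).powersetCard 1)
  simp only [Finset.powersetCard_one, Finset.sum_map, Function.Embedding.coeFn_mk,
    Finset.prod_singleton, Finset.card_map] at this
  rw [this]
  exact_mod_cast ndA_card n

lemma emb_extend {ℓ n : ℕ} (hn : ℓ ≤ n) (f : Fin ℓ → Fin n) (s : Finset (Fin ℓ))
    (hf : Set.InjOn f s) : ∃ g : Fin ℓ ↪ Fin n, ∀ i ∈ s, g i = f i := by
  classical
  obtain ⟨t, ht1, -, ht2⟩ := Finset.exists_subsuperset_card_eq (Finset.subset_univ (s.image f))
    (n := ℓ) (by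
      rw [Finset.card_image_of_injOn hf]
      simpa using Finset.card_le_univ s) (by simpa using hn)
  obtain ⟨g, hg⟩ := Finset.exists_equiv_extend_of_card_eq (by simp [ht2]) ht1 hf
  exact ⟨g.toEmbedding.trans (Function.Embedding.subtype _), fun i hi => by simpa using hg i hi⟩

open Classical in
/-- Copies of `G`. -/
noncomputable def copA {ℓ : ℕ} (G : SimpleGraph (Fin ℓ)) (n : ℕ) : Finset (Finset (Sym2 (Fin n))) :=
  Finset.univ.filter fun E => ∃ f : Fin ℓ ↪ Fin n, (↑E : Set (Sym2 (Fin n))) = Sym2.map f '' G.edgeSet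

lemma graphFactor_eq {ℓ : ℕ} (G : SimpleGraph (Fin ℓ)) (p : ℝ) {n : ℕ} (x : Sym2 (Fin n) → Bool) :
    graphFactor G p x = ∑ E ∈ copA G n, ∏ e ∈ E, chiA p (x e) := by
  classical
  unfold graphFactor copA chiA
  rw [Finset.sum_filter]

lemma copA_card {ℓ : ℕ} (G : SimpleGraph (Fin ℓ)) (n : ℕ) :
    (copA G n).card ≤ n ^ (Nat.card G.support) := by
  classical
  let T : (G.support → Fin n) → Finset (Sym2 (Fin n)) := fun h =>
    Finset.univ.filter fun e => ∃ a b : G.support, G.Adj a b ∧ e = s(h a, h b)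
  have : copA G n ⊆ Finset.univ.image T := by
    intro E hE
    obtain ⟨f, hf⟩ := (Finset.mem_filter.1 hE).2
    refine Finset.mem_image.2 ⟨fun a => f a, Finset.mem_univ _, ?_⟩
    ext e
    rw [← Finset.mem_coe (s := E), hf]
    simp only [T, Finset.mem_filter, Finset.mem_univ, true_and, Set.mem_image]
    constructor
    · rintro ⟨a, b, hab, rfl⟩
      exact ⟨s(a, b), hab, rfl⟩
    · rintro ⟨e', he', rfl⟩
      induction e' with | _ a b =>
      have hab : G.Adj a b := he'
      exact ⟨⟨a, hab.left_mem_support⟩, ⟨b, hab.right_mem_support⟩, hab, rfl⟩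
  refine (Finset.card_le_card this).trans (Finset.card_image_le.trans ?_)
  simp [Nat.card_eq_fintype_card]

lemma conn_lem {V : Type*} (G : SimpleGraph V) (a : V) (ha : a ∈ G.support)
    (h : ∀ Q : V → Prop, Q a → (∀ x y, Q x → G.Adj x y → Q y) → ∀ x ∈ G.support, Q x) :
    (G.induce G.support).Connected := by
  rw [SimpleGraph.connected_iff_exists_forall_reachable]
  refine ⟨⟨a, ha⟩, ?_⟩
  rintro ⟨w, hw⟩
  have := h (fun x => ∃ hx : x ∈ G.support, (G.induce G.support).Reachable ⟨a, ha⟩ ⟨x, hx⟩)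
    ⟨ha, SimpleGraph.Reachable.refl _⟩ (by
      rintro x y ⟨hx, hr⟩ hxy
      refine ⟨hxy.right_mem_support, hr.trans (SimpleGraph.Adj.reachable ?_)⟩
      exact hxy) w hw
  exact this.2

/-- Classification of small supports. -/
lemma small_support {ℓ : ℕ} (G : SimpleGraph (Fin ℓ)) (h4 : Nat.card G.support ≤ 4) :
    G.edgeSet = ∅ ∨ (∃ a b, a ≠ b ∧ Nat.card G.support = 2 ∧ G.edgeSet = {s(a, b)}) ∨
    ((Nat.card G.support = 3 ∨ Nat.card G.support = 4) ∧ (G.induce G.support).Connected) ∨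
    (∃ a b c d, [a, b, c, d].Nodup ∧ Nat.card G.support = 4 ∧ G.edgeSet = {s(a, b), s(c, d)}) := by
  classical
  by_cases h0 : G = ⊥
  · left; simp [h0]
  right
  have : ∃ a b, G.Adj a b := by
    by_contra hc
    push Not at hc
    apply h0
    ext a b
    simp [hc]
  obtain ⟨a, b, hab⟩ := this
  have hne := hab.ne
  let S : Finset (Fin ℓ) := Finset.univ.filter (· ∈ G.support)
  have hS : Nat.card G.support = S.card := by
    rw [Nat.card_eq_fintype_card, ← Set.toFinset_card]
    congr 1
    ext; simp [S]
  have hmem : ∀ x, x ∈ S ↔ ∃ y, G.Adj x y := by intro x; simp [S, SimpleGraph.mem_support]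
  have hmem' : ∀ x, x ∈ G.support ↔ x ∈ S := by intro x; simp [S]
  have haS : a ∈ S := (hmem a).2 ⟨b, hab⟩
  have hbS : b ∈ S := (hmem b).2 ⟨a, hab.symm⟩
  have hadjS : ∀ x y, G.Adj x y → x ∈ S ∧ y ∈ S := fun x y h => ⟨(hmem x).2 ⟨y, h⟩, (hmem y).2 ⟨x, h.symm⟩⟩
  rw [hS] at h4 ⊢
  let T := (S.erase a).erase b
  have hT : T.card + 2 = S.card := by
    have h1 := Finset.card_erase_add_one haS
    have h2 := Finset.card_erase_add_one (Finset.mem_erase.2 ⟨hne.symm, hbS⟩)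
    simp only [T]; omega
  have hST : ∀ x, x ∈ S ↔ x = a ∨ x = b ∨ x ∈ T := by
    intro x; simp only [T, Finset.mem_erase]; grind
  have hTne : ∀ x ∈ T, x ≠ a ∧ x ≠ b := by
    intro x; simp only [T, Finset.mem_erase]; grind
  have hT3 : T.card = 0 ∨ T.card = 1 ∨ T.card = 2 := by omega
  rcases hT3 with h | h | h
  · left
    refine ⟨a, b, hne, by omega, ?_⟩
    have hTe := Finset.card_eq_zero.1 h
    ext e
    induction e with | _ x y =>
    simp only [SimpleGraph.mem_edgeSet, Set.mem_singleton_iff, Sym2.eq_iff]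
    have := hadjS x y
    have hxy : G.Adj x y → x ≠ y := fun h => h.ne
    have := hab.symm
    constructor
    · intro h
      simp [hTe] at hST
      grind
    · rintro (⟨rfl, rfl⟩ | ⟨rfl, rfl⟩) <;> assumption
  · right; left
    refine ⟨by omega, conn_lem G a ((hmem' a).2 haS) ?_⟩
    intro Q ha hQ x hx
    obtain ⟨c, hc⟩ := Finset.card_eq_one.1 h
    have hb := hQ a b ha hab
    have hcS : c ∈ S := (hST c).2 (by simp [hc])
    obtain ⟨y, hy⟩ := (hmem c).1 hcS
    have := hadjS c y hy
    have hcy := hy.ne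
    have hcQ : Q c := by
      refine hQ y c ?_ hy.symm
      have := (hST y).1 this.2
      simp [hc] at this
      grind
    have := (hST x).1 ((hmem' x).1 hx)
    simp [hc] at this
    grind
  · right
    obtain ⟨c, d, hcd, hc⟩ := Finset.card_eq_two.1 h
    have hST' : ∀ x, x ∈ S ↔ x = a ∨ x = b ∨ x = c ∨ x = d := by
      intro x; rw [hST, hc]; simp
    have hc1 := hTne c (by simp [hc])
    have hd1 := hTne d (by simp [hc])
    have hcS : c ∈ S := (hST' c).2 (by simp)
    have hdS : d ∈ S := (hST' d).2 (by simp)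
    obtain ⟨y, hy⟩ := (hmem c).1 hcS
    obtain ⟨z, hz⟩ := (hmem d).1 hdS
    have hyn := hy.ne
    have hzn := hz.ne
    have hyS := (hST' y).1 (hadjS c y hy).2
    have hzS := (hST' z).1 (hadjS d z hz).2
    by_cases hX : G.Adj a c ∨ G.Adj a d ∨ G.Adj b c ∨ G.Adj b d
    · left
      refine ⟨by omega, conn_lem G a ((hmem' a).2 haS) ?_⟩
      intro Q ha hQ x hx
      have hb := hQ a b ha hab
      have h1 : Q c ∨ Q d := by
        rcases hX with h | h | h | h
        · exact Or.inl (hQ _ _ ha h)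
        · exact Or.inr (hQ _ _ ha h)
        · exact Or.inl (hQ _ _ hb h)
        · exact Or.inr (hQ _ _ hb h)
      have hc' : Q c := by
        rcases h1 with h1 | h1
        · exact h1
        · refine hQ y c ?_ hy.symm
          rcases hyS with rfl | rfl | rfl | rfl
          · exact ha
          · exact hb
          · exact absurd rfl hyn
          · exact h1
      have hd' : Q d := by
        refine hQ z d ?_ hz.symm
        rcases hzS with rfl | rfl | rfl | rfl
        · exact ha
        · exact hb
        · exact hc'
        · exact absurd rfl hzn
      rcases (hST' x).1 ((hmem' x).1 hx) with rfl | rfl | rfl | rfl <;> assumption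
    · right
      push Not at hX
      obtain ⟨x1, x2, x3, x4⟩ := hX
      have y1 : ¬ G.Adj c a := fun h => x1 h.symm
      have y2 : ¬ G.Adj d a := fun h => x2 h.symm
      have y3 : ¬ G.Adj c b := fun h => x3 h.symm
      have y4 : ¬ G.Adj d b := fun h => x4 h.symm
      have hcdA : G.Adj c d := by
        rcases hyS with rfl | rfl | rfl | rfl
        · exact absurd hy y1
        · exact absurd hy y3
        · exact absurd rfl hyn
        · exact hy
      refine ⟨a, b, c, d, ?_, by omega, ?_⟩
      · simp; grind
      · ext e
        induction e with | _ u v =>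
        simp only [SimpleGraph.mem_edgeSet, Set.mem_singleton_iff, Sym2.eq_iff, Set.mem_insert_iff]
        constructor
        · intro huv
          have hn := huv.ne
          have h1 := (hST' u).1 (hadjS u v huv).1
          have h2 := (hST' v).1 (hadjS u v huv).2
          rcases h1 with rfl | rfl | rfl | rfl <;> rcases h2 with rfl | rfl | rfl | rfl <;>
            simp_all
        · have := hab.symm
          have := hcdA.symm
          rintro ((⟨rfl, rfl⟩ | ⟨rfl, rfl⟩) | (⟨rfl, rfl⟩ | ⟨rfl, rfl⟩)) <;> assumption

lemma copA_empty {ℓ : ℕ} (G : SimpleGraph (Fin ℓ)) (h : G.edgeSet = ∅) (n : ℕ) (p : ℝ)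
    (x y : Sym2 (Fin n) → Bool) : graphFactor G p x = graphFactor G p y := by
  rw [graphFactor_eq, graphFactor_eq]
  refine Finset.sum_congr rfl fun E hE => ?_
  obtain ⟨f, hf⟩ := (Finset.mem_filter.1 hE).2
  rw [h] at hf
  simp at hf
  simp [hf]

lemma copA_one {ℓ n : ℕ} (hn : ℓ ≤ n) (G : SimpleGraph (Fin ℓ)) (a b : Fin ℓ) (hab : a ≠ b)
    (h : G.edgeSet = {s(a, b)}) : copA G n = (ndA n).powersetCard 1 := by
  classical
  ext E
  simp only [copA, Finset.mem_filter, Finset.mem_univ, true_and, h, Set.image_singleton,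
    Finset.coe_eq_singleton, Finset.powersetCard_one, Finset.mem_map, Function.Embedding.coeFn_mk]
  constructor
  · rintro ⟨f, rfl⟩
    exact ⟨_, by simp [ndA, hab], rfl⟩
  · rintro ⟨e, he, rfl⟩
    induction e with | _ u v =>
    have huv : u ≠ v := by simpa [ndA] using he
    obtain ⟨g, hg⟩ := emb_extend hn (fun i => if i = a then u else v) {a, b} (by
      intro i hi j hj hij
      simp at hi hj hij
      grind)
    refine ⟨g, ?_⟩
    have h1 := hg a (by simp)
    have h2 := hg b (by simp)
    simp [hab.symm] at h1 h2
    simp [h1, h2]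

lemma copA_two {ℓ n : ℕ} (hn : ℓ ≤ n) (G : SimpleGraph (Fin ℓ)) (a b c d : Fin ℓ)
    (hab : [a, b, c, d].Nodup) (h : G.edgeSet = {s(a, b), s(c, d)}) :
    copA G n ⊆ (ndA n).powersetCard 2 ∧ ((ndA n).powersetCard 2 \ copA G n).card ≤ n ^ 3 := by
  classical
  simp only [List.nodup_cons, List.mem_cons, List.not_mem_nil, or_false, not_or,
    not_false_eq_true, List.nodup_nil, and_true] at hab
  obtain ⟨⟨ab, ac, ad⟩, ⟨bc, bd⟩, cd⟩ := hab
  have hcop : ∀ E, E ∈ copA G n ↔ ∃ f : Fin ℓ ↪ Fin n, E = {s(f a, f b), s(f c, f d)} := by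
    intro E
    simp only [copA, Finset.mem_filter, Finset.mem_univ, true_and, h, Set.image_pair, Sym2.map_mk]
    refine exists_congr fun f => ?_
    rw [← Finset.coe_inj]
    simp
  constructor
  · intro E hE
    obtain ⟨f, rfl⟩ := (hcop E).1 hE
    rw [Finset.mem_powersetCard]
    constructor
    · intro e he
      simp only [Finset.mem_insert, Finset.mem_singleton] at he
      rcases he with rfl | rfl <;> simp [ndA, ab, cd]
    · rw [Finset.card_pair]
      simp [ac, ad]
  · have : (ndA n).powersetCard 2 \ copA G n ⊆
        (Finset.univ : Finset (Fin n × Fin n × Fin n)).image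
          (fun q => ({s(q.1, q.2.1), s(q.1, q.2.2)} : Finset (Sym2 (Fin n)))) := by
      intro E hE
      rw [Finset.mem_sdiff, Finset.mem_powersetCard, Finset.card_eq_two] at hE
      obtain ⟨⟨hE1, e, e', hee, rfl⟩, hE2⟩ := hE
      have he := hE1 (Finset.mem_insert_self _ _)
      have he' := hE1 (Finset.mem_insert_of_mem (Finset.mem_singleton_self e'))
      induction e with | _ u v =>
      induction e' with | _ w z =>
      have huv : u ≠ v := by simpa [ndA] using he
      have hwz : w ≠ z := by simpa [ndA] using he'
      simp only [Finset.mem_image, Finset.mem_univ, true_and, Prod.exists]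
      by_cases h1 : u = w
      · exact ⟨u, v, z, by rw [h1]⟩
      by_cases h2 : u = z
      · exact ⟨u, v, w, by rw [h2, Sym2.eq_swap (a := w)]⟩
      by_cases h3 : v = w
      · exact ⟨v, u, z, by rw [h3, Sym2.eq_swap (a := u)]⟩
      by_cases h4 : v = z
      · exact ⟨v, u, w, by rw [h4, Sym2.eq_swap (a := u), Sym2.eq_swap (a := w)]⟩
      exfalso
      apply hE2
      rw [hcop]
      obtain ⟨g, hg⟩ := emb_extend hn (fun i => if i = a then u else if i = b then v else
        if i = c then w else z) {a, b, c, d} (by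
        intro i hi j hj hij
        simp at hi hj hij
        grind)
      have g1 := hg a (by simp)
      have g2 := hg b (by simp)
      have g3 := hg c (by simp)
      have g4 := hg d (by simp)
      simp [Ne.symm ab, Ne.symm ac, Ne.symm bc, Ne.symm ad, Ne.symm bd, Ne.symm cd] at g1 g2 g3 g4
      exact ⟨g, by rw [g1, g2, g3, g4]⟩
    refine (Finset.card_le_card this).trans (Finset.card_image_le.trans ?_)
    simp [pow_succ, mul_assoc]

lemma coef_bound {n ℓ v k w : ℕ} (hw : w + k ≤ 2 * v) (hv : v ≤ ℓ) (hn : 1 ≤ n) (φ V : ℝ)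
    (hV : V ≤ (n : ℝ) ^ w) :
    (((n - v).choose (ℓ - v) : ℕ) * φ) ^ 2 * V ≤ φ ^ 2 * (n : ℝ) ^ (2 * ℓ - k) := by
  have hn' : (1 : ℝ) ≤ n := by exact_mod_cast hn
  have h1 : (((n - v).choose (ℓ - v) : ℕ) : ℝ) ≤ (n : ℝ) ^ (ℓ - v) := by
    exact_mod_cast (Nat.choose_le_pow _ _).trans (Nat.pow_le_pow_left (Nat.sub_le _ _) _)
  calc (((n - v).choose (ℓ - v) : ℕ) * φ) ^ 2 * V
      ≤ (((n - v).choose (ℓ - v) : ℕ) * φ) ^ 2 * (n : ℝ) ^ w := by gcongr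
    _ = φ ^ 2 * ((((n - v).choose (ℓ - v) : ℕ) : ℝ) ^ 2 * (n : ℝ) ^ w) := by ring
    _ ≤ φ ^ 2 * (((n : ℝ) ^ (ℓ - v)) ^ 2 * (n : ℝ) ^ w) := by gcongr
    _ = φ ^ 2 * (n : ℝ) ^ ((ℓ - v) * 2 + w) := by rw [← pow_mul, ← pow_add]
    _ ≤ φ ^ 2 * (n : ℝ) ^ (2 * ℓ - k) := by
      gcongr
      omega

lemma per_graph {ℓ : ℕ} {p : ℝ} (hp : p ∈ Set.Ioo (0 : ℝ) 1) (G : SimpleGraph (Fin ℓ)) (φ : ℝ)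
    (h : (G.induce G.support).Connected →
      (Nat.card G.support = 3 ∨ Nat.card G.support = 4) → φ = 0) {n : ℕ} (hn : ℓ ≤ n)
    (hn1 : 1 ≤ n) :
    ∃ g : ℕ → ℝ, ∑ x : Sym2 (Fin n) → Bool, wtA p x *
      (((n - Nat.card G.support).choose (ℓ - Nat.card G.support) : ℕ) * φ * graphFactor G p x
        - g (mA x)) ^ 2 ≤ φ ^ 2 * (n : ℝ) ^ (2 * ℓ - 5) := by
  classical
  have hvℓ : Nat.card G.support ≤ ℓ := by
    have := Nat.card_le_card_of_injective (Subtype.val : G.support → Fin ℓ) Subtype.val_injective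
    simpa using this
  have hrhs : 0 ≤ φ ^ 2 * (n : ℝ) ^ (2 * ℓ - 5) := by positivity
  -- general: remainder is a chaos
  have gen : ∀ (A : ℝ) (S : Finset (Finset (Sym2 (Fin n)))),
      ∑ x : Sym2 (Fin n) → Bool, wtA p x * (A * ∑ E ∈ S, ∏ e ∈ E, chiA p (x e)) ^ 2
        = A ^ 2 * S.card := by
    intro A S
    rw [← chi_var hp S, Finset.mul_sum]
    refine Finset.sum_congr rfl fun x _ => ?_
    ring
  generalize hA : (((n - Nat.card G.support).choose (ℓ - Nat.card G.support) : ℕ) : ℝ) * φ = A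
  by_cases h4 : Nat.card G.support ≤ 4
  · rcases small_support G h4 with h0 | ⟨a, b, hab, hc, he⟩ | ⟨h34, hcon⟩ | ⟨a, b, c, d, hab, hc, he⟩
    · refine ⟨fun _ => A * graphFactor G p (n := n) (fun _ => true), ?_⟩
      refine le_trans (le_of_eq ?_) hrhs
      refine Finset.sum_eq_zero fun x _ => ?_
      rw [copA_empty G h0 n p x (fun _ => true)]
      simp
    · refine ⟨fun m => A * ((m - p * (ndA n).card) / Real.sqrt (p * (1 - p))), ?_⟩
      refine le_trans (le_of_eq ?_) hrhs
      refine Finset.sum_eq_zero fun x _ => ?_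
      beta_reduce
      rw [graphFactor_eq, copA_one hn G a b hab he, ← gamma_m, Finset.powersetCard_one]
      simp
    · refine ⟨fun _ => 0, ?_⟩
      refine le_trans (le_of_eq ?_) hrhs
      refine Finset.sum_eq_zero fun x _ => ?_
      rw [← hA, h hcon h34]
      simp
    · obtain ⟨hs, hcard⟩ := copA_two hn G a b c d hab he
      refine ⟨fun m => A * ((((ndA n).card * chiA p false + m * (chiA p true - chiA p false)) ^ 2
        - ((ndA n).card * chiA p false ^ 2 + m * (chiA p true ^ 2 - chiA p false ^ 2))) / 2), ?_⟩
      have : ∀ x : Sym2 (Fin n) → Bool, wtA p x * (A * graphFactor G p x -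
        A * ((((ndA n).card * chiA p false + mA x * (chiA p true - chiA p false)) ^ 2
        - ((ndA n).card * chiA p false ^ 2 + mA x * (chiA p true ^ 2 - chiA p false ^ 2))) / 2)) ^ 2
        = wtA p x * (A * ∑ E ∈ (ndA n).powersetCard 2 \ copA G n, ∏ e ∈ E, chiA p (x e)) ^ 2 := by
        intro x
        have h1 := Finset.sum_sdiff (f := fun E => ∏ e ∈ E, chiA p (x e)) hs
        rw [e2_formula, sum_fun_m x (chiA p), sum_fun_m x (fun b => chiA p b ^ 2),
          ← graphFactor_eq] at h1
        rw [← h1]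
        ring
      rw [Finset.sum_congr rfl fun x _ => this x, gen, ← hA]
      exact coef_bound (w := 3) (by omega) hvℓ hn1 _ _ (by exact_mod_cast hcard)
  · refine ⟨fun _ => 0, ?_⟩
    simp only [sub_zero, graphFactor_eq]
    rw [gen, ← hA]
    exact coef_bound (w := Nat.card G.support) (by omega) hvℓ hn1 _ _
      (by exact_mod_cast copA_card G n)

lemma combine {α : Type*} [Fintype α] (w : α → ℝ) (hw : ∀ x, 0 ≤ w x) {κ : Type*} (s : Finset κ)
    (f : κ → α → ℝ) (c : κ → ℝ) (h : ∀ k ∈ s, ∑ x, w x * f k x ^ 2 ≤ c k) :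
    ∑ x, w x * (∑ k ∈ s, f k x) ^ 2 ≤ s.card * ∑ k ∈ s, c k := by
  calc ∑ x, w x * (∑ k ∈ s, f k x) ^ 2 ≤ ∑ x, w x * (s.card * ∑ k ∈ s, f k x ^ 2) := by
        refine Finset.sum_le_sum fun x _ => mul_le_mul_of_nonneg_left ?_ (hw x)
        exact sq_sum_le_card_mul_sum_sq
    _ = s.card * ∑ k ∈ s, ∑ x, w x * f k x ^ 2 := by
        rw [Finset.sum_comm, Finset.mul_sum]
        refine Finset.sum_congr rfl fun x _ => ?_
        rw [← Finset.mul_sum]; ring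
    _ ≤ _ := by
        gcongr with k hk
        exact h k hk

lemma cheb {α : Type*} [Fintype α] (w : α → ℝ) (hw : ∀ x, 0 ≤ w x) (f : α → ℝ) (K : ℝ)
    (hK : 0 < K) (h : ∑ x, w x * f x ^ 2 ≤ K ^ 2 / 4) :
    ∑ x with K < |f x|, w x ≤ 1 / 4 := by
  have h1 : K ^ 2 * ∑ x with K < |f x|, w x ≤ ∑ x, w x * f x ^ 2 := by
    rw [Finset.mul_sum]
    calc ∑ x with K < |f x|, K ^ 2 * w x ≤ ∑ x with K < |f x|, w x * f x ^ 2 := by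
          refine Finset.sum_le_sum fun x hx => ?_
          rw [mul_comm]
          refine mul_le_mul_of_nonneg_left ?_ (hw x)
          rw [← sq_abs (f x)]
          have := (Finset.mem_filter.1 hx).2
          gcongr
      _ ≤ _ := Finset.sum_le_sum_of_subset_of_nonneg (Finset.subset_univ _)
          fun x _ _ => mul_nonneg (hw x) (sq_nonneg _)
  have : 0 < K ^ 2 := by positivity
  have h2 := h1.trans h
  by_contra hc
  push Not at hc
  nlinarith

lemma int_count (a K : ℝ) (hK : 0 ≤ K) :
    ((Finset.Icc ⌈a - K⌉ ⌊a + K⌋).card : ℝ) ≤ 2 * K + 1 := by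
  rw [Int.card_Icc]
  have h1 := Int.le_ceil (a - K)
  have h2 := Int.floor_le (a + K)
  by_cases h : 0 ≤ ⌊a + K⌋ + 1 - ⌈a - K⌉
  · have : (((⌊a + K⌋ + 1 - ⌈a - K⌉).toNat : ℤ) : ℝ) = ((⌊a + K⌋ + 1 - ⌈a - K⌉ : ℤ) : ℝ) := by
      rw [Int.toNat_of_nonneg h]
    rw [Int.cast_natCast] at this
    rw [this]
    push_cast
    linarith
  · rw [Int.toNat_of_nonpos (by omega)]
    push_cast
    linarith

/-- Pigeonhole. -/
lemma pigeon_s8 {α : Type*} [Fintype α] (w : α → ℝ) (hw : ∀ x, 0 ≤ w x) (hw1 : ∑ x, w x = 1)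
    (m : α → ℕ) (F R : α → ℝ) (g : ℕ → ℝ) (hF : ∀ x, ∃ z : ℤ, F x = z)
    (hR : ∀ x, R x = F x - g (m x)) (μ L K : ℝ) (hL : 0 < L) (hK : 0 < K)
    (h1 : ∑ x, w x * ((m x : ℝ) - μ) ^ 2 ≤ L ^ 2 / 4)
    (h2 : ∑ x, w x * R x ^ 2 ≤ K ^ 2 / 4) :
    ∃ y : ℤ, 1 / (2 * ((2 * L + 1) * (2 * K + 1))) ≤ ∑ x with F x = y, w x := by
  classical
  have c1 := cheb w hw _ L hL h1
  have c2 := cheb w hw _ K hK h2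
  let A : Finset α := Finset.univ.filter fun x => |(m x : ℝ) - μ| ≤ L ∧ |R x| ≤ K
  have hA : 1 / 2 ≤ ∑ x ∈ A, w x := by
    have : (1 : ℝ) ≤ ∑ x ∈ A, w x + (∑ x with L < |(m x : ℝ) - μ|, w x + ∑ x with K < |R x|, w x) := by
      rw [← hw1, Finset.sum_filter, Finset.sum_filter, Finset.sum_filter, ← Finset.sum_add_distrib,
        ← Finset.sum_add_distrib]
      refine Finset.sum_le_sum fun x _ => ?_
      have := hw x
      by_cases a1 : |(m x : ℝ) - μ| ≤ L
      · by_cases a2 : |R x| ≤ K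
        · simp [a1, a2, not_lt.2 a1, not_lt.2 a2]
        · simp [a1, a2, not_lt.2 a1, not_le.1 a2]
      · have a1' := not_le.1 a1
        simp only [a1, a1', false_and, if_true, if_false]
        split_ifs <;> linarith
    linarith
  choose z hz using hF
  let M : Finset ℤ := Finset.Icc ⌈μ - L⌉ ⌊μ + L⌋
  let T : Finset ℤ := M.biUnion fun k => Finset.Icc ⌈g k.toNat - K⌉ ⌊g k.toNat + K⌋
  have hT : (T.card : ℝ) ≤ (2 * L + 1) * (2 * K + 1) := by
    calc (T.card : ℝ) ≤ ((∑ k ∈ M, (Finset.Icc ⌈g k.toNat - K⌉ ⌊g k.toNat + K⌋).card : ℕ) : ℝ) := by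
          exact_mod_cast Finset.card_biUnion_le
      _ ≤ ∑ k ∈ M, (2 * K + 1) := by
          push_cast
          exact Finset.sum_le_sum fun k _ => int_count _ _ hK.le
      _ = M.card * (2 * K + 1) := by rw [Finset.sum_const, nsmul_eq_mul]
      _ ≤ _ := by
          have := int_count μ L hL.le
          gcongr
  have hzT : ∀ x ∈ A, z x ∈ T := by
    intro x hx
    obtain ⟨-, a1, a2⟩ := Finset.mem_filter.1 hx
    rw [abs_le] at a1 a2
    refine Finset.mem_biUnion.2 ⟨(m x : ℤ), ?_, ?_⟩
    · rw [Finset.mem_Icc, Int.ceil_le, Int.le_floor]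
      push_cast
      constructor <;> linarith
    · rw [Finset.mem_Icc, Int.ceil_le, Int.le_floor, Int.toNat_natCast, ← hz x]
      have := hR x
      constructor <;> linarith
  have hsum : ∑ x ∈ A, w x ≤ ∑ y ∈ T, ∑ x with F x = y, w x := by
    rw [← Finset.sum_fiberwise_of_maps_to hzT]
    refine Finset.sum_le_sum fun y _ => ?_
    refine Finset.sum_le_sum_of_subset_of_nonneg ?_ fun x _ _ => hw x
    intro x hx
    have := (Finset.mem_filter.1 hx).2
    simp [hz x, this]
  by_contra hc
  push Not at hc
  have hD : 0 < (2 * L + 1) * (2 * K + 1) := by positivity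
  have hTne : T.Nonempty := by
    by_contra h
    rw [Finset.not_nonempty_iff_eq_empty] at h
    rw [h, Finset.sum_empty] at hsum
    linarith
  have := Finset.sum_lt_sum_of_nonempty hTne fun y _ => hc y
  rw [Finset.sum_const, nsmul_eq_mul] at this
  have h3 : (T.card : ℝ) * (1 / (2 * ((2 * L + 1) * (2 * K + 1)))) ≤ 1 / 2 := by
    rw [mul_one_div, div_le_div_iff₀ (by positivity) (by norm_num)]
    linarith
  linarith

theorem anticoncentration_counterexample
    (ℓ : ℕ) (hℓ : 4 ≤ ℓ) (p : ℝ) (hp : p ∈ Set.Ioo (0 : ℝ) 1)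
    -- `ℋ` is a complete irredundant set of representatives of the isomorphism classes of
    -- graphs with no isolated vertices on at most `ℓ` vertices (each padded with isolated
    -- vertices to a graph on `Fin ℓ`; the number of non-isolated vertices is `Nat.card G.support`)
    (ℋ : Finset (SimpleGraph (Fin ℓ)))
    (hrep : ∀ G : SimpleGraph (Fin ℓ), ∃! G', G' ∈ ℋ ∧ Nonempty (G ≃g G'))
    (Φ : SimpleGraph (Fin ℓ) → ℝ)
    -- (i) `Φ_H = 0` for all connected graphs on 3 and 4 vertices
    (hconn34 : ∀ G ∈ ℋ, (G.induce G.support).Connected →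
      (Nat.card G.support = 3 ∨ Nat.card G.support = 4) → Φ G = 0)
    -- (ii) `Φ_H ≠ 0` for `H` an edge and for `H` the disjoint union of two edges
    (hK2 : ∀ G ∈ ℋ, Nonempty (G ≃g singleEdgeGraph ℓ hℓ) → Φ G ≠ 0)
    (h2K2 : ∀ G ∈ ℋ, Nonempty (G ≃g twoEdgesGraph ℓ hℓ) → Φ G ≠ 0)
    (F : ∀ n : ℕ, (Sym2 (Fin n) → Bool) → ℝ)
    (hF : ∀ (n : ℕ) (x : Sym2 (Fin n) → Bool),
      F n x = ∑ G ∈ ℋ, ((n - Nat.card G.support).choose (ℓ - Nat.card G.support) : ℝ) *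
        Φ G * graphFactor G p x)
    -- `F` is integer valued
    (hint : ∀ n : ℕ, ∀ᵐ x ∂(gnp n p), ∃ z : ℤ, F n x = (z : ℝ)) :
    ∃ c : ℝ, 0 < c ∧ ∃ N : ℕ, ∀ n : ℕ, N ≤ n → ∃ y : ℤ,
      c * (n : ℝ) ^ ((3 : ℝ) / 2 - (ℓ : ℝ)) ≤ (gnp n p {x | F n x = (y : ℝ)}).toReal := by
  classical
  obtain ⟨C, hC0, hC⟩ : ∃ C : ℝ, 0 ≤ C ∧ C = ℋ.card * ∑ G ∈ ℋ, Φ G ^ 2 :=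
    ⟨_, by positivity, rfl⟩
  have hp1 := hp.1
  have hp2 := hp.2
  have hσ : 0 < p * (1 - p) := mul_pos hp1 (by linarith)
  obtain ⟨D, hD1, hDC⟩ : ∃ D : ℝ, 1 ≤ D ∧ 4 * C ≤ D ^ 2 := ⟨4 * C + 1, by linarith, by nlinarith⟩
  refine ⟨1 / (30 * D), by positivity, ℓ, fun n hn => ?_⟩
  have hn1 : 1 ≤ n := by omega
  have hn1' : (1 : ℝ) ≤ n := by exact_mod_cast hn1
  have hn0 : (0 : ℝ) < n := by linarith
  have hℓ' : (4 : ℝ) ≤ ℓ := by exact_mod_cast hℓ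
  have hg : ∀ G : SimpleGraph (Fin ℓ), ∃ g : ℕ → ℝ, G ∈ ℋ →
      ∑ x : Sym2 (Fin n) → Bool, wtA p x *
      (((n - Nat.card G.support).choose (ℓ - Nat.card G.support) : ℕ) * Φ G * graphFactor G p x
        - g (mA x)) ^ 2 ≤ Φ G ^ 2 * (n : ℝ) ^ (2 * ℓ - 5) := by
    intro G
    by_cases hG : G ∈ ℋ
    · obtain ⟨g, hg⟩ := per_graph hp G (Φ G) (hconn34 G hG) hn hn1
      exact ⟨g, fun _ => hg⟩
    · exact ⟨fun _ => 0, fun h => absurd h hG⟩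
  choose g hg using hg
  have hcomb := combine (wtA p) (fun x => (wtA_pos hp x).le) ℋ
    (fun G (x : Sym2 (Fin n) → Bool) =>
      ((n - Nat.card G.support).choose (ℓ - Nat.card G.support) : ℕ) * Φ G * graphFactor G p x
        - g G (mA x)) _ hg
  rw [← Finset.sum_mul, ← mul_assoc, ← hC] at hcomb
  have hrp : ((n : ℝ) ^ ((ℓ : ℝ) - 5 / 2)) ^ 2 = (n : ℝ) ^ (2 * ℓ - 5) := by
    rw [← Real.rpow_natCast, ← Real.rpow_natCast, ← Real.rpow_mul hn0.le, Nat.cast_sub (by omega)]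
    congr 1
    push_cast
    ring
  set K : ℝ := D * (n : ℝ) ^ ((ℓ : ℝ) - 5 / 2) with hKdef
  have hr1 : 1 ≤ (n : ℝ) ^ ((ℓ : ℝ) - 5 / 2) := Real.one_le_rpow hn1' (by linarith)
  have hK1 : 1 ≤ K := by nlinarith
  have hKsq : C * (n : ℝ) ^ (2 * ℓ - 5) ≤ K ^ 2 / 4 := by
    rw [hKdef, mul_pow, hrp]
    have : 0 ≤ (n : ℝ) ^ (2 * ℓ - 5) := by positivity
    nlinarith
  have hm : ∑ x : Sym2 (Fin n) → Bool, wtA p x * ((mA x : ℝ) - p * (ndA n).card) ^ 2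
      ≤ (2 * (n : ℝ)) ^ 2 / 4 := by
    have h1 := gamma_var (n := n) hp
    have h2 : ∑ x : Sym2 (Fin n) → Bool, wtA p x * ((mA x : ℝ) - p * (ndA n).card) ^ 2
        = (p * (1 - p)) * ∑ x : Sym2 (Fin n) → Bool, wtA p x * (∑ e ∈ ndA n, chiA p (x e)) ^ 2 := by
      rw [Finset.mul_sum]
      refine Finset.sum_congr rfl fun x _ => ?_
      rw [gamma_m, div_pow, Real.sq_sqrt hσ.le]
      field_simp
    rw [h2]
    have h3 : p * (1 - p) ≤ 1 := by nlinarith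
    have : (0 : ℝ) ≤ (n : ℝ) ^ 2 := by positivity
    nlinarith
  obtain ⟨y, hy⟩ := pigeon_s8 (wtA p) (fun x => (wtA_pos hp x).le) (wtA_sum p) mA (F n)
    (fun x => F n x - ∑ G ∈ ℋ, g G (mA x)) (fun m => ∑ G ∈ ℋ, g G m)
    (all_of_ae hp n _ (hint n)) (fun x => rfl) (p * (ndA n).card) (2 * n) K (by linarith)
    (by linarith) hm (by
      refine le_trans (le_of_eq ?_) (hcomb.trans hKsq)
      refine Finset.sum_congr rfl fun x _ => ?_
      rw [hF, Finset.sum_sub_distrib])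
  refine ⟨y, ?_⟩
  rw [gnp_toReal hp]
  have hfin : ∑ x with F n x = y, wtA p x = ∑ x, if x ∈ {x | F n x = (y : ℝ)} then wtA p x else 0 := by
    rw [Finset.sum_filter]
    rfl
  refine le_trans ?_ (hy.trans (le_of_eq ?_))
  · have e1 : (n : ℝ) ^ ((3 : ℝ) / 2 - (ℓ : ℝ)) = 1 / (n * (n : ℝ) ^ ((ℓ : ℝ) - 5 / 2)) := by
      rw [one_div, ← Real.rpow_one_add' hn0.le (by linarith), ← Real.rpow_neg hn0.le]
      congr 1
      ring
    rw [e1, one_div_mul_one_div]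
    refine one_div_le_one_div_of_le (by positivity) ?_
    have : (2 * (2 * (n : ℝ)) + 1) * (2 * K + 1) ≤ (5 * n) * (3 * K) := by
      gcongr <;> linarith
    calc _ ≤ 2 * ((5 * (n : ℝ)) * (3 * K)) := by linarith
      _ = _ := by rw [hKdef]; ring
  · rw [hfin]
end
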